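/- arXiv:1109.4986 — 5 statements merged into one kernel-verified Lean document; each statement's English description precedes it below -/
import Mathlib

section
/- For every m ≥ 2 and all integer weights λ_1,…,λ_k, ν_1,…,ν_k with Σ_{i=1}^k (λ_i + ν_i) = 0, there exists a monomial basis of V_m of nonpositive weight. (By the Kempf–Morrison criterion, this is the combinatorial content of Theorem 4.9: all Hilbert points [C]_m, m ≥ 2, of the canonically embedded balanced double A_{2k+1}-curve of genus g = 2k are semistable.) -/
/-!
The combinatorial content of Theorem 4.9 (semistability of all Hilbert points of the
canonically embedded balanced double `A_{2k+1}`-curve of genus `g = 2k`): for every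
`m ≥ 2` and all integer weights `λ₁,…,λ_k, ν₁,…,ν_k` with `Σ (λᵢ + νᵢ) = 0`, there
exists a monomial basis of `V_m` of nonpositive weight.
-/

noncomputable section

/-- The field `ℂ(u)` of rational functions. -/
abbrev K : Type := RatFunc ℂ

/-- The product ring `T = ℂ(u) × ℂ(u) × ℂ(u)`. -/
abbrev T3 : Type := K × K × K

/-- `x_i := (u^(i-1), u^(-i-1), 0)`. -/
def xA (i : ℕ) : T3 :=
  (RatFunc.X ^ ((i : ℤ) - 1), RatFunc.X ^ (-(i : ℤ) - 1), 0)

/-- `y_i := (0, u^(i-1), u^(-i-1))`. -/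
def yA (i : ℕ) : T3 :=
  (0, RatFunc.X ^ ((i : ℤ) - 1), RatFunc.X ^ (-(i : ℤ) - 1))

/-- The `2k` variables `x_1,…,x_k,y_1,…,y_k`, indexed by `Fin k ⊕ Fin k`. -/
def varA (k : ℕ) : Fin k ⊕ Fin k → T3 :=
  Sum.elim (fun i => xA ((i : ℕ) + 1)) (fun i => yA ((i : ℕ) + 1))

/-- `V_m`: the `ℂ`-span of all degree-`m` monomials in the variables `x_i, y_i`. -/
def VA (k m : ℕ) : Submodule ℂ T3 :=
  Submodule.span ℂ
    {t : T3 | ∃ σ : Multiset (Fin k ⊕ Fin k), Multiset.card σ = m ∧ t = (σ.map (varA k)).prod}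

/-- Degree-`m` monomials, as multisets of `m` variable indices. -/
abbrev DegMonA (k m : ℕ) := Sym (Fin k ⊕ Fin k) m

/-- A finite set of degree-`m` monomials is a monomial basis of `V_m` if its images in
`T` are linearly independent over `ℂ` and span `V_m`. -/
def IsMonBasisA (k m : ℕ) (S : Finset (DegMonA k m)) : Prop :=
  LinearIndependent ℂ (fun s : S => (((s : DegMonA k m)).1.map (varA k)).prod) ∧
  Submodule.span ℂ ((fun s : DegMonA k m => (s.1.map (varA k)).prod) '' S) = VA k m

/-- The weight of a monomial, given weights `λ` on the `x`'s and `ν` on the `y`'s. -/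
def wtA {k m : ℕ} (lam nu : Fin k → ℤ) (σ : DegMonA k m) : ℤ :=
  (σ.1.map (Sum.elim lam nu)).sum


section
open Finset

theorem sum_range_mul_eq (f : ℕ → ℚ) (a b : ℕ) :
    ∑ t ∈ range (a * b), f t = ∑ i ∈ range a, ∑ j ∈ range b, f (i * b + j) := by
  induction a with
  | zero => simp
  | succ a ih => rw [Nat.succ_mul, sum_range_add, ih, sum_range_succ]

theorem sum_range_id_rat (m : ℕ) : ∑ r ∈ range m, (r : ℚ) = m * (m - 1) / 2 := by
  induction m with
  | zero => simp
  | succ a ih => rw [sum_range_succ, ih]; push_cast; ring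

/-- `Ψ` is bounded by the weights of pure monomials of degree `m` in the letters `0, …, N`. -/
def PureBound (N m : ℕ) (z Ψ : ℕ → ℚ) : Prop :=
  ∀ A : Multiset ℕ, (∀ a ∈ A, a ≤ N) → A.card = m → Ψ A.sum ≤ (A.map z).sum

/-- `Φ` is bounded by the weights of mixed monomials of degree `m`: the negative part is `A`, the
positive part is `B`, and the letter `i` has value `i + 1`. -/
def MixedBound (N m : ℕ) (z Φ : ℕ → ℚ) : Prop :=
  ∀ A B : Multiset ℕ, (∀ a ∈ A, a ≤ N) → (∀ b ∈ B, b ≤ N) → A ≠ 0 → B ≠ 0 →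
    A.card + B.card = m → ∀ d, B.sum + B.card = A.sum + A.card + d →
    Φ d ≤ (A.map z).sum + (B.map z).sum

theorem PureBound.sum_le_adjacent {N m : ℕ} {z Ψ : ℕ → ℚ} (h : PureBound N m z Ψ)
    (hz : ∑ i ∈ range (N + 1), z i = 0) :
    ∑ t ∈ range (m * N + 1), Ψ t ≤ -(m * (m - 1) / 2) * (z 0 + z N) := by
  have h0 : Ψ 0 ≤ m * z 0 := by
    simpa using h (Multiset.replicate m 0) (by simp [Multiset.mem_replicate]) (by simp)
  have h1 : ∀ q ∈ range N, ∑ j ∈ range m, Ψ (q * m + j + 1) ≤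
      m * (m + 1) / 2 * z (q + 1) + m * (m - 1) / 2 * z q := by
    intro q hq
    have : ∀ j ∈ range m, Ψ (q * m + j + 1) ≤ (j + 1) * z (q + 1) + (m - 1 - j) * z q := by
      intro j hj
      simp only [mem_range] at hq hj
      obtain ⟨i, rfl⟩ : ∃ i, m = j + 1 + i := ⟨m - (j + 1), by omega⟩
      have := h (Multiset.replicate (j + 1) (q + 1) + Multiset.replicate i q)
        (by simp only [Multiset.mem_add, Multiset.mem_replicate]; omega) (by simp; omega)
      simp only [Multiset.sum_add, Multiset.sum_replicate, Multiset.map_add,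
        Multiset.map_replicate, smul_eq_mul, nsmul_eq_mul] at this
      have e : (j + 1) * (q + 1) + i * q = q * (j + 1 + i) + j + 1 := by ring
      rw [e] at this
      push_cast at this ⊢
      linarith
    refine (sum_le_sum this).trans (le_of_eq ?_)
    rw [sum_add_distrib, ← sum_mul, ← sum_mul]
    simp only [sum_add_distrib, sum_sub_distrib, sum_range_id_rat, sum_const, card_range,
      nsmul_eq_mul]
    ring
  rw [mul_comm m N, sum_range_succ', sum_range_mul_eq (fun t => Ψ (t + 1))]
  have h2 := sum_le_sum h1
  rw [sum_add_distrib, ← mul_sum, ← mul_sum] at h2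
  have e1 := sum_range_succ' z N
  have e2 := sum_range_succ z N
  rw [hz] at e1 e2
  have e1' : ∑ k ∈ range N, z (k + 1) = - z 0 := by linarith
  have e2' : ∑ k ∈ range N, z k = - z N := by linarith
  rw [e1', e2'] at h2
  linarith

theorem PureBound.sum_le_extremal {N m : ℕ} {z Ψ : ℕ → ℚ} (h : PureBound N m z Ψ)
    (hz : ∑ i ∈ range (N + 1), z i = 0) :
    ∑ t ∈ range (m * N + 1), Ψ t ≤ N * (m * (m - 1) / 2) * (z 0 + z N) := by
  have h0 : Ψ 0 ≤ m * z 0 := by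
    simpa using h (Multiset.replicate m 0) (by simp [Multiset.mem_replicate]) (by simp)
  have h1 : ∀ j ∈ range m, ∑ i ∈ range N, Ψ (j * N + i + 1) ≤
      N * ((m - 1 - j) * z 0 + j * z N) - z 0 := by
    intro j hj
    have : ∀ i ∈ range N, Ψ (j * N + i + 1) ≤ ((m - 1 - j) * z 0 + j * z N) + z (i + 1) := by
      intro i hi
      simp only [mem_range] at hi hj
      obtain ⟨l, rfl⟩ : ∃ l, m = j + 1 + l := ⟨m - (j + 1), by omega⟩
      have := h (Multiset.replicate l 0 + Multiset.replicate j N + {i + 1})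
        (by simp only [Multiset.mem_add, Multiset.mem_replicate, Multiset.mem_singleton]; omega)
        (by simp; omega)
      simp only [Multiset.sum_add, Multiset.sum_replicate, Multiset.map_add,
        Multiset.map_replicate, smul_eq_mul, nsmul_eq_mul, Multiset.sum_singleton,
        Multiset.map_singleton, mul_zero, zero_add] at this
      rw [← add_assoc] at this
      push_cast at this ⊢
      linarith
    refine (sum_le_sum this).trans (le_of_eq ?_)
    have e1 := sum_range_succ' z N
    rw [hz] at e1
    rw [sum_add_distrib, sum_const, card_range, nsmul_eq_mul]
    linarith
  rw [sum_range_succ', sum_range_mul_eq (fun t => Ψ (t + 1))]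
  refine (add_le_add (sum_le_sum h1) h0).trans (le_of_eq ?_)
  rw [sum_sub_distrib, ← mul_sum, sum_add_distrib, ← sum_mul, ← sum_mul]
  simp only [sum_sub_distrib, sum_range_id_rat, sum_const, card_range, nsmul_eq_mul]
  ring

/-- The mean weight of the two most balanced pairs of letters that realise the difference `δ`. -/
def pairWeight (N : ℕ) (z : ℕ → ℚ) (δ : ℕ) : ℚ :=
  (z ((N - δ) / 2) + z ((N - δ + 1) / 2) + z ((N + δ) / 2) + z ((N + δ + 1) / 2)) / 2

theorem sum_half_steps (z : ℕ → ℚ) (N : ℕ) :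
    ∑ x ∈ range (2 * N + 1), (z (x / 2) + z ((x + 1) / 2)) =
      4 * ∑ i ∈ range (N + 1), z i - z 0 - z N := by
  induction N with
  | zero => simp; ring
  | succ N ih =>
    rw [show 2 * (N + 1) + 1 = 2 * N + 1 + 1 + 1 by ring, sum_range_succ, sum_range_succ, ih,
      sum_range_succ _ (N + 1)]
    rw [show (2 * N + 1) / 2 = N by omega, show (2 * N + 1 + 1) / 2 = N + 1 by omega,
      show (2 * N + 1 + 1 + 1) / 2 = N + 1 by omega]
    ring

theorem sum_pairWeight (z : ℕ → ℚ) (N : ℕ) (hz : ∑ i ∈ range (N + 1), z i = 0) :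
    2 * ∑ δ ∈ range (N + 1), pairWeight N z δ = pairWeight N z 0 - (z 0 + z N) := by
  have h := sum_half_steps z N
  rw [hz] at h
  set f : ℕ → ℚ := fun x => z (x / 2) + z ((x + 1) / 2) with hf
  have e : ∀ δ, pairWeight N z δ = (f (N - δ) + f (N + δ)) / 2 := by
    intro δ; simp only [pairWeight, hf]; ring
  have h1 : ∑ δ ∈ range (N + 1), f (N - δ) = ∑ x ∈ range (N + 1), f x := by
    simpa using sum_range_reflect f (N + 1)
  have h2 : ∑ x ∈ range (2 * N + 1), f x =
      ∑ x ∈ range (N + 1), f x + ∑ δ ∈ range (N + 1), f (N + δ) - f N := by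
    rw [show 2 * N + 1 = N + (N + 1) by ring, sum_range_add, sum_range_succ f N]
    ring
  simp only [e]
  rw [← sum_div, sum_add_distrib, h1]
  simp only [Nat.sub_zero, Nat.add_zero]
  have h' : ∑ x ∈ range (2 * N + 1), f x = - z 0 - z N := by rw [h]; ring
  linarith

theorem pairWeight_self (z : ℕ → ℚ) (N : ℕ) : pairWeight N z N = z 0 + z N := by
  unfold pairWeight
  rw [show (N - N) / 2 = 0 by omega, show (N - N + 1) / 2 = 0 by omega,
    show (N + N) / 2 = N by omega, show (N + N + 1) / 2 = N by omega]
  ring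

theorem MixedBound.le_pairWeight {N n : ℕ} {z Φ : ℕ → ℚ} (h : MixedBound N (n + 2) z Φ)
    (C : Multiset ℕ) (hC : ∀ c ∈ C, c ≤ N) (hn : C.card = n) (δ : ℕ) (hδ : δ ≤ N) :
    Φ (C.sum + n + δ) ≤ (C.map z).sum + pairWeight N z δ := by
  have key : ∀ a b, b = a + δ → b ≤ N → Φ (C.sum + n + δ) ≤ (C.map z).sum + (z a + z b) := by
    intro a b hab hb
    have := h {a} (b ::ₘ C) (by simp; omega)
      (by intro c hc; rcases Multiset.mem_cons.1 hc with rfl | hc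
          · exact hb
          · exact hC c hc)
      (by simp) (by simp) (by simp; omega) (C.sum + n + δ)
      (by simp only [Multiset.sum_cons, Multiset.card_cons, Multiset.sum_singleton,
            Multiset.card_singleton]; omega)
    simp only [Multiset.map_cons, Multiset.sum_cons, Multiset.map_singleton,
      Multiset.sum_singleton] at this
    linarith
  have h1 := key ((N - δ) / 2) ((N + δ) / 2) (by omega) (by omega)
  have h2 := key ((N - δ + 1) / 2) ((N + δ + 1) / 2) (by omega) (by omega)
  unfold pairWeight
  linarith

/-- The sum over one block of `n + 1` consecutive differences. -/
theorem MixedBound.sum_block_le {N n : ℕ} {z Φ : ℕ → ℚ} (h : MixedBound N (n + 2) z Φ)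
    (q : ℕ) (hq : q < N) :
    2 * ∑ j ∈ range (n + 1), Φ ((q + 1) * (n + 1) + j) ≤
      n * ((n + 2) * z (q + 1) + n * z q) + (n + 2) * pairWeight N z (q + 1)
        + n * pairWeight N z q := by
  have key : ∀ r ∈ range (n + 1), (n + 1) * Φ ((q + 1) * (n + 1) + (n + 1 - 1 - r)) ≤
      n * ((n + 1 - r) * z (q + 1) + r * z q) + (n + 1 - r) * pairWeight N z (q + 1)
        + r * pairWeight N z q := by
    intro r hr
    simp only [mem_range] at hr
    obtain ⟨i, rfl⟩ : ∃ i, n = r + i := ⟨n - r, by omega⟩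
    have e0 : (q + 1) * (r + i + 1) + (r + i + 1 - 1 - r) =
        i * (q + 1) + r * q + (r + i) + (q + 1) := by
      rw [show r + i + 1 - 1 - r = i by omega]; ring
    rw [e0]
    have h1 := h.le_pairWeight (Multiset.replicate i (q + 1) + Multiset.replicate r q)
      (by simp only [Multiset.mem_add, Multiset.mem_replicate]; omega) (by simp; omega)
      (q + 1) (by omega)
    simp only [Multiset.sum_add, Multiset.sum_replicate, Multiset.map_add,
        Multiset.map_replicate, smul_eq_mul, nsmul_eq_mul] at h1
    rcases r with _ | r
    · push_cast at h1 ⊢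
      simp only [zero_add, zero_mul, add_zero, sub_zero] at h1 ⊢
      have := mul_le_mul_of_nonneg_left h1 (by positivity : (0 : ℚ) ≤ i + 1)
      linarith
    · have h2 := h.le_pairWeight (Multiset.replicate (i + 1) (q + 1) + Multiset.replicate r q)
        (by simp only [Multiset.mem_add, Multiset.mem_replicate]; omega) (by simp; omega)
        q (by omega)
      simp only [Multiset.sum_add, Multiset.sum_replicate, Multiset.map_add,
        Multiset.map_replicate, smul_eq_mul, nsmul_eq_mul] at h2
      rw [show (i + 1) * (q + 1) + r * q + (r + 1 + i) + q
        = i * (q + 1) + (r + 1) * q + (r + 1 + i) + (q + 1) by ring] at h2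
      have h1' := mul_le_mul_of_nonneg_left h1 (by positivity : (0 : ℚ) ≤ i + 1)
      have h2' := mul_le_mul_of_nonneg_left h2 (by positivity : (0 : ℚ) ≤ r + 1)
      push_cast at h1' h2' ⊢
      linarith
  have hs := sum_le_sum key
  rw [← mul_sum, sum_range_reflect (fun j => Φ ((q + 1) * (n + 1) + j))] at hs
  have e : ∑ r ∈ range (n + 1), (n * ((n + 1 - r) * z (q + 1) + r * z q)
      + (n + 1 - r) * pairWeight N z (q + 1) + r * pairWeight N z q)
      = (n + 1) * (n * ((n + 2) * z (q + 1) + n * z q) + (n + 2) * pairWeight N z (q + 1)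
        + n * pairWeight N z q) / 2 := by
    simp only [sum_add_distrib, ← mul_sum, ← sum_mul, sum_sub_distrib, sum_range_id_rat, sum_const,
      card_range, nsmul_eq_mul]
    push_cast
    ring
  rw [e] at hs
  have hn : (0 : ℚ) < n + 1 := by positivity
  refine le_of_mul_le_mul_left ?_ hn
  linarith

/-- The sum over all blocks. -/
theorem MixedBound.sum_blocks_le {N n : ℕ} {z Φ : ℕ → ℚ} (h : MixedBound N (n + 2) z Φ)
    (hz : ∑ i ∈ range (N + 1), z i = 0) :
    2 * ∑ q ∈ range N, ∑ j ∈ range (n + 1), Φ ((q + 1) * (n + 1) + j) ≤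
      -(n * (n + 2)) * z 0 - n ^ 2 * z N - (2 * n + 1) * (z 0 + z N) - pairWeight N z 0 := by
  have hs := sum_le_sum fun q hq => h.sum_block_le q (mem_range.1 hq)
  simp only [sum_add_distrib, ← mul_sum] at hs
  have e1 := sum_range_succ' z N
  have e2 := sum_range_succ z N
  have e3 := sum_range_succ' (pairWeight N z) N
  have e4 := sum_range_succ (pairWeight N z) N
  have e5 := sum_pairWeight z N hz
  rw [pairWeight_self] at e4
  rw [hz] at e1 e2
  have e1' : ∑ k ∈ range N, z (k + 1) = - z 0 := by linarith
  have e2' : ∑ k ∈ range N, z k = - z N := by linarith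
  have e3' : ∑ k ∈ range N, pairWeight N z (k + 1) =
      - pairWeight N z 0 / 2 - (z 0 + z N) / 2 := by linarith
  have e4' : ∑ k ∈ range N, pairWeight N z k =
      pairWeight N z 0 / 2 - 3 * (z 0 + z N) / 2 := by linarith
  rw [e1', e2', e3', e4'] at hs
  refine hs.trans (le_of_eq ?_)
  ring


theorem exists_nonpos_and_adjacent (z : ℕ → ℚ) {N : ℕ} (hN : 1 ≤ N)
    (hz : ∑ i ∈ range (N + 1), z i = 0) :
    (∃ i ≤ N, z i ≤ 0) ∧ ∃ i < N, z i + z (i + 1) ≤ max 0 (-(z 0 + z N)) := by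
  constructor
  · obtain ⟨i, hi, h⟩ := exists_le_of_sum_le (s := range (N + 1)) (f := z) (g := fun _ => 0)
      (by simp) (by simp [hz])
    exact ⟨i, by simpa [Nat.lt_succ_iff] using hi, h⟩
  · by_contra! hc
    have e1 := sum_range_succ' z N
    have e2 := sum_range_succ z N
    rw [hz] at e1 e2
    have e : ∑ i ∈ range N, (z i + z (i + 1)) = -(z 0 + z N) := by
      rw [sum_add_distrib]; linarith
    have h1 := hc 0 hN
    have h2 : ∑ i ∈ range N, (0 : ℚ) ≤ ∑ i ∈ range N, (z i + z (i + 1)) - (z 0 + z 1) := by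
      obtain ⟨M, rfl⟩ : ∃ M, N = M + 1 := ⟨N - 1, by omega⟩
      rw [sum_range_succ' (fun i => z i + z (i + 1))]
      simp only [sum_const_zero, zero_add, add_sub_cancel_right]
      exact sum_nonneg fun i hi => (le_max_left _ _).trans (hc (i + 1) (by simp at hi; omega)).le
    rw [e] at h2
    simp only [sum_const_zero, zero_add] at h1 h2
    have := le_max_right 0 (-(z 0 + z N))
    linarith

/-- Monomials with `l` factors `y_0`, `j` balanced pairs `x_p y_p` and one pair `x_a y_b`. -/
theorem MixedBound.le_of_pairs {N n : ℕ} {z Φ : ℕ → ℚ} (h : MixedBound N (n + 2) z Φ)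
    {p a b l j : ℕ} (hp : p ≤ N) (ha : a ≤ N) (hb : b ≤ N) (hn : l + 2 * j = n) {d : ℕ}
    (hd : a + d = b + l) : Φ d ≤ l * z 0 + 2 * j * z p + (z a + z b) := by
  have := h (a ::ₘ Multiset.replicate j p) (b ::ₘ (Multiset.replicate l 0 + Multiset.replicate j p))
    (by simp only [Multiset.mem_cons, Multiset.mem_replicate]; omega)
    (by simp only [Multiset.mem_cons, Multiset.mem_add, Multiset.mem_replicate]; omega)
    (by simp) (by simp) (by simp; omega) d
    (by simp; omega)
  simp only [Multiset.map_cons, Multiset.sum_cons, Multiset.map_add, Multiset.sum_add,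
    Multiset.map_replicate, Multiset.sum_replicate, nsmul_eq_mul] at this
  linarith

theorem MixedBound.zero_le_of_pairs {N n : ℕ} {z Φ : ℕ → ℚ} (h : MixedBound N (n + 2) z Φ)
    {p a j : ℕ} (hp : p ≤ N) (ha : a + 1 ≤ N) (hn : 1 + 2 * j = n) :
    Φ 0 ≤ z 0 + 2 * j * z p + (z a + z (a + 1)) := by
  have := h (a ::ₘ 0 ::ₘ Multiset.replicate j p) ((a + 1) ::ₘ Multiset.replicate j p)
    (by simp only [Multiset.mem_cons, Multiset.mem_replicate]; omega)
    (by simp only [Multiset.mem_cons, Multiset.mem_replicate]; omega)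
    (by simp) (by simp) (by simp; omega) 0
    (by simp; omega)
  simp only [Multiset.map_cons, Multiset.sum_cons,
    Multiset.map_replicate, Multiset.sum_replicate, nsmul_eq_mul] at this
  linarith

theorem MixedBound.low_le {N n : ℕ} {z Φ : ℕ → ℚ} (h : MixedBound N (n + 2) z Φ) (hN : 1 ≤ N)
    (hz : ∑ i ∈ range (N + 1), z i = 0) {p : ℕ} (hp : p ≤ N) (hp0 : z p ≤ z 0) :
    (1 ≤ n → Φ 0 ≤ z 0 + (n - 1) * z p + max 0 (-(z 0 + z N))) ∧
    ∀ d, d + 1 < n → Φ (d + 1) ≤ (d + 1) * z 0 + (n - (d + 1)) * z p + max 0 (-(z 0 + z N)) := by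
  obtain ⟨⟨i, hi, hi'⟩, a, ha, ha'⟩ := exists_nonpos_and_adjacent z hN hz
  have hE := le_max_left 0 (-(z 0 + z N))
  constructor
  · intro hn
    rcases Nat.even_or_odd' n with ⟨j, rfl | rfl⟩
    · have := h.le_of_pairs (l := 0) (j := j) hp hi hi (by omega) (d := 0) (by omega)
      push_cast at this ⊢
      linarith
    · have := h.zero_le_of_pairs (j := j) hp (a := a) (by omega) (by omega)
      push_cast at this ⊢
      linarith
  · intro d hd
    obtain ⟨r, rfl⟩ : ∃ r, n = d + 1 + r := ⟨n - (d + 1), by omega⟩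
    rcases Nat.even_or_odd' r with ⟨j, rfl | rfl⟩
    · have := h.le_of_pairs (l := d + 1) (j := j) hp hi hi (by omega) (d := d + 1) (by omega)
      push_cast at this ⊢
      linarith
    · have := h.le_of_pairs (l := d) (j := j + 1) (a := a) (b := a + 1) hp (by omega) (by omega)
        (by omega) (d := d + 1) (by omega)
      push_cast at this ⊢
      linarith

theorem MixedBound.sum_low_le {N n : ℕ} {z Φ : ℕ → ℚ} (h : MixedBound N (n + 2) z Φ) (hN : 1 ≤ N)
    (hz : ∑ i ∈ range (N + 1), z i = 0) {p : ℕ} (hp : p ≤ N) (hp0 : z p ≤ z 0) (hn : 1 ≤ n) :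
    2 * ∑ d ∈ range n, Φ d - Φ 0 ≤ (n ^ 2 - n + 1) * z 0 + (n ^ 2 - 1) * z p
      + (2 * n - 1) * max 0 (-(z 0 + z N)) := by
  obtain ⟨h0, h1⟩ := h.low_le hN hz hp hp0
  have h0 := h0 hn
  obtain ⟨r, rfl⟩ : ∃ r, n = r + 1 := ⟨n - 1, by omega⟩
  rw [sum_range_succ']
  have hs : ∑ d ∈ range r, Φ (d + 1) ≤ _ :=
    sum_le_sum fun d hd => h1 d (by simp at hd; omega)
  simp only [sum_add_distrib, ← sum_mul, sum_sub_distrib, sum_range_id_rat, sum_const,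
      card_range, nsmul_eq_mul] at hs
  push_cast at hs h0 ⊢
  linarith

theorem two_mul_sum_add_sum_nonpos {N n : ℕ} (hN : 1 ≤ N) {z Ψ Φ : ℕ → ℚ}
    (hΨ : PureBound N (n + 2) z Ψ) (hΦ : MixedBound N (n + 2) z Φ)
    (hz : ∑ i ∈ range (N + 1), z i = 0) :
    2 * ∑ t ∈ range ((n + 2) * N + 1), Ψ t
      + (2 * ∑ d ∈ range ((n + 1) * (N + 1)), Φ d - Φ 0) ≤ 0 := by
  have hb := hΦ.sum_blocks_le hz
  have hadj := hΨ.sum_le_adjacent hz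
  have hext := hΨ.sum_le_extremal hz
  rw [mul_comm (n + 1) (N + 1), sum_range_mul_eq,
    sum_range_succ' (fun q => ∑ j ∈ range (n + 1), Φ (q * (n + 1) + j))]
  simp only [zero_mul, zero_add]
  have hN' : (1 : ℚ) ≤ N := by exact_mod_cast hN
  have hn0 : (0 : ℚ) ≤ n := by positivity
  push_cast at hadj hext
  have hmid := hΦ.le_pairWeight (Multiset.replicate n 0) (by simp [Multiset.mem_replicate])
    (by simp) 0 (by omega)
  simp only [Multiset.sum_replicate, Multiset.map_replicate, nsmul_eq_mul, smul_eq_mul,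
    mul_zero, zero_add, add_zero] at hmid
  obtain ⟨p, hp, hp0, hpN⟩ : ∃ p ≤ N, z p ≤ z 0 ∧ z p ≤ z N := by
    rcases le_total (z 0) (z N) with h | h
    · exact ⟨0, by omega, le_rfl, h⟩
    · exact ⟨N, le_rfl, h, le_rfl⟩
  have hmid' := hΦ.le_of_pairs (l := n) (j := 0) hp hp hp (by omega) (d := n) (by omega)
  rw [Nat.cast_zero] at hmid'
  have hpure : 2 * ∑ t ∈ range ((n + 2) * N + 1), Ψ t ≤ -(z 0 + z N) * ((n + 2) * (n + 1)) ∧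
      (z 0 + z N ≤ 0 →
        2 * ∑ t ∈ range ((n + 2) * N + 1), Ψ t ≤ (z 0 + z N) * ((n + 2) * (n + 1))) := by
    constructor
    · linarith
    · intro hs
      have : (N - 1) * ((z 0 + z N) * ((n + 2) * (n + 1))) ≤ 0 :=
        mul_nonpos_of_nonneg_of_nonpos (by linarith)
          (mul_nonpos_of_nonpos_of_nonneg hs (by positivity))
      linarith
  obtain ⟨hP1, hP2⟩ := hpure
  rcases Nat.eq_zero_or_pos n with rfl | hn
  · simp only [Nat.cast_zero, sum_range_one, zero_add, zero_mul, mul_zero, mul_one, one_mul,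
      neg_zero] at *
    rcases le_total 0 (z 0 + z N) with hs | hs
    · linarith
    · have := hP2 hs
      linarith
  · have hlow := hΦ.sum_low_le hN hz hp hp0 hn
    have hn1 : (1 : ℚ) ≤ n := by exact_mod_cast hn
    rw [sum_range_succ Φ n]
    have hz1 : (n ^ 2 - n + 1) * (z 0 + z p) ≤ (n ^ 2 - n + 1) * (z 0 + z N) :=
      mul_le_mul_of_nonneg_left (by linarith) (by nlinarith)
    have hz2 : n * (2 * z p) ≤ n * (z 0 + z N) :=
      mul_le_mul_of_nonneg_left (by linarith) hn0
    rcases le_total 0 (z 0 + z N) with hs | hs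
    · rw [max_eq_left (by linarith)] at hlow
      have := mul_nonneg hn0 hs
      have : 0 ≤ (n + 2) * (n + 1) * (z 0 + z N) := by positivity
      linarith
    · rw [max_eq_right (by linarith)] at hlow
      have := hP2 hs
      have : (n ^ 2 - 3 / 2 * n + 3) * (z 0 + z N) ≤ 0 :=
        mul_nonpos_of_nonneg_of_nonpos (by nlinarith) hs
      linarith

theorem linearIndependent_X_zpow :
    LinearIndependent ℂ (fun j : ℤ => (RatFunc.X : RatFunc ℂ) ^ j) := by
  rw [linearIndependent_iff']
  intro s g hg i hi
  obtain ⟨M, hM⟩ : ∃ M : ℕ, ∀ j ∈ s, 0 ≤ j + M := by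
    refine ⟨∑ j ∈ s, j.natAbs, fun j hj => ?_⟩
    have := single_le_sum (f := fun j : ℤ => j.natAbs) (fun _ _ => Nat.zero_le _) hj
    omega
  have hX : (RatFunc.X : RatFunc ℂ) ≠ 0 := RatFunc.X_ne_zero
  have h1 : algebraMap (Polynomial ℂ) (RatFunc ℂ)
      (∑ j ∈ s, g j • Polynomial.X ^ (j + M).toNat) = 0 := by
    have h2 := congrArg (· * (RatFunc.X : RatFunc ℂ) ^ (M : ℤ)) hg
    simp only [zero_mul, sum_mul] at h2
    rw [map_sum, ← h2]
    refine sum_congr rfl fun j hj => ?_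
    rw [smul_mul_assoc, ← zpow_add₀ hX,
      show (RatFunc.X : RatFunc ℂ) ^ (j + M) = RatFunc.X ^ (j + M).toNat by
        rw [← zpow_natCast, Int.toNat_of_nonneg (hM j hj)],
      Algebra.smul_def, Algebra.smul_def, map_mul, map_pow, RatFunc.algebraMap_X,
      ← IsScalarTower.algebraMap_apply]
  rw [map_eq_zero_iff _ (RatFunc.algebraMap_injective ℂ)] at h1
  have h2 := congrArg (fun p => p.coeff (i + M).toNat) h1
  simp only [Polynomial.finsetSum_coeff, Polynomial.coeff_smul, Polynomial.coeff_X_pow,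
    Polynomial.coeff_zero] at h2
  rw [sum_eq_single_of_mem i hi] at h2
  · simpa using h2
  · intro j hj hji
    have := hM j hj
    have := hM i hi
    rw [if_neg (by omega), smul_zero]

theorem linearIndependent_sumElim_of_comp {R ι ι' M M' : Type*} [Ring R] [AddCommGroup M]
    [AddCommGroup M'] [Module R M] [Module R M'] {v : ι → M} {v' : ι' → M} (f : M →ₗ[R] M')
    (hv : LinearIndependent R (f ∘ v)) (hv' : LinearIndependent R v') (h : ∀ i, f (v' i) = 0) :
    LinearIndependent R (Sum.elim v v') := by
  refine (hv.of_comp f).sum_type hv' ((Submodule.range_ker_disjoint hv).mono_right ?_)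
  rw [Submodule.span_le]
  rintro _ ⟨i, rfl⟩
  exact h i

/-- The value of a monomial of degree `m`, in terms of its type (a power of the `x`'s, a power of
the `y`'s, or mixed) and its index sum. -/
def keyValue (m : ℕ) : ℤ ⊕ (ℤ ⊕ ℤ) → T3 :=
  Sum.elim (fun t => (RatFunc.X ^ t, RatFunc.X ^ (-t - 2 * m), 0))
    (Sum.elim (fun t => (0, RatFunc.X ^ t, RatFunc.X ^ (-t - 2 * m)))
      (fun d => (0, RatFunc.X ^ (d - m), 0)))

theorem linearIndependent_keyValue (m : ℕ) : LinearIndependent ℂ (keyValue m) := by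
  refine linearIndependent_sumElim_of_comp (LinearMap.fst ℂ K (K × K)) ?_ ?_ ?_
  · exact linearIndependent_X_zpow
  · refine linearIndependent_sumElim_of_comp
      ((LinearMap.snd ℂ K K).comp (LinearMap.snd ℂ K (K × K))) ?_ ?_ ?_
    · exact linearIndependent_X_zpow.comp (fun t : ℤ => -t - 2 * m) (fun a b h => by simpa using h)
    · refine LinearIndependent.of_comp ((LinearMap.fst ℂ K K).comp (LinearMap.snd ℂ K (K × K))) ?_
      exact linearIndependent_X_zpow.comp (fun t : ℤ => t - m) (fun a b h => by simpa using h)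
    · intro i; rfl
  · rintro (i | i) <;> rfl

variable {k : ℕ}

/-- The indices of the `x`-factors of a monomial. -/
def xPart (σ : Multiset (Fin k ⊕ Fin k)) : Multiset (Fin k) :=
  σ.bind (Sum.elim (fun i => {i}) (fun _ => 0))

/-- The indices of the `y`-factors of a monomial. -/
def yPart (σ : Multiset (Fin k ⊕ Fin k)) : Multiset (Fin k) :=
  σ.bind (Sum.elim (fun _ => 0) (fun i => {i}))

theorem map_xPart_add_map_yPart (σ : Multiset (Fin k ⊕ Fin k)) :
    (xPart σ).map Sum.inl + (yPart σ).map Sum.inr = σ := by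
  induction σ using Multiset.induction_on with
  | empty => simp [xPart, yPart]
  | cons a σ ih =>
    rcases a with a | a
    · simpa [xPart, yPart] using ih
    · simpa [xPart, yPart] using ih

theorem xPart_add (A B : Multiset (Fin k)) : xPart (A.map Sum.inl + B.map Sum.inr) = A := by
  simpa [xPart, Multiset.bind_map] using Multiset.bind_singleton (s := A) (f := id)

theorem yPart_add (A B : Multiset (Fin k)) : yPart (A.map Sum.inl + B.map Sum.inr) = B := by
  simpa [yPart, Multiset.bind_map] using Multiset.bind_singleton (s := B) (f := id)

theorem prod_map_xA (A : Multiset ℕ) : (A.map fun i => xA (i + 1)).prod =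
    (RatFunc.X ^ (A.sum : ℤ), RatFunc.X ^ (-(A.sum : ℤ) - 2 * A.card),
      if A = 0 then 1 else 0) := by
  have hX : (RatFunc.X : RatFunc ℂ) ≠ 0 := RatFunc.X_ne_zero
  induction A using Multiset.induction_on with
  | empty => simp; rfl
  | cons a A ih =>
    rw [Multiset.map_cons, Multiset.prod_cons, ih, xA, Prod.mk_mul_mk, Prod.mk_mul_mk,
      ← zpow_add₀ hX, ← zpow_add₀ hX]
    simp only [Multiset.sum_cons, Multiset.card_cons, zero_mul, Multiset.cons_ne_zero, if_false]
    push_cast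
    congr 3 <;> ring

theorem prod_map_yA (A : Multiset ℕ) : (A.map fun i => yA (i + 1)).prod =
    (if A = 0 then 1 else 0, RatFunc.X ^ (A.sum : ℤ),
      RatFunc.X ^ (-(A.sum : ℤ) - 2 * A.card)) := by
  have hX : (RatFunc.X : RatFunc ℂ) ≠ 0 := RatFunc.X_ne_zero
  induction A using Multiset.induction_on with
  | empty => simp; rfl
  | cons a A ih =>
    rw [Multiset.map_cons, Multiset.prod_cons, ih, yA, Prod.mk_mul_mk, Prod.mk_mul_mk,
      ← zpow_add₀ hX, ← zpow_add₀ hX]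
    simp only [Multiset.sum_cons, Multiset.card_cons, zero_mul, Multiset.cons_ne_zero, if_false]
    push_cast
    congr 3 <;> ring

/-- The key of the monomial with `x`-indices `A` and `y`-indices `B`. -/
def pairKey (A B : Multiset ℕ) : ℤ ⊕ (ℤ ⊕ ℤ) :=
  if B = 0 then Sum.inl A.sum else if A = 0 then Sum.inr (Sum.inl B.sum)
  else Sum.inr (Sum.inr ((B.sum + B.card : ℤ) - (A.sum + A.card)))

/-- The key of a monomial. -/
def monKey (σ : Multiset (Fin k ⊕ Fin k)) : ℤ ⊕ (ℤ ⊕ ℤ) :=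
  pairKey ((xPart σ).map Fin.val) ((yPart σ).map Fin.val)

theorem prod_mul_prod_eq_keyValue (A B : Multiset ℕ) (h : A.card + B.card ≠ 0) :
    (A.map fun i => xA (i + 1)).prod * (B.map fun i => yA (i + 1)).prod =
      keyValue (A.card + B.card) (pairKey A B) := by
  have hX : (RatFunc.X : RatFunc ℂ) ≠ 0 := RatFunc.X_ne_zero
  rw [prod_map_xA, prod_map_yA, pairKey]
  by_cases hB : B = 0
  · have hA : A ≠ 0 := by rintro rfl; simp [hB] at h
    simp [hB, hA, keyValue]
  · by_cases hA : A = 0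
    · simp [hB, hA, keyValue]
    · simp only [hA, hB, if_false, keyValue, Sum.elim_inr, Prod.mk_mul_mk, mul_zero, zero_mul,
        ← zpow_add₀ hX]
      congr 3
      push_cast
      ring

theorem prod_map_varA (σ : Multiset (Fin k ⊕ Fin k)) (h : σ.card ≠ 0) :
    (σ.map (varA k)).prod = keyValue σ.card (monKey σ) := by
  have e := map_xPart_add_map_yPart σ
  have hc : ((xPart σ).map Fin.val).card + ((yPart σ).map Fin.val).card = σ.card := by
    conv_rhs => rw [← e]
    simp
  rw [monKey, ← hc, ← prod_mul_prod_eq_keyValue _ _ (by rwa [hc])]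
  conv_lhs => rw [← e]
  simp [varA, Multiset.map_map, Function.comp_def]

theorem exists_minimal_section {α κ : Type*} [Fintype α] (f : α → κ) (w : α → ℤ) :
    ∃ S : Finset α, Set.InjOn f S ∧ (∀ a, ∃ s ∈ S, f s = f a) ∧
      ∀ s ∈ S, ∀ a, f a = f s → w s ≤ w a := by
  classical
  have h : ∀ a : α, ∃ s, f s = f a ∧ ∀ b, f b = f a → w s ≤ w b := by
    intro a
    obtain ⟨s, hs, hs'⟩ := exists_min_image (univ.filter fun b => f b = f a) w ⟨a, by simp⟩
    exact ⟨s, by simpa using hs, fun b hb => hs' b (by simpa using hb)⟩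
  have h' : ∀ c : Set.range f, ∃ s, f s = c ∧ ∀ b, f b = c → w s ≤ w b := by
    rintro ⟨_, a, rfl⟩
    exact h a
  choose g hg hg' using h'
  refine ⟨univ.image fun a => g ⟨f a, a, rfl⟩, ?_, ?_, ?_⟩
  · intro a ha b hb hab
    simp only [coe_image, coe_univ, Set.image_univ, Set.mem_range] at ha hb
    obtain ⟨a, rfl⟩ := ha
    obtain ⟨b, rfl⟩ := hb
    simp only [hg] at hab
    simp only [hab]
  · intro a
    exact ⟨_, mem_image_of_mem _ (mem_univ a), hg _⟩
  · intro s hs a ha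
    obtain ⟨b, -, rfl⟩ := mem_image.1 hs
    exact hg' _ _ (by rw [ha, hg])

theorem isMonBasisA_of_section {m : ℕ} (hm : m ≠ 0) (S : Finset (DegMonA k m))
    (hinj : Set.InjOn (fun σ : DegMonA k m => monKey σ.1) S)
    (hsurj : ∀ σ : DegMonA k m, ∃ s ∈ S, monKey s.1 = monKey σ.1) : IsMonBasisA k m S := by
  have hval : ∀ σ : DegMonA k m, (σ.1.map (varA k)).prod = keyValue m (monKey σ.1) := by
    intro σ
    rw [prod_map_varA _ (by rw [σ.2]; exact hm), σ.2]
  refine ⟨?_, ?_⟩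
  · simp only [hval]
    exact (linearIndependent_keyValue m).comp (fun s : S => monKey s.1.1)
      (fun a b h => Subtype.ext (hinj a.2 b.2 h))
  · unfold VA
    congr 1
    ext t
    constructor
    · rintro ⟨s, -, rfl⟩
      exact ⟨s.1, s.2, rfl⟩
    · rintro ⟨σ, hσ, rfl⟩
      obtain ⟨s, hs, h⟩ := hsurj ⟨σ, hσ⟩
      exact ⟨s, hs, by simp only [hval s]; rw [h, ← hval ⟨σ, hσ⟩]⟩


theorem sum_Ioo_neg_int (g : ℤ → ℚ) {D : ℕ} (hD : 1 ≤ D) :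
    ∑ d ∈ Ioo (-(D : ℤ)) D, g d = ∑ d ∈ range D, (g d + g (-d)) - g 0 := by
  induction D, hD using Nat.le_induction with
  | base =>
    have : Ioo (-((1 : ℕ) : ℤ)) ((1 : ℕ) : ℤ) = {0} := by ext x; simp; omega
    rw [this]
    simp
  | succ D hD ih =>
    have : Ioo (-((D + 1 : ℕ) : ℤ)) ((D + 1 : ℕ) : ℤ) =
        insert (D : ℤ) (insert (-(D : ℤ)) (Ioo (-(D : ℤ)) D)) := by
      ext x; simp only [mem_Ioo, mem_insert]; omega
    rw [this, sum_insert (by simp; omega), sum_insert (by simp), ih, sum_range_succ]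
    ring

/-- The possible keys of monomials of degree `n + 2` in `N + 1` letters of each kind. -/
def keyRange (N n : ℕ) : Finset (ℤ ⊕ (ℤ ⊕ ℤ)) :=
  ((range ((n + 2) * N + 1)).map Nat.castEmbedding).disjSum
    (((range ((n + 2) * N + 1)).map Nat.castEmbedding).disjSum
      (Ioo (-(((n + 1) * (N + 1) : ℕ) : ℤ)) ((n + 1) * (N + 1) : ℕ)))

theorem sum_keyRange (N n : ℕ) (F : ℤ ⊕ (ℤ ⊕ ℤ) → ℚ) :
    ∑ κ ∈ keyRange N n, F κ =
      ∑ t ∈ range ((n + 2) * N + 1), (F (Sum.inl t) + F (Sum.inr (Sum.inl t))) +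
      (∑ d ∈ range ((n + 1) * (N + 1)),
        (F (Sum.inr (Sum.inr d)) + F (Sum.inr (Sum.inr (-d)))) - F (Sum.inr (Sum.inr 0))) := by
  rw [keyRange, sum_disjSum, sum_disjSum, sum_Ioo_neg_int _ (Nat.mul_pos (by omega) (by omega)),
    sum_map, sum_map, sum_add_distrib (s := range ((n + 2) * N + 1))]
  simp only [Nat.castEmbedding_apply]
  ring

theorem pairKey_mem_keyRange {N n : ℕ} {A B : Multiset ℕ} (hA : ∀ a ∈ A, a ≤ N)
    (hB : ∀ b ∈ B, b ≤ N) (h : A.card + B.card = n + 2) : pairKey A B ∈ keyRange N n := by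
  have hA' : A.sum ≤ A.card * N := by simpa using Multiset.sum_le_card_nsmul A N hA
  have hB' : B.sum ≤ B.card * N := by simpa using Multiset.sum_le_card_nsmul B N hB
  unfold pairKey keyRange
  split_ifs with h1 h2
  · rw [inl_mem_disjSum, mem_map]
    subst h1
    simp only [Multiset.card_zero, add_zero] at h
    rw [h] at hA'
    exact ⟨A.sum, by simp; omega, rfl⟩
  · rw [inr_mem_disjSum, inl_mem_disjSum, mem_map]
    subst h2
    simp only [Multiset.card_zero, zero_add] at h
    rw [h] at hB'
    exact ⟨B.sum, by simp; omega, rfl⟩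
  · rw [inr_mem_disjSum, inr_mem_disjSum, mem_Ioo]
    obtain ⟨a, ha⟩ := Nat.exists_eq_succ_of_ne_zero (mt Multiset.card_eq_zero.1 h2)
    obtain ⟨b, hb⟩ := Nat.exists_eq_succ_of_ne_zero (mt Multiset.card_eq_zero.1 h1)
    have hn : n = a + b := by omega
    subst hn
    rw [ha] at hA'
    rw [hb] at hB'
    rw [ha, hb]
    generalize A.sum = P at *
    generalize B.sum = Q at *
    zify at hA' hB'
    push_cast at hA' hB' ⊢
    constructor
    · nlinarith [mul_nonneg (Int.natCast_nonneg b) (Int.natCast_nonneg N)]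
    · nlinarith [mul_nonneg (Int.natCast_nonneg a) (Int.natCast_nonneg N)]

theorem exists_map_val_eq {N : ℕ} (A : Multiset ℕ) (hA : ∀ a ∈ A, a ≤ N) :
    ∃ A' : Multiset (Fin (N + 1)), A'.map Fin.val = A := by
  refine ⟨A.map (Fin.ofNat (N + 1)), ?_⟩
  rw [Multiset.map_map]
  conv_rhs => rw [← Multiset.map_id A]
  refine Multiset.map_congr rfl fun a ha => ?_
  simpa [Nat.lt_succ_iff] using hA a ha

theorem exists_monomial {N m : ℕ} (lam nu : ℕ → ℤ) (A B : Multiset ℕ) (hA : ∀ a ∈ A, a ≤ N)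
    (hB : ∀ b ∈ B, b ≤ N) (h : A.card + B.card = m) :
    ∃ σ : DegMonA (N + 1) m, monKey σ.1 = pairKey A B ∧
      wtA (fun i => lam i) (fun i => nu i) σ = (A.map lam).sum + (B.map nu).sum := by
  obtain ⟨A, rfl⟩ := exists_map_val_eq A hA
  obtain ⟨B, rfl⟩ := exists_map_val_eq B hB
  refine ⟨⟨A.map Sum.inl + B.map Sum.inr, by simpa using h⟩, ?_, ?_⟩
  · rw [monKey, xPart_add, yPart_add]
  · simp [wtA, Multiset.map_map, Function.comp_def]

theorem exists_monBasis_weight_nonpos {N n : ℕ} (hN : 1 ≤ N) (lam nu : ℕ → ℤ)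
    (hz : ∑ i ∈ range (N + 1), (lam i + nu i) = 0) :
    ∃ S : Finset (DegMonA (N + 1) (n + 2)), IsMonBasisA (N + 1) (n + 2) S ∧
      ∑ σ ∈ S, wtA (fun i => lam i) (fun i => nu i) σ ≤ 0 := by
  set w : DegMonA (N + 1) (n + 2) → ℤ := wtA (fun i => lam i) (fun i => nu i) with hw
  obtain ⟨S, hinj, hsurj, hmin⟩ := exists_minimal_section
    (fun σ : DegMonA (N + 1) (n + 2) => monKey σ.1) w
  refine ⟨S, isMonBasisA_of_section (by omega) S hinj hsurj, ?_⟩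
  set F : ℤ ⊕ (ℤ ⊕ ℤ) → ℚ := fun κ => ∑ s ∈ S with monKey s.1 = κ, (w s : ℚ) with hF
  have hsum : ∑ κ ∈ keyRange N n, F κ = ∑ s ∈ S, (w s : ℚ) := by
    refine sum_fiberwise_of_maps_to (fun s _ => ?_) _
    refine pairKey_mem_keyRange ?_ ?_ ?_
    · intro a ha
      obtain ⟨i, -, rfl⟩ := Multiset.mem_map.1 ha
      exact i.is_le
    · intro a ha
      obtain ⟨i, -, rfl⟩ := Multiset.mem_map.1 ha
      exact i.is_le
    · have e := congrArg Multiset.card (map_xPart_add_map_yPart s.1)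
      simpa [s.2] using e
  have hFle : ∀ A B : Multiset ℕ, (∀ a ∈ A, a ≤ N) → (∀ b ∈ B, b ≤ N) →
      A.card + B.card = n + 2 →
      F (pairKey A B) ≤ (A.map fun i => (lam i : ℚ)).sum + (B.map fun i => (nu i : ℚ)).sum := by
    intro A B hA hB h
    obtain ⟨σ, hσ, hwσ⟩ := exists_monomial lam nu A B hA hB h
    obtain ⟨s, hs, hsσ⟩ := hsurj σ
    have e : F (pairKey A B) = w s := by
      rw [hF]
      refine sum_eq_single_of_mem s (mem_filter.2 ⟨hs, hsσ.trans hσ⟩) fun b hb hbs => ?_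
      simp only [mem_filter] at hb
      exact absurd (hinj hb.1 hs (by simp only [hb.2, hsσ, hσ])) hbs
    have h1 := hmin s hs σ hsσ.symm
    rw [e]
    have h2 : (w s : ℚ) ≤ w σ := by exact_mod_cast h1
    refine h2.trans (le_of_eq ?_)
    rw [hw, hwσ]
    push_cast [Multiset.map_map]
    rfl
  have hzero : ∀ A : Multiset ℕ, A.card = n + 2 → A ≠ 0 := by
    rintro _ h rfl
    simp at h
  have hΨ : PureBound N (n + 2) (fun i => (lam i : ℚ) + nu i)
      (fun t => F (Sum.inl t) + F (Sum.inr (Sum.inl t))) := by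
    intro A hA hc
    have h1 := hFle A 0 hA (by simp) (by simpa using hc)
    have h2 := hFle 0 A (by simp) hA (by simpa using hc)
    simp only [pairKey, hzero A hc, if_true, if_false, Multiset.map_zero, Multiset.sum_zero,
      add_zero, zero_add] at h1 h2
    rw [Multiset.sum_map_add]
    exact add_le_add h1 h2
  have hΦ : MixedBound N (n + 2) (fun i => (lam i : ℚ) + nu i)
      (fun d => F (Sum.inr (Sum.inr d)) + F (Sum.inr (Sum.inr (-d)))) := by
    intro A B hA hB hA0 hB0 hc d hd
    have h1 := hFle A B hA hB hc
    have h2 := hFle B A hB hA (by omega)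
    have e1 : (B.sum + B.card : ℤ) - (A.sum + A.card) = d := by omega
    have e2 : (A.sum + A.card : ℤ) - (B.sum + B.card) = -d := by linarith
    simp only [pairKey, hA0, hB0, if_false, e1, e2] at h1 h2
    rw [Multiset.sum_map_add, Multiset.sum_map_add]
    linarith
  have hmain := two_mul_sum_add_sum_nonpos hN hΨ hΦ (by exact_mod_cast hz)
  simp only [Nat.cast_zero, neg_zero] at hmain
  rw [sum_keyRange] at hsum
  have : ∑ s ∈ S, (w s : ℚ) ≤ 0 := by linarith
  exact_mod_cast this

end

/-- Combinatorial content of Theorem 4.9. -/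
theorem doubleA_semistable (k m : ℕ) (hk : 2 ≤ k) (hm : 2 ≤ m)
    (lam nu : Fin k → ℤ) (h : (∑ i : Fin k, (lam i + nu i)) = 0) :
    ∃ S : Finset (DegMonA k m), IsMonBasisA k m S ∧ (∑ σ ∈ S, wtA lam nu σ) ≤ 0 := by
  obtain ⟨N, rfl⟩ : ∃ N, k = N + 1 := ⟨k - 1, by omega⟩
  obtain ⟨n, rfl⟩ : ∃ n, m = n + 2 := ⟨m - 2, by omega⟩
  obtain ⟨S, hS, hw⟩ := exists_monBasis_weight_nonpos (N := N) (n := n) (by omega)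
    (fun i => lam (Fin.ofNat (N + 1) i)) (fun i => nu (Fin.ofNat (N + 1) i))
    (by rw [Finset.sum_range]; simpa using h)
  refine ⟨S, hS, ?_⟩
  simpa using hw

end
end

section
/- For every m ≥ 2 and every assignment of integer weights to the 3g−3 variables x_i, y_i, z_i (i ∈ ℤ/(g−1)) with total sum 0, there exists a monomial basis of V_m of nonpositive weight. (By the Kempf–Morrison criterion, this is the combinatorial content of Theorem 4.14: all Hilbert points [C]_m, m ≥ 2, of the bicanonically embedded rosary of odd genus g are semistable.) -/
/-!
The combinatorial content of Theorem 4.14 (semistability of all Hilbert points of the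
bicanonically embedded rosary of odd genus `g ≥ 5`): for every `m ≥ 2` and every
assignment of integer weights to the `3g-3` bicanonical variables `x_i, y_i, z_i`
(`i ∈ ℤ/(g-1)`) with total sum `0`, there exists a monomial basis of `V_m` of
nonpositive weight.
-/

noncomputable section

/-- The product ring `P = ∏_{i ∈ ℤ/(g-1)} ℂ(u)`. -/
abbrev Pro (g : ℕ) : Type := ZMod (g - 1) → RatFunc ℂ

/-- `ω_i := e_i + u^(-2)·e_(i+1)`. -/
def omegaR (g : ℕ) (i : ZMod (g - 1)) : Pro g :=
  Pi.single i 1 + Pi.single (i + 1) (RatFunc.X ^ (-2 : ℤ))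

/-- `η := Σ_i u^(-1)·e_i`, i.e. the constant tuple `u^(-1)`. -/
def etaR (g : ℕ) : Pro g := fun _ => RatFunc.X ^ (-1 : ℤ)

/-- `x_i := ω_i²`. -/
def xRos (g : ℕ) (i : ZMod (g - 1)) : Pro g := omegaR g i ^ 2

/-- `y_i := ω_i·η`. -/
def yRos (g : ℕ) (i : ZMod (g - 1)) : Pro g := omegaR g i * etaR g

/-- `z_i := ω_{i-1}·ω_i`. -/
def zRos (g : ℕ) (i : ZMod (g - 1)) : Pro g := omegaR g (i - 1) * omegaR g i

/-- Index type for the `3g-3` bicanonical variables `x_i, y_i, z_i`. -/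
abbrev IdxR (g : ℕ) : Type := ZMod (g - 1) ⊕ (ZMod (g - 1) ⊕ ZMod (g - 1))

/-- The bicanonical variables. -/
def varRos (g : ℕ) : IdxR g → Pro g :=
  Sum.elim (xRos g) (Sum.elim (yRos g) (zRos g))

/-- `V_m`: the `ℂ`-span of all degree-`m` monomials in the variables `x_i, y_i, z_i`. -/
def VRos (g m : ℕ) : Submodule ℂ (Pro g) :=
  Submodule.span ℂ
    {p : Pro g | ∃ σ : Multiset (IdxR g), Multiset.card σ = m ∧ p = (σ.map (varRos g)).prod}

/-- Degree-`m` monomials, as multisets of `m` variable indices. -/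
abbrev DegMonR (g m : ℕ) := Sym (IdxR g) m

/-- A finite set of degree-`m` monomials is a monomial basis of `V_m` if its images in
`P` are linearly independent over `ℂ` and span `V_m`. -/
def IsMonBasisRos (g m : ℕ) (S : Finset (DegMonR g m)) : Prop :=
  LinearIndependent ℂ (fun s : S => (((s : DegMonR g m)).1.map (varRos g)).prod) ∧
  Submodule.span ℂ ((fun s : DegMonR g m => (s.1.map (varRos g)).prod) '' S) = VRos g m

/-- The element `u^(-k)·e_i`. -/
def slotPow (g : ℕ) (i : ZMod (g - 1)) (k : ℕ) : Pro g :=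
  Pi.single i ((RatFunc.X : RatFunc ℂ)⁻¹ ^ k)

lemma slotPow_mul_same (g : ℕ) (i : ZMod (g - 1)) (k l : ℕ) :
    slotPow g i k * slotPow g i l = slotPow g i (k + l) := by
  simp only [slotPow, ← Pi.single_mul, pow_add]

lemma slotPow_mul_ne (g : ℕ) {i j : ZMod (g - 1)} (h : i ≠ j) (k l : ℕ) :
    slotPow g i k * slotPow g j l = 0 := by
  funext s
  by_cases hs : s = i
  · subst hs
    simp [slotPow, Pi.single_eq_of_ne h]
  · simp [slotPow, Pi.single_eq_of_ne hs]

lemma omegaR_eq (g : ℕ) (i : ZMod (g - 1)) :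
    omegaR g i = slotPow g i 0 + slotPow g (i + 1) 2 := by
  simp [omegaR, slotPow, zpow_neg, zpow_ofNat]

lemma slotPow_mul_etaR (g : ℕ) (i : ZMod (g - 1)) (k : ℕ) :
    slotPow g i k * etaR g = slotPow g i (k + 1) := by
  funext s
  by_cases hs : s = i
  · subst hs
    simp [slotPow, etaR, pow_succ]
  · simp [slotPow, Pi.single_eq_of_ne hs]

lemma succ_ne_self_of_two_ne_zero {R : Type*} [Ring R] (h2 : (2 : R) ≠ 0) (i : R) :
    i + 1 ≠ i := by
  intro h
  have h1 : (1 : R) = 0 := by simpa using h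
  exact h2 (by rw [← one_add_one_eq_two, h1, add_zero])

lemma xRos_eq (g : ℕ) (h2 : (2 : ZMod (g - 1)) ≠ 0) (i : ZMod (g - 1)) :
    xRos g i = slotPow g i 0 + slotPow g (i + 1) 4 := by
  have h := succ_ne_self_of_two_ne_zero h2 i
  rw [xRos, omegaR_eq, sq, add_mul, mul_add, mul_add, slotPow_mul_ne g h, slotPow_mul_ne g h.symm,
    slotPow_mul_same, slotPow_mul_same, zero_add, add_zero, zero_add]

lemma yRos_eq (g : ℕ) (i : ZMod (g - 1)) :
    yRos g i = slotPow g i 1 + slotPow g (i + 1) 3 := by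
  rw [yRos, omegaR_eq, add_mul, slotPow_mul_etaR, slotPow_mul_etaR]

lemma zRos_eq (g : ℕ) (h2 : (2 : ZMod (g - 1)) ≠ 0) (i : ZMod (g - 1)) :
    zRos g i = slotPow g i 2 := by
  have h := succ_ne_self_of_two_ne_zero h2
  have ha : i - 1 ≠ i := by simpa using (h (i - 1)).symm
  have hb : i - 1 ≠ i + 1 := fun e => h2 (by linear_combination -e)
  rw [zRos, omegaR_eq, omegaR_eq, sub_add_cancel, add_mul, mul_add, mul_add, slotPow_mul_ne g ha,
    slotPow_mul_ne g hb, slotPow_mul_ne g (h i).symm, slotPow_mul_same]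
  simp

/-- The element `u^(-k)·e_i + u^(-(d-k))·e_(i+1)`, a section glued along the tacnode
joining components `i` and `i+1`. -/
def gluedPow (g d : ℕ) (i : ZMod (g - 1)) (k : ℕ) : Pro g :=
  slotPow g i k + slotPow g (i + 1) (d - k)

lemma gluedPow_mul_same (g : ℕ) (h2 : (2 : ZMod (g - 1)) ≠ 0) {d e : ℕ} (i : ZMod (g - 1))
    {k l : ℕ} (hk : k ≤ d) (hl : l ≤ e) :
    gluedPow g d i k * gluedPow g e i l = gluedPow g (d + e) i (k + l) := by
  have h := succ_ne_self_of_two_ne_zero h2 i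
  rw [gluedPow, gluedPow, add_mul, mul_add, mul_add, slotPow_mul_ne g h, slotPow_mul_ne g h.symm,
    slotPow_mul_same, slotPow_mul_same, add_zero, zero_add, gluedPow]
  congr 2
  omega

lemma gluedPow_pow (g : ℕ) (h2 : (2 : ZMod (g - 1)) ≠ 0) {d : ℕ} (i : ZMod (g - 1))
    {k : ℕ} (hk : k ≤ d) (p : ℕ) :
    gluedPow g d i k ^ (p + 1) = gluedPow g ((p + 1) * d) i ((p + 1) * k) := by
  induction p with
  | zero => simp
  | succ p ih =>
    rw [pow_succ, ih, gluedPow_mul_same g h2 i (Nat.mul_le_mul_left _ hk) hk]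
    congr 1 <;> ring

lemma slotPow_mul_gluedPow (g : ℕ) (h2 : (2 : ZMod (g - 1)) ≠ 0) (d : ℕ) (i : ZMod (g - 1))
    (k l : ℕ) : slotPow g i k * gluedPow g d i l = slotPow g i (k + l) := by
  rw [gluedPow, mul_add, slotPow_mul_same,
    slotPow_mul_ne g (succ_ne_self_of_two_ne_zero h2 i).symm, add_zero]

lemma slotPow_mul_gluedPow_pred (g : ℕ) (h2 : (2 : ZMod (g - 1)) ≠ 0) (d : ℕ)
    (i : ZMod (g - 1)) (k l : ℕ) :
    slotPow g i k * gluedPow g d (i - 1) l = slotPow g i (k + (d - l)) := by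
  have h : i ≠ i - 1 := by simpa using succ_ne_self_of_two_ne_zero h2 (i - 1)
  rw [gluedPow, mul_add, sub_add_cancel, slotPow_mul_same, slotPow_mul_ne g h, zero_add]

lemma gluedPow_mul_gluedPow_pred (g : ℕ) (h2 : (2 : ZMod (g - 1)) ≠ 0) (d e : ℕ)
    (i : ZMod (g - 1)) (k l : ℕ) :
    gluedPow g d i k * gluedPow g e (i - 1) l = slotPow g i (k + (e - l)) := by
  have h := succ_ne_self_of_two_ne_zero h2
  have ha : i + 1 ≠ i - 1 := fun e => h2 (by linear_combination e)
  rw [gluedPow, add_mul, slotPow_mul_gluedPow_pred g h2, gluedPow, mul_add, sub_add_cancel,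
    slotPow_mul_ne g (h i), slotPow_mul_ne g ha, add_zero, add_zero]

/-- The standard generators of the sections of degree `m`: monomials supported on one component
and vanishing at the tacnodes, and glued pairs. -/
def stdSpan (g m : ℕ) : Submodule ℂ (Pro g) :=
  Submodule.span ℂ ({f | ∃ i k, 2 ≤ k ∧ k + 2 ≤ 4 * m ∧ f = slotPow g i k} ∪
    {f | ∃ i k, k < 2 ∧ f = gluedPow g (4 * m) i k})

lemma slotPow_mem_stdSpan (g : ℕ) {m : ℕ} (i : ZMod (g - 1)) {k : ℕ} (h : 2 ≤ k)
    (h' : k + 2 ≤ 4 * m) : slotPow g i k ∈ stdSpan g m :=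
  Submodule.subset_span (Or.inl ⟨i, k, h, h', rfl⟩)

lemma gluedPow_mem_stdSpan (g : ℕ) {m : ℕ} (i : ZMod (g - 1)) {k : ℕ} (h : k + 2 ≤ 4 * m) :
    gluedPow g (4 * m) i k ∈ stdSpan g m := by
  by_cases hk : k < 2
  · exact Submodule.subset_span (Or.inr ⟨i, k, hk, rfl⟩)
  · exact add_mem (slotPow_mem_stdSpan g i (by omega) h)
      (slotPow_mem_stdSpan g _ (by omega) (by omega))

lemma slotPow_mul_mem_stdSpan (g : ℕ) {m : ℕ} (i j : ZMod (g - 1)) {k l : ℕ} (h : 2 ≤ k + l)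
    (h' : k + l + 2 ≤ 4 * m) : slotPow g i k * slotPow g j l ∈ stdSpan g m := by
  by_cases hij : i = j
  · subst hij
    rw [slotPow_mul_same]
    exact slotPow_mem_stdSpan g i h h'
  · rw [slotPow_mul_ne g hij]
    exact zero_mem _

lemma varRos_cases (g : ℕ) (h2 : (2 : ZMod (g - 1)) ≠ 0) (s : IdxR g) :
    (∃ i, varRos g s = slotPow g i 2) ∨ ∃ i k, k < 2 ∧ varRos g s = gluedPow g 4 i k := by
  rcases s with i | i | i
  · exact Or.inr ⟨i, 0, by omega, xRos_eq g h2 i⟩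
  · exact Or.inr ⟨i, 1, by omega, yRos_eq g i⟩
  · exact Or.inl ⟨i, zRos_eq g h2 i⟩

lemma mul_varRos_mem_stdSpan (g : ℕ) (h2 : (2 : ZMod (g - 1)) ≠ 0) {m : ℕ} (hm : 1 ≤ m)
    (s : IdxR g) {f : Pro g} (hf : f ∈ stdSpan g m) : f * varRos g s ∈ stdSpan g (m + 1) := by
  induction hf using Submodule.span_induction with
  | zero => simp
  | add a b _ _ ha hb => rw [add_mul]; exact add_mem ha hb
  | smul c a _ ha => rw [smul_mul_assoc]; exact Submodule.smul_mem _ c ha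
  | mem f hf =>
    rcases hf with ⟨i, k, hk, hk', rfl⟩ | ⟨i, k, hk, rfl⟩ <;>
    rcases varRos_cases g h2 s with ⟨j, hj⟩ | ⟨j, l, hl, hj⟩ <;> rw [hj]
    · exact slotPow_mul_mem_stdSpan g _ _ (by omega) (by omega)
    · rw [gluedPow, mul_add]
      exact add_mem (slotPow_mul_mem_stdSpan g _ _ (by omega) (by omega))
        (slotPow_mul_mem_stdSpan g _ _ (by omega) (by omega))
    · rw [gluedPow, add_mul]
      exact add_mem (slotPow_mul_mem_stdSpan g _ _ (by omega) (by omega))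
        (slotPow_mul_mem_stdSpan g _ _ (by omega) (by omega))
    · by_cases hij : i = j
      · subst hij
        rw [gluedPow_mul_same g h2 i (by omega) (by omega)]
        exact gluedPow_mem_stdSpan g (m := m + 1) i (by omega)
      · have hij' : i + 1 ≠ j + 1 := fun e => hij (add_right_cancel e)
        rw [gluedPow, gluedPow, add_mul, mul_add, mul_add, slotPow_mul_ne g hij,
          slotPow_mul_ne g hij', zero_add, add_zero]
        exact add_mem (slotPow_mul_mem_stdSpan g _ _ (by omega) (by omega))
          (slotPow_mul_mem_stdSpan g _ _ (by omega) (by omega))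

lemma prod_varRos_mem_stdSpan (g : ℕ) (h2 : (2 : ZMod (g - 1)) ≠ 0) (m : ℕ)
    (σ : Multiset (IdxR g)) (hσ : Multiset.card σ = m + 1) :
    (σ.map (varRos g)).prod ∈ stdSpan g (m + 1) := by
  induction m generalizing σ with
  | zero =>
    obtain ⟨s, rfl⟩ := Multiset.card_eq_one.1 hσ
    rw [Multiset.map_singleton, Multiset.prod_singleton]
    rcases varRos_cases g h2 s with ⟨j, hj⟩ | ⟨j, l, hl, hj⟩ <;> rw [hj]
    · exact slotPow_mem_stdSpan g j (by omega) (by omega)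
    · exact gluedPow_mem_stdSpan g (m := 1) j (by omega)
  | succ m ih =>
    obtain ⟨s, τ, rfl, hτ⟩ := Multiset.card_eq_succ_iff.1 hσ
    rw [Multiset.map_cons, Multiset.prod_cons, mul_comm]
    exact mul_varRos_mem_stdSpan g h2 (by omega) s (ih τ hτ)

lemma exists_coeff_inv_X_pow :
    ∃ φ : ℕ → RatFunc ℂ →ₗ[ℂ] ℂ, ∀ k l, φ k (RatFunc.X⁻¹ ^ l) = if l = k then 1 else 0 := by
  have htr : Transcendental ℂ (RatFunc.X : RatFunc ℂ)⁻¹ := by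
    rw [Transcendental, IsAlgebraic.inv_iff]
    exact RatFunc.transcendental_X
  have hli : LinearIndependent ℂ (fun l : ℕ => (RatFunc.X : RatFunc ℂ)⁻¹ ^ l) := by
    have := (Polynomial.basisMonomials ℂ).linearIndependent.map'
      (Polynomial.aeval (RatFunc.X : RatFunc ℂ)⁻¹).toLinearMap
      (LinearMap.ker_eq_bot.2 (transcendental_iff_injective.1 htr))
    have hpow : (⇑(Polynomial.aeval (RatFunc.X : RatFunc ℂ)⁻¹).toLinearMap ∘
        ⇑(Polynomial.basisMonomials ℂ)) = fun l : ℕ => (RatFunc.X : RatFunc ℂ)⁻¹ ^ l := by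
      funext l
      simp [Polynomial.aeval_monomial]
    exact hpow ▸ this
  obtain ⟨f, hf⟩ := (Finsupp.linearCombination ℂ _).exists_leftInverse_of_injective
    (LinearMap.ker_eq_bot.2 hli)
  refine ⟨fun k => Finsupp.lapply k ∘ₗ f, fun k l => ?_⟩
  have := LinearMap.congr_fun hf (Finsupp.single l 1)
  simp only [LinearMap.comp_apply, Finsupp.linearCombination_single, one_smul,
    LinearMap.id_apply] at this
  rw [LinearMap.comp_apply, this, Finsupp.lapply_apply, Finsupp.single_apply]

/-- The sections `gluedPow` for `k < a` and `slotPow` for `k ≥ a`. -/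
def rosVec (g m a : ℕ) (i : ZMod (g - 1)) (k : ℕ) : Pro g :=
  if k < a then gluedPow g (4 * m) i k else slotPow g i k

lemma linearIndependent_rosVec (g : ℕ) [NeZero (g - 1)] {m a : ℕ} (hm : 1 ≤ m)
    (ha : a ≤ m + 1) :
    LinearIndependent ℂ
      (fun s : ZMod (g - 1) × Fin (4 * m - 1) => rosVec g m a s.1 s.2) := by
  obtain ⟨φ, hφ⟩ := exists_coeff_inv_X_pow
  rw [Fintype.linearIndependent_iff]
  intro c hc
  have hslot : ∀ (i j : ZMod (g - 1)) (k l : ℕ),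
      φ l (slotPow g i k j) = if i = j ∧ k = l then 1 else 0 := by
    intro i j k l
    by_cases h : i = j
    · subst h
      simp only [slotPow, Pi.single_eq_same, hφ, true_and]
    · simp [slotPow, h]
  have key : ∀ (j : ZMod (g - 1)) (l : ℕ),
      ∑ s : ZMod (g - 1) × Fin (4 * m - 1), c s * φ l (rosVec g m a s.1 s.2 j) = 0 := by
    intro j l
    have := congrArg (fun f : Pro g => φ l (f j)) hc
    simpa [Finset.sum_apply, map_sum] using this
  have low : ∀ (j : ZMod (g - 1)) (l : Fin (4 * m - 1)), (l : ℕ) < a → c (j, l) = 0 := by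
    intro j l hl
    rw [← key j l, Finset.sum_eq_single (j, l)]
    · have h1 : ¬ (j + 1 = j ∧ 4 * m - (l : ℕ) = l) := fun h => by omega
      simp only [rosVec, hl, if_true, gluedPow, Pi.add_apply, map_add, hslot]
      rw [if_neg h1]
      simp
    · rintro ⟨i, k⟩ - hne
      have h1 : ¬ (i = j ∧ (k : ℕ) = l) := fun h => hne (by rw [h.1, Fin.ext h.2])
      simp only [rosVec]
      split_ifs with hk
      · simp only [gluedPow, Pi.add_apply, map_add, hslot]
        rw [if_neg h1, if_neg (fun h => by omega)]
        simp
      · rw [hslot, if_neg h1, mul_zero]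
    · simp
  rintro ⟨j, l⟩
  by_cases hl : (l : ℕ) < a
  · exact low j l hl
  · rw [← key j l, Finset.sum_eq_single (j, l)]
    · simp [rosVec, hl, hslot]
    · rintro ⟨i, k⟩ - hne
      by_cases hk : (k : ℕ) < a
      · rw [low i k hk, zero_mul]
      · have h1 : ¬ (i = j ∧ (k : ℕ) = l) := fun h => hne (by rw [h.1, Fin.ext h.2])
        simp only [rosVec, hk, if_false]
        rw [hslot, if_neg h1, mul_zero]
    · simp

lemma stdSpan_le_span_rosVec (g : ℕ) {m a : ℕ} (hm : 1 ≤ m) (ha2 : 2 ≤ a) (ha : a ≤ m + 1) :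
    stdSpan g m ≤ Submodule.span ℂ
      (Set.range fun s : ZMod (g - 1) × Fin (4 * m - 1) => rosVec g m a s.1 s.2) := by
  have hmem : ∀ i k, k < 4 * m - 1 → rosVec g m a i k ∈ Submodule.span ℂ
      (Set.range fun s : ZMod (g - 1) × Fin (4 * m - 1) => rosVec g m a s.1 s.2) :=
    fun i k hk => Submodule.subset_span ⟨(i, ⟨k, hk⟩), rfl⟩
  refine Submodule.span_le.2 ?_
  rintro f (⟨i, k, hk, hk', rfl⟩ | ⟨i, k, hk, rfl⟩)
  · by_cases hka : k < a
    · have h1 := hmem i k (by omega)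
      have h2 := hmem (i + 1) (4 * m - k) (by omega)
      rw [rosVec, if_pos hka] at h1
      rw [rosVec, if_neg (by omega)] at h2
      have := sub_mem h1 h2
      rwa [gluedPow, add_sub_cancel_right] at this
    · have h1 := hmem i k (by omega)
      rwa [rosVec, if_neg hka] at h1
  · have h1 := hmem i k (by omega)
    rwa [rosVec, if_pos (by omega)] at h1

/-- Exponents of the five variables `x_i, y_i, z_i, y_(i-1), x_(i-1)` that do not vanish on
the component `i`. -/
structure SlotExp where
  /-- exponent of `x_i` -/
  x : ℕ
  /-- exponent of `y_i` -/
  y : ℕ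
  /-- exponent of `z_i` -/
  z : ℕ
  /-- exponent of `y_(i-1)` -/
  yPrev : ℕ
  /-- exponent of `x_(i-1)` -/
  xPrev : ℕ

/-- The number of factors of the monomial. -/
def SlotExp.card (E : SlotExp) : ℕ := E.x + E.y + E.z + E.yPrev + E.xPrev

/-- The order in `u⁻¹` of the monomial on the component `i`. -/
def SlotExp.order (E : SlotExp) : ℕ := E.y + 2 * E.z + 3 * E.yPrev + 4 * E.xPrev

/-- The monomial is supported on the component `i` only. -/
def SlotExp.IsLocal (E : SlotExp) : Prop := 0 < E.z ∨ (0 < E.x + E.y ∧ 0 < E.yPrev + E.xPrev)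

/-- The monomial with the given exponents. -/
def SlotExp.mon (g : ℕ) (E : SlotExp) (i : ZMod (g - 1)) : Multiset (IdxR g) :=
  Multiset.replicate E.x (Sum.inl i) + Multiset.replicate E.y (Sum.inr (Sum.inl i)) +
    Multiset.replicate E.z (Sum.inr (Sum.inr i)) +
    Multiset.replicate E.yPrev (Sum.inr (Sum.inl (i - 1))) +
    Multiset.replicate E.xPrev (Sum.inl (i - 1))

lemma SlotExp.card_mon (g : ℕ) (E : SlotExp) (i : ZMod (g - 1)) :
    Multiset.card (E.mon g i) = E.card := by
  simp [SlotExp.mon, SlotExp.card]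

lemma SlotExp.sum_mon (g : ℕ) (E : SlotExp) (i : ZMod (g - 1)) (w : IdxR g → ℤ) :
    ((E.mon g i).map w).sum = E.x * w (Sum.inl i) + E.y * w (Sum.inr (Sum.inl i)) +
      E.z * w (Sum.inr (Sum.inr i)) + E.yPrev * w (Sum.inr (Sum.inl (i - 1))) +
      E.xPrev * w (Sum.inl (i - 1)) := by
  simp [SlotExp.mon]

lemma slotPow_mul_gluedPow_pow (g : ℕ) (h2 : (2 : ZMod (g - 1)) ≠ 0) (d : ℕ)
    (i : ZMod (g - 1)) (k l p : ℕ) :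
    slotPow g i k * gluedPow g d i l ^ p = slotPow g i (k + p * l) := by
  induction p with
  | zero => simp
  | succ p ih =>
    rw [pow_succ, ← mul_assoc, ih, slotPow_mul_gluedPow g h2]
    congr 1; ring

lemma slotPow_mul_gluedPow_pred_pow (g : ℕ) (h2 : (2 : ZMod (g - 1)) ≠ 0) (d : ℕ)
    (i : ZMod (g - 1)) (k l p : ℕ) :
    slotPow g i k * gluedPow g d (i - 1) l ^ p = slotPow g i (k + p * (d - l)) := by
  induction p with
  | zero => simp
  | succ p ih =>
    rw [pow_succ, ← mul_assoc, ih, slotPow_mul_gluedPow_pred g h2]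
    congr 1; ring

lemma slotPow_pow (g : ℕ) (i : ZMod (g - 1)) (k p : ℕ) :
    slotPow g i k ^ (p + 1) = slotPow g i ((p + 1) * k) := by
  induction p with
  | zero => simp
  | succ p ih =>
    rw [pow_succ, ih, slotPow_mul_same]
    congr 1; ring

lemma gluedPow_pow_mul_pow (g : ℕ) (h2 : (2 : ZMod (g - 1)) ≠ 0) (i : ZMod (g - 1)) {p q : ℕ}
    (h : 0 < p + q) :
    gluedPow g 4 i 0 ^ p * gluedPow g 4 i 1 ^ q = gluedPow g (4 * (p + q)) i q := by
  rcases p with _ | p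
  · obtain ⟨q, rfl⟩ : ∃ q', q = q' + 1 := ⟨q - 1, by omega⟩
    rw [gluedPow_pow g h2 i (by omega), pow_zero, one_mul]
    congr 1 <;> ring
  · rcases q with _ | q
    · rw [gluedPow_pow g h2 i (by omega), pow_zero, mul_one]
      congr 1; ring
    · rw [gluedPow_pow g h2 i (by omega), gluedPow_pow g h2 i (by omega),
        gluedPow_mul_same g h2 i (by omega) (by omega)]
      congr 1 <;> ring

lemma SlotExp.prod_mon (g : ℕ) (h2 : (2 : ZMod (g - 1)) ≠ 0) (E : SlotExp) (i : ZMod (g - 1)) :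
    ((E.mon g i).map (varRos g)).prod =
      gluedPow g 4 i 0 ^ E.x * gluedPow g 4 i 1 ^ E.y * slotPow g i 2 ^ E.z *
        (gluedPow g 4 (i - 1) 0 ^ E.xPrev * gluedPow g 4 (i - 1) 1 ^ E.yPrev) := by
  simp only [SlotExp.mon, Multiset.map_add, Multiset.prod_add, Multiset.map_replicate,
    Multiset.prod_replicate, varRos, Sum.elim_inl, Sum.elim_inr, xRos_eq g h2, yRos_eq,
    zRos_eq g h2, gluedPow]
  ring

lemma SlotExp.prod_mon_of_isLocal (g : ℕ) (h2 : (2 : ZMod (g - 1)) ≠ 0) (E : SlotExp)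
    (hE : E.IsLocal) (i : ZMod (g - 1)) :
    ((E.mon g i).map (varRos g)).prod = slotPow g i E.order := by
  rw [E.prod_mon g h2]
  rcases Nat.eq_zero_or_pos E.z with hz | hz
  · obtain ⟨hxy, hxy'⟩ := hE.resolve_left (by omega)
    rw [hz, pow_zero, mul_one, gluedPow_pow_mul_pow g h2 i hxy,
      gluedPow_pow_mul_pow g h2 _ (by omega), gluedPow_mul_gluedPow_pred g h2]
    congr 1
    rw [SlotExp.order]
    omega
  · obtain ⟨n, hn⟩ : ∃ n, E.z = n + 1 := ⟨E.z - 1, by omega⟩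
    rw [hn, slotPow_pow, mul_comm (_ * _) (slotPow g i _), ← mul_assoc, ← mul_assoc,
      slotPow_mul_gluedPow_pow g h2, slotPow_mul_gluedPow_pow g h2,
      slotPow_mul_gluedPow_pred_pow g h2, slotPow_mul_gluedPow_pred_pow g h2]
    congr 1
    rw [SlotExp.order]
    omega

lemma SlotExp.prod_mon_of_eq_zero (g : ℕ) (h2 : (2 : ZMod (g - 1)) ≠ 0) (E : SlotExp)
    (hz : E.z = 0) (hy : E.yPrev = 0) (hx : E.xPrev = 0) (hE : 0 < E.card) (i : ZMod (g - 1)) :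
    ((E.mon g i).map (varRos g)).prod = gluedPow g (4 * E.card) i E.order := by
  have hc : E.card = E.x + E.y := by simp [SlotExp.card, hx, hy, hz]
  have ho : E.order = E.y := by simp [SlotExp.order, hx, hy, hz]
  rw [E.prod_mon g h2, hz, hy, hx, hc, ho, ← gluedPow_pow_mul_pow g h2 i (by omega)]
  simp

/-- A rotation-invariant choice of monomials, one for each order `k ≤ 4m-2` on each component,
glued for `k < a` and local for `k ≥ a`, is a monomial basis. -/
lemma exists_isMonBasisRos_of_slotExp (g : ℕ) [NeZero (g - 1)] (h2 : (2 : ZMod (g - 1)) ≠ 0)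
    {m a : ℕ} (hm : 1 ≤ m) (ha2 : 2 ≤ a) (ha : a ≤ m + 1) (E : ℕ → SlotExp)
    (hcard : ∀ k < 4 * m - 1, (E k).card = m) (horder : ∀ k < 4 * m - 1, (E k).order = k)
    (hlow : ∀ k < a, (E k).z = 0 ∧ (E k).yPrev = 0 ∧ (E k).xPrev = 0)
    (hhigh : ∀ k < 4 * m - 1, a ≤ k → (E k).IsLocal) {Y Z : ℕ}
    (hY : ∑ k ∈ Finset.range (4 * m - 1), ((E k).y + (E k).yPrev) = Y)
    (hZ : ∑ k ∈ Finset.range (4 * m - 1), (E k).z = Z) (w : IdxR g → ℤ) :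
    ∃ S : Finset (DegMonR g m), IsMonBasisRos g m S ∧
      ∑ σ ∈ S, (σ.1.map w).sum =
        ((4 * m - 1) * m - Y - Z) * (∑ i, w (Sum.inl i)) +
        Y * (∑ i, w (Sum.inr (Sum.inl i))) + Z * (∑ i, w (Sum.inr (Sum.inr i))) := by
  classical
  let F : ZMod (g - 1) × Fin (4 * m - 1) → DegMonR g m := fun s =>
    ⟨(E s.2).mon g s.1, by rw [SlotExp.card_mon, hcard _ s.2.2]⟩
  have hF : ∀ s, ((F s).1.map (varRos g)).prod = rosVec g m a s.1 s.2 := by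
    rintro ⟨i, k, hk⟩
    simp only [F, rosVec]
    split_ifs with hka
    · obtain ⟨hz, hy, hx⟩ := hlow k hka
      rw [SlotExp.prod_mon_of_eq_zero g h2 _ hz hy hx (by rw [hcard k hk]; omega), hcard k hk,
        horder k hk]
    · rw [SlotExp.prod_mon_of_isLocal g h2 _ (hhigh k hk (by omega)), horder k hk]
  have hli := linearIndependent_rosVec g hm ha
  have hli' : LinearIndependent ℂ
      ((fun σ : DegMonR g m => (σ.1.map (varRos g)).prod) ∘ F) := by
    convert hli using 1
    exact funext hF
  have hinj : Function.Injective F := hli'.injective.of_comp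
  refine ⟨Finset.univ.image F, ⟨?_, ?_⟩, ?_⟩
  · have := (linearIndepOn_range_iff (R := ℂ) hinj
      (fun σ : DegMonR g m => (σ.1.map (varRos g)).prod)).2 hli'
    rw [← Set.image_univ, ← Finset.coe_univ, ← Finset.coe_image] at this
    exact this
  · rw [Finset.coe_image, Finset.coe_univ, Set.image_univ, ← Set.range_comp]
    refine le_antisymm (Submodule.span_mono ?_) ?_
    · rintro _ ⟨s, rfl⟩
      exact ⟨(F s).1, (F s).2, rfl⟩
    · rw [show ((fun σ : DegMonR g m => (σ.1.map (varRos g)).prod) ∘ F) = _ from funext hF]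
      refine le_trans (Submodule.span_le.2 ?_) (stdSpan_le_span_rosVec g hm ha2 ha)
      rintro _ ⟨σ, hσ, rfl⟩
      obtain ⟨n, rfl⟩ : ∃ n, m = n + 1 := ⟨m - 1, by omega⟩
      exact prod_varRos_mem_stdSpan g h2 n σ hσ
  · have hX : ∑ k ∈ Finset.range (4 * m - 1), ((E k).x + (E k).xPrev : ℤ) =
        (4 * m - 1) * m - Y - Z := by
      have h : ∑ k ∈ Finset.range (4 * m - 1), (E k).card = (4 * m - 1) * m := by
        rw [Finset.sum_congr rfl fun k hk => hcard k (Finset.mem_range.1 hk)]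
        simp
      have h' := congrArg (Nat.cast : ℕ → ℤ) h
      rw [← hY, ← hZ]
      push_cast [SlotExp.card, Nat.cast_sub (show 1 ≤ 4 * m by omega)] at h' ⊢
      rw [← h', ← Finset.sum_sub_distrib, ← Finset.sum_sub_distrib]
      exact Finset.sum_congr rfl fun k _ => by ring
    have hshift : ∀ f : ZMod (g - 1) → ℤ, ∑ i, f (i - 1) = ∑ i, f i := fun f =>
      Equiv.sum_comp (Equiv.subRight (1 : ZMod (g - 1))) f
    rw [Finset.sum_image (fun s _ t _ h => hinj h), Fintype.sum_prod_type, Finset.sum_comm,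
      ← hX, ← hY, ← hZ]
    simp only [F, SlotExp.sum_mon, Finset.sum_add_distrib, ← Finset.mul_sum,
      hshift (fun i => w (Sum.inl i)), hshift (fun i => w (Sum.inr (Sum.inl i)))]
    simp only [← Finset.sum_mul, Finset.sum_range]
    push_cast
    ring

/-- Exponents of a basis with many factors `x`. -/
def expX (m k : ℕ) : SlotExp where
  x := if k % 4 = 0 then m - k / 4 else m - 1 - k / 4
  y := if k % 4 = 1 then 1 else 0
  z := if k % 4 = 2 then 1 else 0
  yPrev := if k % 4 = 3 then 1 else 0
  xPrev := k / 4

/-- Exponents of a basis with many factors `z` and few factors `y`. -/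
def expZ (m k : ℕ) : SlotExp where
  x := if k ≤ 2 * m then m - k / 2 - k % 2 else 0
  y := if k ≤ 2 * m then k % 2 else 0
  z := if k ≤ 2 * m then k / 2 else (4 * m - k) / 2
  yPrev := if k ≤ 2 * m then 0 else k % 2
  xPrev := if k ≤ 2 * m then 0 else m - (4 * m - k) / 2 - k % 2

/-- Exponents of a basis with few factors `x` and many factors `y` and `z`. -/
def expYZ (m k : ℕ) : SlotExp where
  x := m - k
  y := if k ≤ m then k else 2 * m - k
  z := if k ≤ m then 0 else if k ≤ 2 * m then k - m else if k < 3 * m then 3 * m - k else 1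
  yPrev := if k < 3 * m then k - 2 * m else 4 * m - 2 - k
  xPrev := k + 1 - 3 * m

lemma sum_range_mod_two (M : ℕ) : ∑ k ∈ Finset.range (4 * M + 3), k % 2 = 2 * M + 1 := by
  induction M with
  | zero => decide
  | succ M ih =>
    rw [show 4 * (M + 1) + 3 = 4 * M + 3 + 1 + 1 + 1 + 1 by ring]
    rw [Finset.sum_range_succ, Finset.sum_range_succ, Finset.sum_range_succ,
      Finset.sum_range_succ, ih]
    omega

lemma sum_range_mod_four (M : ℕ) :
    ∑ k ∈ Finset.range (4 * M + 3), (if k % 4 = 2 then 1 else 0) = M + 1 := by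
  induction M with
  | zero => decide
  | succ M ih =>
    rw [show 4 * (M + 1) + 3 = 4 * M + 3 + 1 + 1 + 1 + 1 by ring]
    rw [Finset.sum_range_succ, Finset.sum_range_succ, Finset.sum_range_succ,
      Finset.sum_range_succ, ih]
    rw [if_neg (by omega), if_neg (by omega), if_neg (by omega), if_pos (by omega)]

lemma sum_range_div_two (M : ℕ) : ∑ k ∈ Finset.range (2 * M + 1), k / 2 = M ^ 2 := by
  induction M with
  | zero => decide
  | succ M ih =>
    rw [show 2 * (M + 1) + 1 = 2 * M + 1 + 1 + 1 by ring, Finset.sum_range_succ,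
      Finset.sum_range_succ, ih, show (2 * M + 1) / 2 = M by omega,
      show (2 * M + 1 + 1) / 2 = M + 1 by omega]
    ring

lemma sum_range_sub_div_two (M : ℕ) :
    ∑ k ∈ Finset.range (2 * M), (2 * M + 1 - k) / 2 = M * (M + 1) := by
  induction M with
  | zero => simp
  | succ M ih =>
    rw [show 2 * (M + 1) = 2 * M + 1 + 1 by ring, Finset.sum_range_succ', Finset.sum_range_succ',
      Finset.sum_congr rfl fun k _ => show (2 * M + 1 + 1 + 1 - (k + 1 + 1)) / 2 =
        (2 * M + 1 - k) / 2 by omega, ih, show (2 * M + 1 + 1 + 1 - (0 + 1)) / 2 = M + 1 by omega,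
      show (2 * M + 1 + 1 + 1 - 0) / 2 = M + 1 by omega]
    ring

lemma two_mul_sum_range_succ (N : ℕ) : 2 * ∑ k ∈ Finset.range N, (k + 1) = N * (N + 1) := by
  induction N with
  | zero => simp
  | succ N ih => rw [Finset.sum_range_succ, mul_add, ih]; ring

lemma two_mul_sum_range_sub (N : ℕ) : 2 * ∑ k ∈ Finset.range N, (N - k) = N * (N + 1) := by
  induction N with
  | zero => simp
  | succ N ih =>
    rw [Finset.sum_range_succ']
    simp only [Nat.add_sub_add_right, mul_add, ih]
    simp only [Nat.sub_zero]
    ring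

lemma sum_expZ_z (M : ℕ) :
    ∑ k ∈ Finset.range (4 * M + 3), (expZ (M + 1) k).z = (M + 1) * (2 * M + 1) := by
  rw [show 4 * M + 3 = 2 * (M + 1) + 1 + 2 * M by ring, Finset.sum_range_add,
    Finset.sum_congr rfl fun k hk => show (expZ (M + 1) k).z = k / 2 from
      if_pos (by have := Finset.mem_range.1 hk; omega),
    Finset.sum_congr rfl fun k _ => show (expZ (M + 1) (2 * (M + 1) + 1 + k)).z =
        (2 * M + 1 - k) / 2 from (if_neg (by omega)).trans (by omega),
    sum_range_div_two, sum_range_sub_div_two]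
  ring

lemma sum_range_split (M : ℕ) (f : ℕ → ℕ) :
    ∑ k ∈ Finset.range (4 * M + 3), f k = ∑ k ∈ Finset.range (M + 2), f k +
      ∑ k ∈ Finset.range (M + 1), f (M + 2 + k) + ∑ k ∈ Finset.range M, f (2 * M + 3 + k) +
      ∑ k ∈ Finset.range M, f (3 * M + 3 + k) := by
  rw [show 4 * M + 3 = M + 2 + (M + 1) + M + M by ring, Finset.sum_range_add,
    Finset.sum_range_add, Finset.sum_range_add, show M + 2 + (M + 1) = 2 * M + 3 by ring,
    show 2 * M + 3 + M = 3 * M + 3 by ring]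

lemma sum_expYZ_z (M : ℕ) :
    ∑ k ∈ Finset.range (4 * M + 3), (expYZ (M + 1) k).z = (M + 1) ^ 2 + M := by
  have h1 : ∀ k ∈ Finset.range (M + 2), (expYZ (M + 1) k).z = 0 := fun k hk => by
    have := Finset.mem_range.1 hk
    simp only [expYZ]; split_ifs <;> omega
  have h2 : ∀ k ∈ Finset.range (M + 1), (expYZ (M + 1) (M + 2 + k)).z = k + 1 := fun k hk => by
    have := Finset.mem_range.1 hk
    simp only [expYZ]; split_ifs <;> omega
  have h3 : ∀ k ∈ Finset.range M, (expYZ (M + 1) (2 * M + 3 + k)).z = M - k := fun k hk => by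
    have := Finset.mem_range.1 hk
    simp only [expYZ]; split_ifs <;> omega
  have h4 : ∀ k ∈ Finset.range M, (expYZ (M + 1) (3 * M + 3 + k)).z = 1 := fun k hk => by
    have := Finset.mem_range.1 hk
    simp only [expYZ]; split_ifs <;> omega
  rw [sum_range_split, Finset.sum_congr rfl h1, Finset.sum_congr rfl h2, Finset.sum_congr rfl h3,
    Finset.sum_congr rfl h4]
  have e1 := two_mul_sum_range_succ (M + 1)
  have e2 := two_mul_sum_range_sub M
  simp only [Finset.sum_const, Finset.card_range, smul_eq_mul, mul_zero, mul_one]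
  linarith

lemma sum_expYZ_y (M : ℕ) :
    ∑ k ∈ Finset.range (4 * M + 3), ((expYZ (M + 1) k).y + (expYZ (M + 1) k).yPrev) =
      2 * M * (M + 1) + 1 := by
  have h1 : ∀ k ∈ Finset.range (M + 2),
      (expYZ (M + 1) k).y + (expYZ (M + 1) k).yPrev = k := fun k hk => by
    have := Finset.mem_range.1 hk
    simp only [expYZ]; split_ifs <;> omega
  have h2 : ∀ k ∈ Finset.range (M + 1), (expYZ (M + 1) (M + 2 + k)).y +
      (expYZ (M + 1) (M + 2 + k)).yPrev = M - k := fun k hk => by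
    have := Finset.mem_range.1 hk
    simp only [expYZ]; split_ifs <;> omega
  have h3 : ∀ k ∈ Finset.range M, (expYZ (M + 1) (2 * M + 3 + k)).y +
      (expYZ (M + 1) (2 * M + 3 + k)).yPrev = k + 1 := fun k hk => by
    have := Finset.mem_range.1 hk
    simp only [expYZ]; split_ifs <;> omega
  have h4 : ∀ k ∈ Finset.range M, (expYZ (M + 1) (3 * M + 3 + k)).y +
      (expYZ (M + 1) (3 * M + 3 + k)).yPrev + 1 = M - k := fun k hk => by
    have := Finset.mem_range.1 hk
    simp only [expYZ]; split_ifs <;> omega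
  have h4' := Finset.sum_congr rfl h4
  rw [Finset.sum_add_distrib] at h4'
  rw [sum_range_split, Finset.sum_congr rfl h1, Finset.sum_congr rfl h2, Finset.sum_congr rfl h3,
    Finset.sum_range_succ' _ (M + 1), Finset.sum_range_succ (fun k => M - k), Nat.sub_self]
  have e1 := two_mul_sum_range_succ (M + 1)
  have e2 := two_mul_sum_range_sub M
  have e3 := two_mul_sum_range_succ M
  simp only [Finset.sum_const, Finset.card_range, smul_eq_mul, mul_one] at h4' ⊢
  linarith

lemma exists_basis_expX (g : ℕ) [NeZero (g - 1)] (h2 : (2 : ZMod (g - 1)) ≠ 0) (M : ℕ)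
    (w : IdxR g → ℤ) :
    ∃ S : Finset (DegMonR g (M + 1)), IsMonBasisRos g (M + 1) S ∧
      ∑ σ ∈ S, (σ.1.map w).sum =
        (2 * M + 1) ^ 2 * (∑ i, w (Sum.inl i)) + (2 * M + 1) * (∑ i, w (Sum.inr (Sum.inl i))) +
          (M + 1) * (∑ i, w (Sum.inr (Sum.inr i))) := by
  obtain ⟨S, hS, h⟩ := exists_isMonBasisRos_of_slotExp g h2 (m := M + 1) (a := 2) (by omega)
    le_rfl (by omega) (expX (M + 1))
    (fun k hk => by simp only [SlotExp.card, expX]; split_ifs <;> omega)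
    (fun k hk => by simp only [SlotExp.order, expX]; split_ifs <;> omega)
    (fun k hk => by simp only [expX]; split_ifs <;> omega)
    (fun k hk hk' => by simp only [SlotExp.IsLocal, expX]; split_ifs <;> omega)
    (Y := 2 * M + 1) (Z := M + 1)
    ((Finset.sum_congr rfl fun k _ => by simp only [expX]; split_ifs <;> omega).trans
      (sum_range_mod_two M))
    (sum_range_mod_four M) w
  refine ⟨S, hS, h.trans ?_⟩
  push_cast
  ring

lemma exists_basis_expZ (g : ℕ) [NeZero (g - 1)] (h2 : (2 : ZMod (g - 1)) ≠ 0) (M : ℕ)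
    (hM : 1 ≤ M) (w : IdxR g → ℤ) :
    ∃ S : Finset (DegMonR g (M + 1)), IsMonBasisRos g (M + 1) S ∧
      ∑ σ ∈ S, (σ.1.map w).sum =
        (2 * M ^ 2 + 2 * M + 1) * (∑ i, w (Sum.inl i)) +
          (2 * M + 1) * (∑ i, w (Sum.inr (Sum.inl i))) +
          (M + 1) * (2 * M + 1) * (∑ i, w (Sum.inr (Sum.inr i))) := by
  obtain ⟨S, hS, h⟩ := exists_isMonBasisRos_of_slotExp g h2 (m := M + 1) (a := 2) (by omega)
    le_rfl (by omega) (expZ (M + 1))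
    (fun k hk => by simp only [SlotExp.card, expZ]; split_ifs <;> omega)
    (fun k hk => by simp only [SlotExp.order, expZ]; split_ifs <;> omega)
    (fun k hk => by simp only [expZ]; split_ifs <;> omega)
    (fun k hk hk' => by simp only [SlotExp.IsLocal, expZ]; split_ifs <;> omega)
    (Y := 2 * M + 1) (Z := (M + 1) * (2 * M + 1))
    ((Finset.sum_congr rfl fun k _ => by simp only [expZ]; split_ifs <;> omega).trans
      (sum_range_mod_two M))
    (sum_expZ_z M) w
  refine ⟨S, hS, h.trans ?_⟩
  push_cast
  ring

lemma exists_basis_expYZ (g : ℕ) [NeZero (g - 1)] (h2 : (2 : ZMod (g - 1)) ≠ 0) (M : ℕ)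
    (hM : 1 ≤ M) (w : IdxR g → ℤ) :
    ∃ S : Finset (DegMonR g (M + 1)), IsMonBasisRos g (M + 1) S ∧
      ∑ σ ∈ S, (σ.1.map w).sum =
        (M + 1) ^ 2 * (∑ i, w (Sum.inl i)) +
          (2 * M * (M + 1) + 1) * (∑ i, w (Sum.inr (Sum.inl i))) +
          ((M + 1) ^ 2 + M) * (∑ i, w (Sum.inr (Sum.inr i))) := by
  obtain ⟨S, hS, h⟩ := exists_isMonBasisRos_of_slotExp g h2 (m := M + 1) (a := M + 2) (by omega)
    (by omega) le_rfl (expYZ (M + 1))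
    (fun k hk => by simp only [SlotExp.card, expYZ]; split_ifs <;> omega)
    (fun k hk => by simp only [SlotExp.order, expYZ]; split_ifs <;> omega)
    (fun k hk => by simp only [expYZ]; split_ifs <;> omega)
    (fun k hk hk' => by simp only [SlotExp.IsLocal, expYZ]; split_ifs <;> omega)
    (sum_expYZ_y M) (sum_expYZ_z M) w
  refine ⟨S, hS, h.trans ?_⟩
  push_cast
  ring

/-- Combinatorial content of Theorem 4.14.  (The instance `NeZero (g-1)`, which follows
from `5 ≤ g`, makes `ℤ/(g-1)` a fintype so that the total weight sum makes sense.) -/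
theorem rosary_bicanonical_semistable (g : ℕ) (hodd : Odd g) (hg : 5 ≤ g)
    [NeZero (g - 1)] (m : ℕ) (hm : 2 ≤ m)
    (w : IdxR g → ℤ) (hw : (∑ i : IdxR g, w i) = 0) :
    ∃ S : Finset (DegMonR g m), IsMonBasisRos g m S ∧
      (∑ σ ∈ S, (σ.1.map w).sum) ≤ 0 := by
  have h2 : (2 : ZMod (g - 1)) ≠ 0 := by
    have := (ZMod.natCast_eq_zero_iff 2 (g - 1)).not.2 fun h => by
      have := Nat.le_of_dvd (by omega) h
      omega
    exact_mod_cast this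
  obtain ⟨M, rfl⟩ : ∃ M, m = M + 1 := ⟨m - 1, by omega⟩
  have hM : 1 ≤ M := by omega
  obtain ⟨S₁, hS₁, h₁⟩ := exists_basis_expX g h2 M w
  obtain ⟨S₂, hS₂, h₂⟩ := exists_basis_expZ g h2 M hM w
  obtain ⟨S₃, hS₃, h₃⟩ := exists_basis_expYZ g h2 M hM w
  rw [Fintype.sum_sum_type, Fintype.sum_sum_type] at hw
  by_contra! hcon
  have p₁ := hcon S₁ hS₁
  have p₂ := hcon S₂ hS₂
  have p₃ := hcon S₃ hS₃
  rw [h₁] at p₁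
  rw [h₂] at p₂
  rw [h₃] at p₃
  generalize ∑ i, w (Sum.inl i) = A at *
  generalize ∑ i, w (Sum.inr (Sum.inl i)) = B at *
  generalize ∑ i, w (Sum.inr (Sum.inr i)) = C at *
  obtain rfl : C = -A - B := by linarith
  have hM' : (1 : ℤ) ≤ M := by exact_mod_cast hM
  have q₁ := mul_pos (show (0 : ℤ) < 3 * M by linarith) p₁
  have q₂ := mul_pos (show (0 : ℤ) < 4 * M ^ 2 - M - 2 by nlinarith) p₂
  have q₃ := mul_pos (show (0 : ℤ) < 2 * (M + 1) * (4 * M + 1) by nlinarith) p₃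
  linarith

end
end

section
/- For all integers n ≥ 1 and 0 ≤ k ≤ n, there exist a positive integer s and a function c : {0,…,n}×{0,…,n} → ℕ such that: c(i,j) = 0 unless k ≤ i+j ≤ 2n−k; for every d with k ≤ d ≤ 2n−k, Σ_{i+j=d} c(i,j) = s; and the occurrence count Σ_{j=0}^n (c(i,j) + c(j,i)) takes the same value for every i ∈ {0,…,n} (necessarily 2s(2n−2k+1)/(n+1)). (Proposition 5.6: there exists an X-balanced quadratic monomial multibasis of Z_k = span{z^d : k ≤ d ≤ 2n−k} in the variables x_i = z^i, 0 ≤ i ≤ n.) -/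
open Polynomial in
/-- The monoid of pairs (degree distribution, variable occurrence count), written as generating
polynomials, of finite multisets of quadratic monomials `x_i x_j` with `i, j < N`. -/
noncomputable def monomialCounts (N : ℕ) : AddSubmonoid (ℕ[X] × ℕ[X]) :=
  AddSubmonoid.closure {p | ∃ i j, i < N ∧ j < N ∧ p = (X ^ (i + j), X ^ i + X ^ j)}

open Polynomial in
/-- The generating polynomial `1 + X + ⋯ + X ^ (a - 1)` of an initial segment. -/
noncomputable def segmentPoly (a : ℕ) : ℕ[X] := ∑ i ∈ Finset.range a, X ^ i

open Polynomial in
/-- There is a balanced multibasis in `k + r + 1` variables, with degrees `k, …, k + 2 r`. -/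
def HasBalanced (k r : ℕ) : Prop :=
  ∃ s t : ℕ, 0 < s ∧ 0 < t ∧
    ((s : ℕ[X]) * (X ^ k * segmentPoly (2 * r + 1)), (t : ℕ[X]) * segmentPoly (k + r + 1)) ∈
      monomialCounts (k + r + 1)

section

open Polynomial

theorem segmentPoly_add (a b : ℕ) :
    segmentPoly (a + b) = segmentPoly a + X ^ a * segmentPoly b := by
  simp [segmentPoly, Finset.sum_range_add, pow_add, Finset.mul_sum]

theorem segmentPoly_one : segmentPoly 1 = 1 := by simp [segmentPoly]

theorem coeff_segmentPoly (a d : ℕ) : (segmentPoly a).coeff d = if d < a then 1 else 0 := by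
  simp [segmentPoly, coeff_X_pow]

theorem eval_one_segmentPoly (a : ℕ) : (segmentPoly a).eval 1 = a := by
  simp [segmentPoly, eval_finsetSum]

theorem monomial_mem_monomialCounts {N i j : ℕ} (hi : i < N) (hj : j < N) :
    ((X ^ (i + j), X ^ i + X ^ j) : ℕ[X] × ℕ[X]) ∈ monomialCounts N :=
  AddSubmonoid.subset_closure ⟨i, j, hi, hj, rfl⟩

theorem natCast_mul_mem_monomialCounts {N : ℕ} {D m : ℕ[X]} (a : ℕ)
    (h : (D, m) ∈ monomialCounts N) : ((a : ℕ[X]) * D, (a : ℕ[X]) * m) ∈ monomialCounts N := by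
  have := (monomialCounts N).nsmul_mem h a
  simpa [nsmul_eq_mul] using this

theorem add_mem_monomialCounts {N : ℕ} {D m D' m' : ℕ[X]}
    (h : (D, m) ∈ monomialCounts N) (h' : (D', m') ∈ monomialCounts N) :
    (D + D', m + m') ∈ monomialCounts N :=
  (monomialCounts N).add_mem h h'

theorem monomialCounts_mono {M N : ℕ} (hMN : M ≤ N) : monomialCounts M ≤ monomialCounts N := by
  refine AddSubmonoid.closure_mono ?_
  rintro _ ⟨i, j, hi, hj, rfl⟩
  exact ⟨i, j, by omega, by omega, rfl⟩

/-- Shifting all variables by `a`. -/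
theorem shift_mem_monomialCounts {L : ℕ} (a : ℕ) {p : ℕ[X] × ℕ[X]} (h : p ∈ monomialCounts L) :
    (X ^ (2 * a) * p.1, X ^ a * p.2) ∈ monomialCounts (L + a) := by
  induction h using AddSubmonoid.closure_induction with
  | mem p hp =>
    obtain ⟨i, j, hi, hj, rfl⟩ := hp
    convert monomial_mem_monomialCounts (N := L + a) (i := i + a) (j := j + a)
      (by omega) (by omega) using 2 <;> ring
  | zero =>
    simp only [Prod.fst_zero, Prod.snd_zero, mul_zero]
    exact (monomialCounts (L + a)).zero_mem
  | add p q _ _ hp hq =>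
    convert add_mem_monomialCounts hp hq using 2 <;> simp [mul_add]

/-- Shifting, in each monomial, either one of the two variables by `a`. -/
theorem cross_shift_mem_monomialCounts {L : ℕ} (a : ℕ) {p : ℕ[X] × ℕ[X]}
    (h : p ∈ monomialCounts L) :
    (2 * (X ^ a * p.1), (1 + X ^ a) * p.2) ∈ monomialCounts (L + a) := by
  induction h using AddSubmonoid.closure_induction with
  | mem p hp =>
    obtain ⟨i, j, hi, hj, rfl⟩ := hp
    convert add_mem_monomialCounts
      (monomial_mem_monomialCounts (N := L + a) (i := i) (j := j + a) (by omega) (by omega))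
      (monomial_mem_monomialCounts (N := L + a) (i := i + a) (j := j) (by omega) (by omega))
      using 2 <;> ring
  | zero =>
    simp only [Prod.fst_zero, Prod.snd_zero, mul_zero]
    exact (monomialCounts (L + a)).zero_mem
  | add p q _ _ hp hq =>
    convert add_mem_monomialCounts hp hq using 2 <;> simp [mul_add]

/-- The basis of monomials `x_i x_{i+k}` and `x_i x_{i+k+1}`. -/
theorem chain_mem_monomialCounts (k r : ℕ) :
    (X ^ k * segmentPoly (2 * r + 1),
      (1 + X ^ k) * segmentPoly (r + 1) + (1 + X ^ (k + 1)) * segmentPoly r) ∈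
      monomialCounts (k + r + 1) := by
  induction r with
  | zero =>
    convert monomial_mem_monomialCounts (N := k + 0 + 1) (i := 0) (j := k)
      (by omega) (by omega) using 2 <;> simp [segmentPoly]
  | succ r ih =>
    convert add_mem_monomialCounts (monomialCounts_mono (by omega) ih) (add_mem_monomialCounts
      (monomial_mem_monomialCounts (N := k + (r + 1) + 1) (i := r) (j := r + k + 1)
        (by omega) (by omega))
      (monomial_mem_monomialCounts (N := k + (r + 1) + 1) (i := r + 1) (j := r + 1 + k)
        (by omega) (by omega))) using 2
    · rw [show 2 * (r + 1) + 1 = 2 * r + 1 + 1 + 1 by ring, segmentPoly_add _ 1,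
        segmentPoly_add _ 1, segmentPoly_one]
      ring
    · rw [segmentPoly_add (r + 1) 1, segmentPoly_add r 1, segmentPoly_one]
      ring

/-- The basis of monomials `x_0 x_i` and `x_i x_r`. -/
theorem hook_mem_monomialCounts (r : ℕ) :
    (segmentPoly (2 * r + 1),
      (r + 1 : ℕ[X]) + segmentPoly (r + 1) + X * segmentPoly r + (r : ℕ[X]) * X ^ r) ∈
      monomialCounts (r + 1) := by
  have h₁ : (segmentPoly (r + 1), (r + 1 : ℕ[X]) + segmentPoly (r + 1)) ∈
      monomialCounts (r + 1) := by
    have := (monomialCounts (r + 1)).sum_mem (t := Finset.range (r + 1))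
      (f := fun i => ((X ^ (0 + i), X ^ 0 + X ^ i) : ℕ[X] × ℕ[X]))
      (fun i hi => monomial_mem_monomialCounts (by omega) (Finset.mem_range.1 hi))
    convert this using 1
    ext1 <;> simp [Prod.fst_sum, Prod.snd_sum, segmentPoly, Finset.sum_add_distrib]
  have h₂ : (X ^ (r + 1) * segmentPoly r, X * segmentPoly r + (r : ℕ[X]) * X ^ r) ∈
      monomialCounts (r + 1) := by
    have := (monomialCounts (r + 1)).sum_mem (t := Finset.range r)
      (f := fun i => ((X ^ (i + 1 + r), X ^ (i + 1) + X ^ r) : ℕ[X] × ℕ[X]))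
      (fun i hi => monomial_mem_monomialCounts
        (by have := Finset.mem_range.1 hi; omega) (by omega))
    convert this using 1
    ext1
    · simp only [Prod.fst_sum, segmentPoly, Finset.mul_sum]
      exact Finset.sum_congr rfl fun i _ => by ring
    · simp [Prod.snd_sum, segmentPoly, Finset.sum_add_distrib, Finset.mul_sum, pow_succ']
  convert add_mem_monomialCounts h₁ h₂ using 2
  · rw [← segmentPoly_add]
    congr 1
    ring
  · ring

theorem hasBalanced_self (r : ℕ) : HasBalanced r r := by
  refine ⟨1, 2, by norm_num, by norm_num, ?_⟩
  convert chain_mem_monomialCounts r r using 2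
  · simp
  · have h₁ := segmentPoly_add r (r + 1)
    have h₂ := segmentPoly_add (r + 1) r
    rw [show r + 1 + r = r + r + 1 by ring] at h₂
    rw [← add_assoc] at h₁
    calc ((2 : ℕ) : ℕ[X]) * segmentPoly (r + r + 1)
        = segmentPoly (r + r + 1) + segmentPoly (r + r + 1) := by push_cast; ring
      _ = (segmentPoly r + X ^ r * segmentPoly (r + 1)) +
          (segmentPoly (r + 1) + X ^ (r + 1) * segmentPoly r) := by rw [← h₁, ← h₂]
      _ = _ := by ring

theorem hasBalanced_zero_left (r : ℕ) : HasBalanced 0 r := by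
  refine ⟨r + 1, 4 * r + 2, by omega, by omega, ?_⟩
  convert add_mem_monomialCounts
    (natCast_mul_mem_monomialCounts r (chain_mem_monomialCounts 0 r))
    (monomialCounts_mono (by omega) (hook_mem_monomialCounts r)) using 2
  · push_cast; ring
  · have h₁ : segmentPoly (r + 1) = segmentPoly r + X ^ r := by
      rw [segmentPoly_add, segmentPoly_one, mul_one]
    have h₂ : segmentPoly (r + 1) = 1 + X * segmentPoly r := by
      rw [add_comm, segmentPoly_add, segmentPoly_one, pow_one]
    rw [show 0 + r + 1 = r + 1 by ring]
    push_cast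
    calc (4 * r + 2 : ℕ[X]) * segmentPoly (r + 1)
        = (2 * r + 1 : ℕ[X]) * segmentPoly (r + 1) + (r : ℕ[X]) * segmentPoly (r + 1) +
          (r + 1 : ℕ[X]) * segmentPoly (r + 1) := by ring
      _ = (2 * r + 1 : ℕ[X]) * segmentPoly (r + 1) + (r : ℕ[X]) * (segmentPoly r + X ^ r) +
          (r + 1 : ℕ[X]) * (1 + X * segmentPoly r) := by rw [← h₁, ← h₂]
      _ = _ := by ring

/-- The two ways of cutting an interval into pieces of lengths `a` and `b`. -/
theorem segmentPoly_add_both (a b : ℕ) :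
    (1 + X ^ b) * segmentPoly a + (1 + X ^ a) * segmentPoly b = 2 * segmentPoly (a + b) := by
  have h₁ := segmentPoly_add a b
  have h₂ := segmentPoly_add b a
  rw [add_comm b a] at h₂
  calc _ = (segmentPoly a + X ^ a * segmentPoly b) + (segmentPoly b + X ^ b * segmentPoly a) := by
        ring
    _ = _ := by rw [← h₁, ← h₂]; ring

theorem HasBalanced.add {k l r : ℕ} (hk : HasBalanced k r) (hl : HasBalanced l r) :
    HasBalanced (k + l + r + 1) r := by
  obtain ⟨s, t, hs, ht, h⟩ := hk
  obtain ⟨s', t', hs', ht', h'⟩ := hl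
  refine ⟨2 * (s * t' + s' * t), 2 * (t * t'), by positivity, by positivity, ?_⟩
  convert add_mem_monomialCounts
    (natCast_mul_mem_monomialCounts t'
      (monomialCounts_mono (N := k + l + r + 1 + r + 1) (by omega)
        (cross_shift_mem_monomialCounts (l + r + 1) h)))
    (natCast_mul_mem_monomialCounts t
      (monomialCounts_mono (N := k + l + r + 1 + r + 1) (by omega)
        (cross_shift_mem_monomialCounts (k + r + 1) h'))) using 2
  · push_cast; ring
  · have := segmentPoly_add_both (k + r + 1) (l + r + 1)
    rw [show k + l + r + 1 + r + 1 = (k + r + 1) + (l + r + 1) by ring]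
    push_cast
    calc (2 * (t * t') : ℕ[X]) * segmentPoly ((k + r + 1) + (l + r + 1))
        = t * t' * (2 * segmentPoly ((k + r + 1) + (l + r + 1))) := by ring
      _ = _ := by rw [← this]; ring

/-- Two blocks of `k + a + 1` variables at both ends produce the outermost degrees; a balanced
multibasis for the remaining middle degrees fills the gap. -/
theorem exists_mem_monomialCounts_of_ends {k r a b : ℕ} (hr : r = 2 * a + b + 1)
    (ha : HasBalanced k a) (hb : HasBalanced (k + 2 * a + 1) b) :
    ∃ s p q : ℕ, 0 < s ∧ 0 < p ∧
      ((s : ℕ[X]) * (X ^ k * segmentPoly (2 * r + 1)),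
        (p : ℕ[X]) * ((1 + X ^ (r - a)) * segmentPoly (k + a + 1)) +
          (q : ℕ[X]) * segmentPoly (k + r + 1)) ∈ monomialCounts (k + r + 1) := by
  obtain ⟨s, t, hs, ht, h⟩ := ha
  obtain ⟨s', t', hs', ht', h'⟩ := hb
  refine ⟨s * s', s' * t, s * t', by positivity, by positivity, ?_⟩
  have hra : r - a = a + b + 1 := by omega
  rw [hra]
  subst hr
  convert add_mem_monomialCounts
    (natCast_mul_mem_monomialCounts s' (add_mem_monomialCounts
      (monomialCounts_mono (N := k + (2 * a + b + 1) + 1) (by omega) h)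
      (monomialCounts_mono (N := k + (2 * a + b + 1) + 1) (by omega)
        (shift_mem_monomialCounts (a + b + 1) h))))
    (natCast_mul_mem_monomialCounts s
      (monomialCounts_mono (N := k + (2 * a + b + 1) + 1) (by omega) h')) using 2
  · rw [show 2 * (2 * a + b + 1) + 1 = (2 * a + 1) + ((2 * b + 1) + (2 * a + 1)) by ring,
      segmentPoly_add (2 * a + 1), segmentPoly_add (2 * b + 1)]
    push_cast; ring
  · rw [show k + 2 * a + 1 + b + 1 = k + (2 * a + b + 1) + 1 by ring]
    push_cast; ring

theorem hasBalanced_of_ends {k a b a' b' : ℕ} (hab : 2 * a + b = 2 * a' + b')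
    (hr : 2 * a + b = a + a' + k) (ha : HasBalanced k a) (hb : HasBalanced (k + 2 * a + 1) b)
    (ha' : HasBalanced k a') (hb' : HasBalanced (k + 2 * a' + 1) b') :
    HasBalanced k (2 * a + b + 1) := by
  obtain ⟨s, p, q, hs, hp, h⟩ := exists_mem_monomialCounts_of_ends rfl ha hb
  obtain ⟨s', p', q', hs', hp', h'⟩ :=
    exists_mem_monomialCounts_of_ends (r := 2 * a + b + 1) (by omega) ha' hb'
  refine ⟨p' * s + p * s', 2 * (p * p') + p' * q + p * q', by positivity, by positivity, ?_⟩
  convert add_mem_monomialCounts (natCast_mul_mem_monomialCounts p' h)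
    (natCast_mul_mem_monomialCounts p h') using 2
  · push_cast; ring
  · have := segmentPoly_add_both (k + a + 1) (k + a' + 1)
    rw [show 2 * a + b + 1 - a = k + a' + 1 by omega,
      show 2 * a + b + 1 - a' = k + a + 1 by omega,
      show k + (2 * a + b + 1) + 1 = (k + a + 1) + (k + a' + 1) by omega]
    push_cast
    generalize segmentPoly ((k + a + 1) + (k + a' + 1)) = g at *
    calc (2 * (p * p') + p' * q + p * q' : ℕ[X]) * g
        = p * p' * (2 * g) + (p' * q + p * q') * g := by ring
      _ = _ := by rw [← this]; ring

theorem hasBalanced (k r : ℕ) : HasBalanced k r := by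
  rcases Nat.eq_zero_or_pos k with rfl | hk
  · exact hasBalanced_zero_left r
  rcases lt_trichotomy r k with h | rfl | h
  · have := (hasBalanced_zero_left r).add (hasBalanced (k - r - 1) r)
    rwa [show 0 + (k - r - 1) + r + 1 = k by omega] at this
  · exact hasBalanced_self r
  · obtain ⟨a, ha⟩ : ∃ a, a = (r - k - 1) / 2 := ⟨_, rfl⟩
    obtain ⟨a', ha'⟩ : ∃ a', a' = r - a - k - 1 := ⟨_, rfl⟩
    have := hasBalanced_of_ends (k := k) (a := a) (b := r - 2 * a - 1) (a' := a')
      (b' := r - 2 * a' - 1) (by omega) (by omega) (hasBalanced k a)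
      (hasBalanced (k + 2 * a + 1) (r - 2 * a - 1)) (hasBalanced k a')
      (hasBalanced (k + 2 * a' + 1) (r - 2 * a' - 1))
    rwa [show 2 * a + (r - 2 * a - 1) + 1 = r by omega] at this
termination_by (k + r, r)
decreasing_by all_goals simp only [Prod.lex_def]; omega

theorem eval_one_of_mem_monomialCounts {N : ℕ} {p : ℕ[X] × ℕ[X]} (h : p ∈ monomialCounts N) :
    p.2.eval 1 = 2 * p.1.eval 1 := by
  induction h using AddSubmonoid.closure_induction with
  | mem p hp =>
    obtain ⟨i, j, hi, hj, rfl⟩ := hp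
    simp
  | zero => simp
  | add p q _ _ hp hq => simp [hp, hq, mul_add]

theorem exists_count_of_mem_monomialCounts {N : ℕ} {p : ℕ[X] × ℕ[X]}
    (h : p ∈ monomialCounts N) :
    ∃ c : Fin N → Fin N → ℕ,
      (∀ d : ℕ, (∑ i : Fin N, ∑ j : Fin N, if (i : ℕ) + (j : ℕ) = d then c i j else 0) =
        p.1.coeff d) ∧
      ∀ i : Fin N, ∑ j : Fin N, (c i j + c j i) = p.2.coeff i := by
  induction h using AddSubmonoid.closure_induction with
  | mem p hp =>
    obtain ⟨a, b, ha, hb, rfl⟩ := hp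
    lift a to Fin N using ha
    lift b to Fin N using hb
    refine ⟨fun i j => if i = a then if j = b then 1 else 0 else 0, fun d => ?_, fun i => ?_⟩
    · rw [Finset.sum_eq_single a, Finset.sum_eq_single b]
      · simp [coeff_X_pow, eq_comm]
      all_goals simp +contextual
    · simp [Finset.sum_add_distrib, coeff_X_pow, Fin.val_inj]
  | zero => exact ⟨0, by simp, by simp⟩
  | add p q _ _ hp hq =>
    obtain ⟨c, h₁, h₂⟩ := hp
    obtain ⟨c', h₁', h₂'⟩ := hq
    refine ⟨c + c', fun d => ?_, fun i => ?_⟩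
    · simp only [Prod.fst_add, coeff_add, ← h₁, ← h₁', ← Finset.sum_add_distrib]
      refine Finset.sum_congr rfl fun i _ => Finset.sum_congr rfl fun j _ => ?_
      split_ifs <;> simp
    · simp only [Prod.snd_add, coeff_add, ← h₂, ← h₂', ← Finset.sum_add_distrib]
      refine Finset.sum_congr rfl fun j _ => ?_
      simp only [Pi.add_apply]
      ring

end

/-- Proposition 5.6. -/
theorem balanced_rational_curve_multibasis (n k : ℕ) (hn : 1 ≤ n) (hk : k ≤ n) :
    ∃ (s : ℕ) (c : Fin (n + 1) → Fin (n + 1) → ℕ), 0 < s ∧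
      (∀ i j : Fin (n + 1),
        ¬(k ≤ (i : ℕ) + (j : ℕ) ∧ (i : ℕ) + (j : ℕ) ≤ 2 * n - k) → c i j = 0) ∧
      (∀ d : ℕ, k ≤ d → d ≤ 2 * n - k →
        (∑ i : Fin (n + 1), ∑ j : Fin (n + 1),
          if (i : ℕ) + (j : ℕ) = d then c i j else 0) = s) ∧
      (∀ i : Fin (n + 1),
        (n + 1) * (∑ j : Fin (n + 1), (c i j + c j i)) = 2 * s * (2 * n - 2 * k + 1)) := by
  obtain ⟨r, rfl⟩ := Nat.exists_eq_add_of_le hk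
  obtain ⟨s, t, hs, -, h⟩ := hasBalanced k r
  have htotal := eval_one_of_mem_monomialCounts h
  simp only [Polynomial.eval_mul, Polynomial.eval_natCast, Polynomial.eval_pow,
    Polynomial.eval_X, eval_one_segmentPoly, one_pow, one_mul, Nat.cast_id] at htotal
  obtain ⟨c, hdeg, hvar⟩ := exists_count_of_mem_monomialCounts h
  simp only [← Polynomial.C_eq_natCast, Polynomial.coeff_C_mul, Polynomial.coeff_X_pow_mul',
    coeff_segmentPoly, Nat.cast_id] at hdeg hvar
  refine ⟨s, c, hs, fun i j hij => ?_, fun d hd hd' => ?_, fun i => ?_⟩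
  · have hsum := hdeg (i + j)
    rw [show (if k ≤ (i : ℕ) + j then if (i : ℕ) + j - k < 2 * r + 1 then 1 else 0 else 0) = 0 by
      split_ifs <;> omega, mul_zero] at hsum
    have := (Finset.sum_eq_zero_iff.1 ((Finset.sum_eq_zero_iff.1 hsum) i (Finset.mem_univ i)))
      j (Finset.mem_univ j)
    simpa using this
  · rw [hdeg, if_pos hd, if_pos (by omega), mul_one]
  · rw [hvar, if_pos i.isLt, show 2 * (k + r) - 2 * k = 2 * r by omega]
    linarith
end

section
/- For all integers g ≥ 3, m ≥ 1 and 0 ≤ k ≤ m, there exists a monomial multibasis c of W(k,m−k) that is balanced: the total occurrence count Σ_{(a,b)} c(a,b)·a(i) is the same for every i ∈ {0,…,2g−2}, and the total occurrence count Σ_{(a,b)} c(a,b)·b(j) is the same for every j ∈ {0,…,g−3}. (Proposition 5.7: existence of a balanced (k,m−k)-monomial multibasis of W(k,m−k) for the bicanonically embedded Wiman curve.) -/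
/-!
Proposition 5.7 for the bicanonically embedded Wiman curve `w² = z^(2g+1)+1` of genus
`g ≥ 3`: for `0 ≤ k ≤ m` there exists a balanced `(k, m−k)`-monomial multibasis of
`W(k, m−k)`.  A `(k, m−k)`-monomial is a pair consisting of a multiset of `k`
`x`-indices in `{0,…,2g−2}` and a multiset of `m−k` `y`-indices in `{0,…,g−3}`
(recording `Πxᵢ^{a(i)}·Πyⱼ^{b(j)}`, where `xᵢ = zⁱ` and `yⱼ = zʲw`); its `z`-degree
is the sum of all its indices.  A multibasis is a counting function `c` on
`(k, m−k)`-monomials such that each `z`-degree `d ∈ [0, (2g−2)k+(g−3)(m−k)]` is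
realized exactly `s > 0` times; it is balanced if each `x`-variable has the same
total occurrence count and each `y`-variable has the same total occurrence count.
-/

open scoped Classical

/-- `(k, r)`-monomials for the Wiman curve of genus `g`: a multiset of `k` `x`-indices
in `{0,…,2g−2}` together with a multiset of `r` `y`-indices in `{0,…,g−3}`. -/
abbrev WMon (g k r : ℕ) := Sym (Fin (2 * g - 1)) k × Sym (Fin (g - 2)) r

/-- The `z`-degree `Σ i·a(i) + Σ j·b(j)` of a Wiman monomial. -/
def zdeg {g k r : ℕ} (p : WMon g k r) : ℕ :=
  (p.1.1.map (fun i : Fin (2 * g - 1) => (i : ℕ))).sum +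
    (p.2.1.map (fun j : Fin (g - 2) => (j : ℕ))).sum

open scoped Nat

/-- The binomially weighted sum `∑ i ≤ n, C(n, i) * F i`. -/
def binomSum (n : ℕ) (F : ℕ → ℕ) : ℕ := ∑ i ∈ Finset.range (n + 1), n.choose i * F i

lemma binomSum_congr {n : ℕ} {F G : ℕ → ℕ} (h : ∀ i ≤ n, F i = G i) :
    binomSum n F = binomSum n G :=
  Finset.sum_congr rfl fun i hi => by rw [h i (by simpa [Nat.lt_succ_iff] using hi)]

lemma binomSum_mul_left (n c : ℕ) (F : ℕ → ℕ) :
    binomSum n (fun i => c * F i) = c * binomSum n F := by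
  simp only [binomSum, Finset.mul_sum]
  exact Finset.sum_congr rfl fun i _ => by ring

lemma binomSum_add (n : ℕ) (F G : ℕ → ℕ) :
    binomSum n (fun i => F i + G i) = binomSum n F + binomSum n G := by
  simp only [binomSum, mul_add, Finset.sum_add_distrib]

lemma binomSum_succ (n : ℕ) (F : ℕ → ℕ) :
    binomSum (n + 1) F = binomSum n (fun i => F i + F (i + 1)) := by
  rw [binomSum_add]
  unfold binomSum
  rw [Finset.sum_range_succ' _ (n + 1)]
  simp only [Nat.choose_succ_succ, add_mul, Finset.sum_add_distrib]
  rw [Finset.sum_range_succ (fun x => n.choose (x + 1) * F (x + 1)) n,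
    Finset.sum_range_succ' (fun x => n.choose x * F x) n]
  simp
  ring

lemma binomSum_add_index (n m : ℕ) (F : ℕ → ℕ) :
    binomSum (n + m) F = binomSum n (fun i => binomSum m (fun j => F (i + j))) := by
  induction n generalizing F with
  | zero => simp [binomSum]
  | succ n ih =>
    rw [add_right_comm, binomSum_succ, ih, binomSum_succ]
    refine binomSum_congr fun i _ => ?_
    rw [binomSum_add]
    simp only [add_right_comm]

lemma binomSum_ite_eq {n d : ℕ} (hd : d ≤ n) (F : ℕ → ℕ) :
    binomSum n (fun i => if i = d then F i else 0) = n.choose d * F d := by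
  simp [binomSum, hd]

/-- A discrete form of the Beta integral. -/
lemma exists_binomSum_factorial (A M : ℕ) :
    ∃ D, ∀ i ≤ A, binomSum M (fun e => (i + e)! * (A + M - (i + e))!) = D * (i ! * (A - i)!) := by
  induction M with
  | zero => exact ⟨1, fun i _ => by simp [binomSum]⟩
  | succ M ih =>
    obtain ⟨D, hD⟩ := ih
    refine ⟨(A + M + 2) * D, fun i hi => ?_⟩
    rw [mul_assoc, ← hD i hi, ← binomSum_mul_left, binomSum_succ]
    refine binomSum_congr fun e he => ?_
    obtain ⟨t, ht⟩ : ∃ t, A + M = i + e + t := ⟨A + M - (i + e), by omega⟩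
    rw [show A + (M + 1) - (i + e) = t + 1 by omega, show A + (M + 1) - (i + (e + 1)) = t by omega,
      show A + M - (i + e) = t by omega, ht, ← add_assoc, Nat.factorial_succ, Nat.factorial_succ]
    ring

lemma sum_fin_choose_mul {q n : ℕ} (h : q = n + 1) (F : ℕ → ℕ) :
    ∑ i : Fin q, n.choose i * F i = binomSum n F := by
  subst h
  exact Fin.sum_univ_eq_sum_range (fun i => n.choose i * F i) (n + 1)

/-- Multi-index Vandermonde identity. -/
lemma sum_prod_choose_mul {q n : ℕ} (h : q = n + 1) (k : ℕ) (F : ℕ → ℕ) :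
    ∑ a : Fin k → Fin q, (∏ l, n.choose (a l)) * F (∑ l, (a l : ℕ)) = binomSum (n * k) F := by
  induction k generalizing F with
  | zero => simp [binomSum]
  | succ k ih =>
    rw [← (Fin.insertNthEquiv (fun _ => Fin q) 0).sum_comp, Fintype.sum_prod_type, Nat.mul_succ,
      add_comm (n * k), binomSum_add_index, ← sum_fin_choose_mul h]
    refine Finset.sum_congr rfl fun i _ => ?_
    rw [← ih, Finset.mul_sum]
    refine Finset.sum_congr rfl fun a _ => ?_
    simp [Fin.prod_univ_succ, Fin.sum_univ_succ, mul_assoc]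

lemma sum_prod_choose_mul_of_apply_eq {q n : ℕ} (h : q = n + 1) (k : ℕ) (F : ℕ → ℕ)
    (l : Fin (k + 1)) (i : Fin q) :
    ∑ a : Fin (k + 1) → Fin q,
        (if a l = i then (∏ l, n.choose (a l)) * F (∑ l, (a l : ℕ)) else 0) =
      n.choose i * binomSum (n * k) (fun d => F (i + d)) := by
  rw [← (Fin.insertNthEquiv (fun _ => Fin q) l).sum_comp, Fintype.sum_prod_type,
    Finset.sum_eq_single i]
  · rw [← sum_prod_choose_mul h, Finset.mul_sum]
    refine Finset.sum_congr rfl fun a _ => ?_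
    simp [Fin.prod_univ_succAbove _ l, Fin.sum_univ_succAbove _ l, mul_assoc]
  · intro j _ hj
    simp [hj]
  · simp

/-- The weight of a pair of index tuples: `(N + 1)!` times the probability that independent
binomial variables with parameters `n` (`k` times) and `n'` (`k'` times) and a common uniformly
distributed success probability take the given values, where `N = n * k + n' * k'`. -/
def tupleWeight (n n' : ℕ) {q q' k k' : ℕ} (a : Fin k → Fin q) (b : Fin k' → Fin q') : ℕ :=
  (∏ l, n.choose (a l)) * ((∏ l, n'.choose (b l)) *
    ((∑ l, (a l : ℕ) + ∑ l, (b l : ℕ))! *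
      (n * k + n' * k' - (∑ l, (a l : ℕ) + ∑ l, (b l : ℕ)))!))

lemma tupleWeight_comm (n n' : ℕ) {q q' k k' : ℕ} (a : Fin k → Fin q) (b : Fin k' → Fin q') :
    tupleWeight n n' a b = tupleWeight n' n b a := by
  unfold tupleWeight
  rw [mul_left_comm, add_comm (∑ l, (a l : ℕ)), add_comm (n * k)]

lemma sum_tupleWeight_of_sum_eq {q q' n n' : ℕ} (h : q = n + 1) (h' : q' = n' + 1) (k k' : ℕ)
    {d : ℕ} (hd : d ≤ n * k + n' * k') :
    ∑ a : Fin k → Fin q, ∑ b : Fin k' → Fin q',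
        (if ∑ l, (a l : ℕ) + ∑ l, (b l : ℕ) = d then tupleWeight n n' a b else 0) =
      (n * k + n' * k')! := by
  set F : ℕ → ℕ := fun e => if e = d then e ! * (n * k + n' * k' - e)! else 0 with hF
  calc
    _ = ∑ a : Fin k → Fin q, (∏ l, n.choose (a l)) * ∑ b : Fin k' → Fin q',
          (∏ l, n'.choose (b l)) * F (∑ l, (a l : ℕ) + ∑ l, (b l : ℕ)) := by
      simp only [Finset.mul_sum]
      refine Finset.sum_congr rfl fun a _ => Finset.sum_congr rfl fun b _ => ?_
      simp only [hF, tupleWeight]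
      split_ifs <;> simp
    _ = _ := by
      have hb (s : ℕ) := sum_prod_choose_mul h' k' (fun e => F (s + e))
      simp only [hb]
      rw [sum_prod_choose_mul h k (fun s => binomSum (n' * k') fun e => F (s + e)),
        ← binomSum_add_index, hF, binomSum_ite_eq hd (fun e => e ! * (n * k + n' * k' - e)!),
        ← mul_assoc, Nat.choose_mul_factorial_mul_factorial hd]

lemma exists_sum_tupleWeight_of_apply_eq {q q' n n' : ℕ} (h : q = n + 1) (h' : q' = n' + 1)
    (k k' : ℕ) :
    ∃ t, ∀ (l : Fin k) (i : Fin q), ∑ a : Fin k → Fin q, ∑ b : Fin k' → Fin q',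
        (if a l = i then tupleWeight n n' a b else 0) = t := by
  cases k with
  | zero => exact ⟨0, fun l => l.elim0⟩
  | succ k =>
    obtain ⟨D, hD⟩ := exists_binomSum_factorial n (n * k + n' * k')
    refine ⟨D * n !, fun l i => ?_⟩
    have hi : (i : ℕ) ≤ n := by omega
    set F : ℕ → ℕ := fun e => e ! * (n * (k + 1) + n' * k' - e)! with hF
    calc
      _ = ∑ a : Fin (k + 1) → Fin q, (if a l = i then (∏ l, n.choose (a l)) *
            ∑ b : Fin k' → Fin q',
              (∏ l, n'.choose (b l)) * F (∑ l, (a l : ℕ) + ∑ l, (b l : ℕ)) else 0) := by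
        refine Finset.sum_congr rfl fun a _ => ?_
        split_ifs
        · simp only [Finset.mul_sum, tupleWeight, hF]
        · simp
      _ = _ := by
        have hb (s : ℕ) := sum_prod_choose_mul h' k' (fun e => F (s + e))
        simp only [hb]
        rw [sum_prod_choose_mul_of_apply_eq h k (fun s => binomSum (n' * k') fun e => F (s + e))]
        simp only [add_assoc]
        rw [← binomSum_add_index _ _ (fun e => F (i + e)), hF,
          show n * (k + 1) + n' * k' = n + (n * k + n' * k') by ring, hD i hi,
          ← Nat.choose_mul_factorial_mul_factorial hi]
        ring

/-- The multiset of values of a tuple. -/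
def symOfTuple {q k : ℕ} (a : Fin k → Fin q) : Sym (Fin q) k :=
  ⟨Finset.univ.val.map a, by simp⟩

lemma count_symOfTuple {q k : ℕ} (a : Fin k → Fin q) (i : Fin q) :
    Multiset.count i (symOfTuple a).1 = ∑ l, if a l = i then 1 else 0 := by
  simp only [symOfTuple, Multiset.count_map, Finset.sum_boole, Nat.cast_id, Finset.card_def,
    Finset.filter_val, eq_comm]

lemma zdeg_symOfTuple {g k r : ℕ} (a : Fin k → Fin (2 * g - 1)) (b : Fin r → Fin (g - 2)) :
    zdeg (symOfTuple a, symOfTuple b) = ∑ l, (a l : ℕ) + ∑ l, (b l : ℕ) := by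
  simp only [zdeg, symOfTuple, Multiset.map_map]
  rfl

lemma sum_mul_count_symOfTuple {q k : ℕ} {β : Type*} [Fintype β] (w : (Fin k → Fin q) → β → ℕ)
    {t : ℕ} (ht : ∀ (l : Fin k) (i : Fin q), ∑ a, ∑ b, (if a l = i then w a b else 0) = t)
    (i : Fin q) : ∑ a, ∑ b, w a b * Multiset.count i (symOfTuple a).1 = k * t := by
  calc
    _ = ∑ a, ∑ b, ∑ l, (if a l = i then w a b else 0) := by
      simp only [count_symOfTuple, Finset.mul_sum, mul_ite, mul_one, mul_zero]
    _ = ∑ l, ∑ a, ∑ b, (if a l = i then w a b else 0) := by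
      rw [Finset.sum_comm]
      simp only [Finset.sum_comm (s := (Finset.univ : Finset (Fin k)))]
      rw [Finset.sum_comm]
    _ = _ := by simp only [ht, Finset.sum_const, Finset.card_univ, Fintype.card_fin, smul_eq_mul]

/-- Proposition 5.7. -/
theorem wiman_balanced_multibasis (g m k : ℕ) (hg : 3 ≤ g) (hm : 1 ≤ m) (hk : k ≤ m) :
    ∃ (c : WMon g k (m - k) → ℕ) (s : ℕ), 0 < s ∧
      (∀ d : ℕ, d ≤ (2 * g - 2) * k + (g - 3) * (m - k) →
        (∑ p ∈ Finset.univ.filter (fun p : WMon g k (m - k) => zdeg p = d), c p) = s) ∧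
      (∃ t : ℕ, ∀ i : Fin (2 * g - 1),
        (∑ p : WMon g k (m - k), c p * Multiset.count i p.1.1) = t) ∧
      (∃ t' : ℕ, ∀ j : Fin (g - 2),
        (∑ p : WMon g k (m - k), c p * Multiset.count j p.2.1) = t') := by
  have hx : 2 * g - 1 = (2 * g - 2) + 1 := by omega
  have hy : g - 2 = (g - 3) + 1 := by omega
  set r := m - k
  let w (a : Fin k → Fin (2 * g - 1)) (b : Fin r → Fin (g - 2)) : ℕ :=
    tupleWeight (2 * g - 2) (g - 3) a b
  let c (p : WMon g k r) : ℕ := ∑ a, ∑ b, if (symOfTuple a, symOfTuple b) = p then w a b else 0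
  have hc (f : WMon g k r → ℕ) :
      ∑ p, c p * f p = ∑ a, ∑ b, w a b * f (symOfTuple a, symOfTuple b) := by
    simp only [c, Finset.sum_mul, ite_mul, zero_mul]
    rw [Finset.sum_comm]
    refine Finset.sum_congr rfl fun a _ => ?_
    rw [Finset.sum_comm]
    simp
  obtain ⟨t, ht⟩ := exists_sum_tupleWeight_of_apply_eq hx hy k r
  obtain ⟨t', ht'⟩ := exists_sum_tupleWeight_of_apply_eq hy hx r k
  refine ⟨c, ((2 * g - 2) * k + (g - 3) * r)!, Nat.factorial_pos _, fun d hd => ?_,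
    ⟨k * t, fun i => ?_⟩, ⟨r * t', fun j => ?_⟩⟩
  · have := hc (fun p => if zdeg p = d then 1 else 0)
    simp only [zdeg_symOfTuple, mul_ite, mul_one, mul_zero] at this
    rw [Finset.sum_filter, this]
    exact sum_tupleWeight_of_sum_eq hx hy k r hd
  · rw [hc (fun p => Multiset.count i p.1.1)]
    exact sum_mul_count_symOfTuple w ht i
  · rw [hc (fun p => Multiset.count j p.2.1), Finset.sum_comm]
    simp only [w, tupleWeight_comm (2 * g - 2)]
    exact sum_mul_count_symOfTuple (fun b a => tupleWeight (g - 3) (2 * g - 2) b a) ht' j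
end

section
/- For every m ≥ 3 and every choice of integer weights λ_0,…,λ_{2g−2} and ν_0,…,ν_{g−3}, not all zero, with Σ_i λ_i + Σ_j ν_j = 0, there exists a monomial basis of V_m of negative weight. (By the Kempf–Morrison criterion, this is the combinatorial content of Theorem 7.3 / Corollary 5.19: the m-th Hilbert point of the bicanonically embedded Wiman curve of genus g ≥ 3 is stable for every m ≥ 3.) -/
/-!
The combinatorial content of Theorem 7.3 / Corollary 5.19 (stability of the `m`-th
Hilbert point of the bicanonically embedded Wiman curve of genus `g ≥ 3` for `m ≥ 3`):
for every choice of integer weights `λ₀,…,λ_{2g−2}` and `ν₀,…,ν_{g−3}`, not all zero,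
with total sum `0`, there exists a monomial basis of `V_m` of negative weight.
We work in `R = ℂ[z,w]/(w² − z^(2g+1) − 1)` with `x_i = z^i` and `y_j = z^j·w`.
-/

noncomputable section

/-- The coordinate ring `R = ℂ[z,w]/(w² − z^(2g+1) − 1)` of the Wiman curve. -/
abbrev WRing (g : ℕ) : Type :=
  MvPolynomial (Fin 2) ℂ ⧸
    Ideal.span ({MvPolynomial.X 1 ^ 2 - MvPolynomial.X 0 ^ (2 * g + 1) - 1} :
      Set (MvPolynomial (Fin 2) ℂ))

/-- The image of `z` in `R`. -/
def zW (g : ℕ) : WRing g := Ideal.Quotient.mk _ (MvPolynomial.X 0)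

/-- The image of `w` in `R`. -/
def wW (g : ℕ) : WRing g := Ideal.Quotient.mk _ (MvPolynomial.X 1)

/-- Index type for the `3g−3` bicanonical variables `x₀,…,x_{2g−2}, y₀,…,y_{g−3}`. -/
abbrev WIdx (g : ℕ) : Type := Fin (2 * g - 1) ⊕ Fin (g - 2)

/-- The bicanonical variables: `x_i = z^i` and `y_j = z^j·w`. -/
def varW (g : ℕ) : WIdx g → WRing g :=
  Sum.elim (fun i => zW g ^ (i : ℕ)) (fun j => zW g ^ (j : ℕ) * wW g)

/-- `V_m`: the `ℂ`-span of all degree-`m` monomials in the variables `x_i, y_j`. -/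
def VW (g m : ℕ) : Submodule ℂ (WRing g) :=
  Submodule.span ℂ
    {r : WRing g | ∃ σ : Multiset (WIdx g), Multiset.card σ = m ∧ r = (σ.map (varW g)).prod}

/-- Degree-`m` monomials, as multisets of `m` variable indices. -/
abbrev WDegMon (g m : ℕ) := Sym (WIdx g) m

/-- A finite set of degree-`m` monomials is a monomial basis of `V_m` if its images in
`R` are linearly independent over `ℂ` and span `V_m`. -/
def IsMonBasisW (g m : ℕ) (S : Finset (WDegMon g m)) : Prop :=
  LinearIndependent ℂ (fun s : S => (((s : WDegMon g m)).1.map (varW g)).prod) ∧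
  Submodule.span ℂ ((fun s : WDegMon g m => (s.1.map (varW g)).prod) '' S) = VW g m


theorem wW_sq (g : ℕ) : wW g ^ 2 = zW g ^ (2 * g + 1) + 1 := by
  rw [← sub_eq_zero, ← sub_sub]
  exact Ideal.Quotient.eq_zero_iff_mem.2 (Ideal.subset_span rfl)

/-- Evaluation at the point `(a, b)` of the affine Wiman curve. -/
def evalW (g : ℕ) (a b : ℂ) (h : b ^ 2 = a ^ (2 * g + 1) + 1) : WRing g →ₐ[ℂ] ℂ :=
  Ideal.Quotient.liftₐ _ (MvPolynomial.aeval ![a, b]) fun x hx => by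
    have hle : Ideal.span {MvPolynomial.X 1 ^ 2 - MvPolynomial.X 0 ^ (2 * g + 1) - 1} ≤
        RingHom.ker (MvPolynomial.aeval ![a, b] : MvPolynomial (Fin 2) ℂ →ₐ[ℂ] ℂ) := by
      rw [Ideal.span_le, Set.singleton_subset_iff, SetLike.mem_coe, RingHom.mem_ker]
      simp [h]
    exact hle hx

theorem evalW_zW (g : ℕ) (a b : ℂ) (h : b ^ 2 = a ^ (2 * g + 1) + 1) :
    evalW g a b h (zW g) = a := by
  change MvPolynomial.aeval ![a, b] (MvPolynomial.X 0) = a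
  simp

theorem evalW_wW (g : ℕ) (a b : ℂ) (h : b ^ 2 = a ^ (2 * g + 1) + 1) :
    evalW g a b h (wW g) = b := by
  change MvPolynomial.aeval ![a, b] (MvPolynomial.X 1) = b
  simp

open Polynomial in
/-- `1, w` are linearly independent over `ℂ[z]`. -/
theorem eq_zero_of_aeval_add_aeval_mul_wW (g : ℕ) (P Q : ℂ[X])
    (h : aeval (zW g) P + aeval (zW g) Q * wW g = 0) : P = 0 ∧ Q = 0 := by
  have key : ∀ a b : ℂ, b ^ 2 = a ^ (2 * g + 1) + 1 → P.eval a + Q.eval a * b = 0 := by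
    intro a b hb
    have := congrArg (evalW g a b hb) h
    simpa [← Polynomial.aeval_algHom_apply, evalW_zW, evalW_wW] using this
  have hPQ : ∀ a, P.eval a = 0 ∧ Q.eval a ^ 2 * (a ^ (2 * g + 1) + 1) = 0 := by
    intro a
    obtain ⟨b, hb⟩ := IsAlgClosed.exists_pow_nat_eq (a ^ (2 * g + 1) + 1) two_pos
    have h1 := key a b hb
    have h2 := key a (-b) (by rw [neg_sq, hb])
    refine ⟨by linear_combination (h1 + h2) / 2, ?_⟩
    rw [← hb]
    linear_combination (Q.eval a * b / 2) * (h1 - h2)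
  refine ⟨Polynomial.funext fun a => by simpa using (hPQ a).1, ?_⟩
  have hz : Q ^ 2 * (X ^ (2 * g + 1) + C 1) = 0 :=
    Polynomial.funext fun a => by simpa using (hPQ a).2
  rcases mul_eq_zero.1 hz with h0 | h0
  · exact pow_eq_zero_iff two_ne_zero |>.1 h0
  · exact absurd h0 (Polynomial.X_pow_add_C_ne_zero (Nat.succ_pos _) 1)

/-- The monomials `z^k` for `k ≤ M` and `z^k w` for `k ≤ N`. -/
def normalMon (g M N : ℕ) : Fin (M + 1) ⊕ Fin (N + 1) → WRing g :=
  Sum.elim (fun k => zW g ^ (k : ℕ)) (fun k => zW g ^ (k : ℕ) * wW g)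

open Polynomial in
theorem linearIndependent_normalMon (g M N : ℕ) : LinearIndependent ℂ (normalMon g M N) := by
  rw [Fintype.linearIndependent_iff]
  intro c hc
  have h := eq_zero_of_aeval_add_aeval_mul_wW g
    (∑ k : Fin (M + 1), monomial (k : ℕ) (c (Sum.inl k)))
    (∑ k : Fin (N + 1), monomial (k : ℕ) (c (Sum.inr k))) (by
      rw [← hc, Fintype.sum_sum_type, map_sum, map_sum, Finset.sum_mul]
      simp only [aeval_monomial, mul_assoc]
      congr 1 <;> exact Finset.sum_congr rfl fun _ _ => (Algebra.smul_def _ _).symm)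
  have coeff_eq : ∀ {n : ℕ} (f : Fin n → ℂ) (i : Fin n),
      (∑ k : Fin n, monomial (k : ℕ) (f k)).coeff i = f i := by
    intro n f i
    rw [finsetSum_coeff, Finset.sum_eq_single i]
    · simp
    · intro b _ hb
      rw [coeff_monomial, if_neg (fun h => hb (Fin.ext h))]
    · simp
  rintro (i | i)
  · rw [← coeff_eq (fun k => c (Sum.inl k)) i, h.1, coeff_zero]
  · rw [← coeff_eq (fun k => c (Sum.inr k)) i, h.2, coeff_zero]

/-- There are `n` variables whose product is `z^k w^q` and whose total weight is `c`. -/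
def HasMon (g : ℕ) (wt : WIdx g → ℤ) (n k q : ℕ) (c : ℤ) : Prop :=
  ∃ σ : Multiset (WIdx g), Multiset.card σ = n ∧ (σ.map (varW g)).prod = zW g ^ k * wW g ^ q ∧
    (σ.map wt).sum = c

theorem HasMon.zero (g : ℕ) (wt : WIdx g → ℤ) : HasMon g wt 0 0 0 0 := ⟨0, by simp⟩

theorem HasMon.add {g : ℕ} {wt : WIdx g → ℤ} {n k q n' k' q' : ℕ} {c c' : ℤ}
    (h : HasMon g wt n k q c) (h' : HasMon g wt n' k' q' c') :
    HasMon g wt (n + n') (k + k') (q + q') (c + c') := by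
  obtain ⟨σ, h1, h2, h3⟩ := h
  obtain ⟨τ, h1', h2', h3'⟩ := h'
  refine ⟨σ + τ, by simp [h1, h1'], ?_, by simp [h3, h3']⟩
  rw [Multiset.map_add, Multiset.prod_add, h2, h2']
  ring

theorem HasMon.nsmul {g : ℕ} {wt : WIdx g → ℤ} {n k q : ℕ} {c : ℤ}
    (h : HasMon g wt n k q c) (p : ℕ) : HasMon g wt (p * n) (p * k) (p * q) (p * c) := by
  induction p with
  | zero => simpa using HasMon.zero g wt
  | succ p ih => simpa only [Nat.succ_mul, Nat.cast_succ, add_mul, one_mul] using ih.add h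

/-- Every monomial in `p` variables `x_i` and `q` variables `y_j` is some `z^k w^q` with
`k ≤ p(2g-2) + q(g-3)`. -/
theorem exists_prod_varW_eq (d : ℕ) (σ : Multiset (WIdx (d + 3))) :
    ∃ p q k : ℕ, p + q = Multiset.card σ ∧ k ≤ p * (2 * d + 4) + q * d ∧
      (σ.map (varW (d + 3))).prod = zW (d + 3) ^ k * wW (d + 3) ^ q := by
  induction σ using Multiset.induction with
  | empty => exact ⟨0, 0, 0, by simp⟩
  | cons a σ ih =>
    obtain ⟨p, q, k, h1, h2, h3⟩ := ih
    rcases a with ⟨i, hi⟩ | ⟨j, hj⟩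
    · refine ⟨p + 1, q, k + i, ?_, ?_, ?_⟩
      · rw [Multiset.card_cons]
        omega
      · rw [add_mul]
        omega
      · rw [Multiset.map_cons, Multiset.prod_cons, h3]
        simp only [varW, Sum.elim_inl]
        ring
    · refine ⟨p, q + 1, k + j, ?_, ?_, ?_⟩
      · rw [Multiset.card_cons]
        omega
      · rw [add_mul]
        omega
      · rw [Multiset.map_cons, Multiset.prod_cons, h3]
        simp only [varW, Sum.elim_inr]
        ring

theorem pow_mul_pow_add_two (g k q : ℕ) :
    zW g ^ k * wW g ^ (q + 2) = zW g ^ k * wW g ^ q + zW g ^ (k + (2 * g + 1)) * wW g ^ q := by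
  rw [pow_add (wW g), wW_sq]
  ring

theorem pow_mul_pow_mem_of_normalMon_mem (d m : ℕ) (U : Submodule ℂ (WRing (d + 3)))
    (h0 : ∀ k ≤ m * (2 * d + 4), zW (d + 3) ^ k ∈ U)
    (h1 : ∀ k ≤ (m - 1) * (2 * d + 4) + d, zW (d + 3) ^ k * wW (d + 3) ∈ U) :
    ∀ p q k : ℕ, p + q = m → k ≤ p * (2 * d + 4) + q * d →
      zW (d + 3) ^ k * wW (d + 3) ^ q ∈ U := by
  intro p q
  induction q using Nat.twoStepInduction generalizing p with
  | zero =>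
    intro k hm hk
    subst hm
    simpa using h0 k (by simpa using hk)
  | one =>
    intro k hm hk
    subst hm
    simpa using h1 k (by simpa using hk)
  | more q ih _ =>
    intro k hm hk
    rw [pow_mul_pow_add_two]
    have e : (p + 2) * (2 * d + 4) + q * d = p * (2 * d + 4) + (q + 2) * d + (2 * d + 8) := by ring
    exact U.add_mem (ih (p + 2) k (by omega) (by omega))
      (ih (p + 2) (k + (2 * (d + 3) + 1)) (by omega) (by omega))

/-- A family of degree-`m` monomials of the right cardinality whose span contains all normal
monomials is a monomial basis. -/
theorem exists_isMonBasisW_of_family (d m : ℕ) (wt : WIdx (d + 3) → ℤ) {ι : Type} [Fintype ι]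
    (k q : ι → ℕ) (c : ι → ℤ) (hmon : ∀ i, HasMon (d + 3) wt m (k i) (q i) (c i))
    (hcard : Fintype.card ι = m * (2 * d + 4) + 1 + ((m - 1) * (2 * d + 4) + d + 1))
    (hspan : ∀ U : Submodule ℂ (WRing (d + 3)),
      (∀ i, zW (d + 3) ^ k i * wW (d + 3) ^ q i ∈ U) →
        (∀ k ≤ m * (2 * d + 4), zW (d + 3) ^ k ∈ U) ∧
        (∀ k ≤ (m - 1) * (2 * d + 4) + d, zW (d + 3) ^ k * wW (d + 3) ∈ U))
    (hc : ∑ i, c i < 0) :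
    ∃ S : Finset (WDegMon (d + 3) m), IsMonBasisW (d + 3) m S ∧
      (∑ σ ∈ S, (σ.1.map wt).sum) < 0 := by
  classical
  choose σ hσ1 hσ2 hσ3 using hmon
  set b : ι → WRing (d + 3) := fun i => ((σ i).map (varW (d + 3))).prod with hb
  set e := normalMon (d + 3) (m * (2 * d + 4)) ((m - 1) * (2 * d + 4) + d) with he
  have hU := hspan (Submodule.span ℂ (Set.range b)) fun i => by
    rw [← hσ2 i]
    exact Submodule.subset_span ⟨i, rfl⟩
  have hbV : Submodule.span ℂ (Set.range b) ≤ VW (d + 3) m := by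
    rw [Submodule.span_le]
    rintro _ ⟨i, rfl⟩
    exact Submodule.subset_span ⟨σ i, hσ1 i, rfl⟩
  have heb : Submodule.span ℂ (Set.range e) ≤ Submodule.span ℂ (Set.range b) := by
    rw [Submodule.span_le]
    rintro _ ⟨i | i, rfl⟩
    · exact hU.1 i (Nat.lt_succ_iff.1 i.2)
    · exact hU.2 i (Nat.lt_succ_iff.1 i.2)
  have hVe : VW (d + 3) m ≤ Submodule.span ℂ (Set.range e) := by
    rw [VW, Submodule.span_le]
    rintro _ ⟨τ, hτ, rfl⟩
    obtain ⟨p, q, k, h1, h2, h3⟩ := exists_prod_varW_eq d τ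
    rw [h3]
    refine pow_mul_pow_mem_of_normalMon_mem d m _ (fun k hk => ?_) (fun k hk => ?_) p q k
      (h1.trans hτ) h2
    · exact Submodule.subset_span ⟨Sum.inl ⟨k, Nat.lt_succ_iff.2 hk⟩, rfl⟩
    · exact Submodule.subset_span ⟨Sum.inr ⟨k, Nat.lt_succ_iff.2 hk⟩, rfl⟩
  have hbe : Submodule.span ℂ (Set.range b) = Submodule.span ℂ (Set.range e) :=
    le_antisymm (hbV.trans hVe) heb
  have hli : LinearIndependent ℂ b := by
    rw [linearIndependent_iff_card_eq_finrank_span, Set.finrank, hbe,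
      finrank_span_eq_card (linearIndependent_normalMon _ _ _), hcard]
    simp
  set s : ι → WDegMon (d + 3) m := fun i => ⟨σ i, hσ1 i⟩ with hs
  have hinj : Function.Injective s := fun i j hij =>
    hli.injective (congrArg (fun t : WDegMon (d + 3) m => (t.1.map (varW (d + 3))).prod) hij)
  refine ⟨Finset.univ.image s, ⟨?_, ?_⟩, ?_⟩
  · have hr : LinearIndepOn ℂ (fun t : WDegMon (d + 3) m => (t.1.map (varW (d + 3))).prod)
        (Set.range s) := (linearIndepOn_range_iff hinj _).2 hli
    have hset : ((Finset.univ.image s : Finset _) : Set (WDegMon (d + 3) m)) = Set.range s := by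
      simp
    rw [← hset] at hr
    exact hr
  · rw [Finset.coe_image, Finset.coe_univ, Set.image_univ, ← Set.range_comp]
    exact le_antisymm hbV (hVe.trans heb)
  · rw [Finset.sum_image fun i _ j _ h => hinj h]
    simpa only [hs, hσ3] using hc

open Finset

theorem sum_choose_mul_choose (a c B : ℕ) :
    ∑ b ∈ range (B + 1), (a + b).choose a * (c + (B - b)).choose c
      = (a + c + B + 1).choose (a + c + 1) := by
  induction c generalizing B with
  | zero =>
    induction B with
    | zero => simp
    | succ B ih =>
      rw [sum_range_succ]
      simp only [Nat.choose_zero_right, mul_one, add_zero] at ih ⊢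
      rw [ih, Nat.choose_succ_succ (a + (B + 1)) a, add_comm, add_assoc a B 1]
  | succ c ihc =>
    induction B with
    | zero => simp
    | succ B ih =>
      have key : ∀ b ∈ range (B + 1), (a + b).choose a * (c + 1 + (B + 1 - b)).choose (c + 1)
          = (a + b).choose a * (c + (B + 1 - b)).choose c
            + (a + b).choose a * (c + 1 + (B - b)).choose (c + 1) := by
        intro b hb
        rw [mem_range] at hb
        rw [show c + 1 + (B + 1 - b) = (c + (B + 1 - b)) + 1 by ring, Nat.choose_succ_succ,
          show c + 1 + (B - b) = c + (B + 1 - b) by omega]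
        ring
      have h := ihc (B + 1)
      rw [sum_range_succ] at h ⊢
      rw [sum_congr rfl key, sum_add_distrib, ih]
      simp only [Nat.sub_self, add_zero, Nat.choose_self, mul_one] at h ⊢
      rw [show a + (c + 1) + (B + 1) + 1 = (a + c + (B + 1) + 1) + 1 by ring,
        show a + (c + 1) + 1 = (a + c + 1) + 1 by ring,
        Nat.choose_succ_succ (a + c + (B + 1) + 1) (a + c + 1), ← h,
        show a + (c + 1) + B + 1 = a + c + (B + 1) + 1 by ring]
      ring

theorem sum_fiber_choose_mul_choose (A B k : ℕ) (hk : k ≤ A + B) :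
    ∑ x ∈ range (A + 1) ×ˢ range (B + 1) with x.1 + x.2 = k,
      (x.1 + x.2).choose x.1 * (A - x.1 + (B - x.2)).choose (A - x.1) = (A + B).choose A := by
  conv_rhs => rw [show A + B = k + (A + B - k) by omega, Nat.add_choose_eq,
    Finset.Nat.sum_antidiagonal_eq_sum_range_succ_mk]
  rw [← sum_subset (s₁ := (range A.succ).filter fun a => a ≤ k ∧ k ≤ a + B) (filter_subset _ _)]
  · symm
    refine sum_bij (fun a _ => (a, k - a)) ?_ ?_ ?_ ?_
    · intro a ha
      simp only [mem_filter, mem_range, mem_product] at ha ⊢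
      omega
    · intro a _ b _ h
      exact congrArg Prod.fst h
    · rintro ⟨a, b⟩ h
      simp only [mem_filter, mem_range, mem_product] at h
      refine ⟨a, ?_, ?_⟩
      · simp only [mem_filter, mem_range]
        omega
      · simp only [Prod.mk.injEq, true_and]
        omega
    · intro a ha
      simp only [mem_filter, mem_range] at ha
      simp only
      rw [show a + (k - a) = k by omega, show A - a + (B - (k - a)) = A + B - k by omega]
  · intro a ha hn
    simp only [mem_filter, mem_range, not_and, not_le] at ha hn
    by_cases h : a ≤ k
    · rw [Nat.choose_eq_zero_of_lt (show A + B - k < A - a by have := hn ha h; omega), mul_zero]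
    · rw [Nat.choose_eq_zero_of_lt (show k < a by omega), zero_mul]

/-- Two sequences on `[0, A]` and `[0, B]` with averages at most `a` and `b` admit a choice of
one pair on every antidiagonal whose total average is at most `a + b`. The bound is obtained by
averaging over all monotone lattice paths from `(0, 0)` to `(A, B)`. -/
theorem exists_antidiagonal_choice (A B : ℕ) (F G : ℕ → ℚ) (a b : ℚ)
    (hF : ∑ i ∈ range (A + 1), F i ≤ (A + 1) * a) (hG : ∑ j ∈ range (B + 1), G j ≤ (B + 1) * b) :
    ∃ s : ℕ → ℕ × ℕ, (∀ k ≤ A + B, (s k).1 ≤ A ∧ (s k).2 ≤ B ∧ (s k).1 + (s k).2 = k) ∧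
      ∑ k ∈ range (A + B + 1), (F (s k).1 + G (s k).2) ≤ ((A + B : ℕ) + 1) * (a + b) := by
  set u : ℕ × ℕ → ℚ := fun x =>
    ((x.1 + x.2).choose x.1 * (A - x.1 + (B - x.2)).choose (A - x.1) : ℕ) with hu
  set rect := range (A + 1) ×ˢ range (B + 1) with hrect
  have hC : (0 : ℚ) < ((A + B).choose A : ℕ) := by
    exact_mod_cast Nat.choose_pos (Nat.le_add_right A B)
  have fiber : ∀ k ≤ A + B, ∑ x ∈ rect with x.1 + x.2 = k, u x = ((A + B).choose A : ℕ) := by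
    intro k hk
    rw [← sum_fiber_choose_mul_choose A B k hk, Nat.cast_sum]
  have choice : ∀ k, ∃ x : ℕ × ℕ, k ≤ A + B → (x.1 ≤ A ∧ x.2 ≤ B ∧ x.1 + x.2 = k) ∧
      ((A + B).choose A : ℕ) * (F x.1 + G x.2)
        ≤ ∑ y ∈ rect with y.1 + y.2 = k, u y * (F y.1 + G y.2) := by
    intro k
    by_cases hk : k ≤ A + B
    swap
    · exact ⟨0, fun h => absurd h hk⟩
    have hne : (rect.filter fun x => x.1 + x.2 = k).Nonempty := by
      refine ⟨(min k A, k - min k A), ?_⟩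
      simp only [hrect, mem_filter, mem_product, mem_range]
      omega
    obtain ⟨x, hx, hmin⟩ := exists_min_image _ (fun x : ℕ × ℕ => F x.1 + G x.2) hne
    refine ⟨x, fun _ => ⟨?_, ?_⟩⟩
    · simp only [hrect, mem_filter, mem_product, mem_range] at hx
      omega
    · rw [← fiber k hk, sum_mul]
      exact sum_le_sum fun y hy => mul_le_mul_of_nonneg_left (hmin y hy) (Nat.cast_nonneg _)
  choose s hs using choice
  refine ⟨s, fun k hk => (hs k hk).1, ?_⟩
  have col : ∀ i ≤ A, ∑ j ∈ range (B + 1), u (i, j) = ((A + B + 1).choose (A + 1) : ℕ) := by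
    intro i hi
    rw [hu, ← Nat.cast_sum]
    simp only
    rw [sum_choose_mul_choose i (A - i) B, show i + (A - i) = A by omega]
  have row : ∀ j ≤ B, ∑ i ∈ range (A + 1), u (i, j) = ((A + B + 1).choose (B + 1) : ℕ) := by
    intro j hj
    rw [show A + B + 1 = j + (B - j) + A + 1 by omega, show B + 1 = j + (B - j) + 1 by omega,
      ← sum_choose_mul_choose j (B - j) A, Nat.cast_sum]
    refine sum_congr rfl fun i hi => ?_
    simp only [hu]
    rw [add_comm i j, ← Nat.choose_symm_add (a := j), add_comm (A - i),
      ← Nat.choose_symm_add (a := B - j)]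
  have total : ∑ x ∈ rect, u x * (F x.1 + G x.2)
      = ((A + B + 1).choose (A + 1) : ℕ) * ∑ i ∈ range (A + 1), F i
        + ((A + B + 1).choose (B + 1) : ℕ) * ∑ j ∈ range (B + 1), G j := by
    simp only [mul_add, sum_add_distrib]
    congr 1
    · rw [hrect, sum_product, mul_sum]
      refine sum_congr rfl fun i hi => ?_
      rw [← col i (by rw [mem_range] at hi; omega), sum_mul]
    · rw [hrect, sum_product_right, mul_sum]
      refine sum_congr rfl fun j hj => ?_
      rw [← row j (by rw [mem_range] at hj; omega), sum_mul]
  have eA : (((A + B + 1).choose (A + 1) : ℕ) : ℚ) * (A + 1)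
      = ((A + B : ℕ) + 1) * ((A + B).choose A : ℕ) := by
    exact_mod_cast (Nat.add_one_mul_choose_eq (A + B) A).symm
  have eB : (((A + B + 1).choose (B + 1) : ℕ) : ℚ) * (B + 1)
      = ((A + B : ℕ) + 1) * ((A + B).choose A : ℕ) := by
    rw [Nat.choose_symm_add]
    exact_mod_cast (Nat.add_one_mul_choose_eq (A + B) B).symm
  refine le_of_mul_le_mul_left ?_ hC
  calc ((A + B).choose A : ℕ) * ∑ k ∈ range (A + B + 1), (F (s k).1 + G (s k).2)
      ≤ ∑ k ∈ range (A + B + 1), ∑ y ∈ rect with y.1 + y.2 = k, u y * (F y.1 + G y.2) := by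
        rw [mul_sum]
        exact sum_le_sum fun k hk => (hs k (by rw [mem_range] at hk; omega)).2
    _ = ∑ x ∈ rect, u x * (F x.1 + G x.2) := by
        refine sum_fiberwise_of_maps_to (fun x hx => ?_) _
        simp only [hrect, mem_product, mem_range] at hx ⊢
        omega
    _ ≤ ((A + B + 1).choose (A + 1) : ℕ) * ((A + 1) * a)
        + ((A + B + 1).choose (B + 1) : ℕ) * ((B + 1) * b) := by
        rw [total]
        gcongr
    _ = ((A + B).choose A : ℕ) * (((A + B : ℕ) + 1) * (a + b)) := by
        rw [← mul_assoc, ← mul_assoc, eA, eB]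
        ring

/-- For every `k ≤ N` there is a product of `n` variables equal to `z^k w^q`, and these can be
chosen with average weight at most `a`. -/
def HasFullRange (g : ℕ) (wt : WIdx g → ℤ) (n q N : ℕ) (a : ℚ) : Prop :=
  ∃ c : ℕ → ℤ, (∀ k ≤ N, HasMon g wt n k q (c k)) ∧
    ∑ k ∈ range (N + 1), (c k : ℚ) ≤ (N + 1) * a

theorem HasFullRange.add {g : ℕ} {wt : WIdx g → ℤ} {n q N n' q' N' : ℕ} {a a' : ℚ}
    (h : HasFullRange g wt n q N a) (h' : HasFullRange g wt n' q' N' a') :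
    HasFullRange g wt (n + n') (q + q') (N + N') (a + a') := by
  obtain ⟨c, h1, h2⟩ := h
  obtain ⟨c', h1', h2'⟩ := h'
  obtain ⟨s, hs, hsum⟩ := exists_antidiagonal_choice N N' (fun k => c k) (fun k => c' k) a a' h2 h2'
  refine ⟨fun k => c (s k).1 + c' (s k).2, fun k hk => ?_, by exact_mod_cast hsum⟩
  obtain ⟨e1, e2, e3⟩ := hs k hk
  have := (h1 _ e1).add (h1' _ e2)
  rwa [e3] at this

theorem HasFullRange.zero (g : ℕ) (wt : WIdx g → ℤ) : HasFullRange g wt 0 0 0 0 :=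
  ⟨fun _ => 0, fun k hk => by rw [Nat.le_zero.1 hk]; exact HasMon.zero g wt, by simp⟩

theorem HasFullRange.nsmul {g : ℕ} {wt : WIdx g → ℤ} {n q N : ℕ} {a : ℚ}
    (h : HasFullRange g wt n q N a) (p : ℕ) :
    HasFullRange g wt (p * n) (p * q) (p * N) (p * a) := by
  induction p with
  | zero => simpa using HasFullRange.zero g wt
  | succ p ih => simpa only [Nat.succ_mul, Nat.cast_succ, add_mul, one_mul] using ih.add h

theorem hasFullRange_of_vars {d : ℕ} {wt : WIdx (d + 3) → ℤ} {l v : ℕ → ℤ}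
    (hx : ∀ i ≤ 2 * d + 4, HasMon (d + 3) wt 1 i 0 (l i))
    (hy : ∀ j ≤ d, HasMon (d + 3) wt 1 j 1 (v j)) {a b : ℚ}
    (ha : ∑ i ∈ range (2 * d + 5), (l i : ℚ) = (2 * d + 5) * a)
    (hb : ∑ j ∈ range (d + 1), (v j : ℚ) = (d + 1) * b) (p q : ℕ) :
    HasFullRange (d + 3) wt (p + q) q (p * (2 * d + 4) + q * d) (p * a + q * b) := by
  have h1 : HasFullRange (d + 3) wt 1 0 (2 * d + 4) a := by
    refine ⟨l, hx, ha.le.trans (le_of_eq ?_)⟩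
    push_cast
    ring
  have h2 : HasFullRange (d + 3) wt 1 1 d b := ⟨v, hy, hb.le⟩
  simpa using (h1.nsmul p).add (h2.nsmul q)

/-- A monomial basis made of one monomial for every `z^k` and every `z^k w`, using at most
one `y`-variable each. -/
theorem exists_isMonBasisW_of_normal (d m : ℕ) (wt : WIdx (d + 3) → ℤ) (c₀ c₁ : ℕ → ℤ)
    (h0 : ∀ k ≤ m * (2 * d + 4), HasMon (d + 3) wt m k 0 (c₀ k))
    (h1 : ∀ k ≤ (m - 1) * (2 * d + 4) + d, HasMon (d + 3) wt m k 1 (c₁ k))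
    (hc : ∑ k ∈ range (m * (2 * d + 4) + 1), c₀ k
      + ∑ k ∈ range ((m - 1) * (2 * d + 4) + d + 1), c₁ k < 0) :
    ∃ S : Finset (WDegMon (d + 3) m), IsMonBasisW (d + 3) m S ∧
      (∑ σ ∈ S, (σ.1.map wt).sum) < 0 := by
  refine exists_isMonBasisW_of_family d m wt
    (ι := Fin (m * (2 * d + 4) + 1) ⊕ Fin ((m - 1) * (2 * d + 4) + d + 1))
    (Sum.elim (fun k => (k : ℕ)) (fun k => (k : ℕ))) (Sum.elim (fun _ => 0) (fun _ => 1))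
    (Sum.elim (fun k => c₀ k) (fun k => c₁ k)) ?_ (by simp) ?_ ?_
  · rintro (k | k)
    · exact h0 k (Nat.lt_succ_iff.1 k.2)
    · exact h1 k (Nat.lt_succ_iff.1 k.2)
  · intro U hU
    refine ⟨fun k hk => ?_, fun k hk => ?_⟩
    · simpa using hU (Sum.inl ⟨k, Nat.lt_succ_iff.2 hk⟩)
    · simpa using hU (Sum.inr ⟨k, Nat.lt_succ_iff.2 hk⟩)
  · rw [Fintype.sum_sum_type]
    simp only [Sum.elim_inl, Sum.elim_inr]
    rwa [Fin.sum_univ_eq_sum_range, Fin.sum_univ_eq_sum_range]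

/-- Pairs of indices in `[0, 2d+3]` whose sums represent all residues modulo `2d+7`. -/
def residuePair (d r : ℕ) : ℕ × ℕ :=
  if r < 2 * d + 4 then (r, r)
  else if r = 2 * d + 4 then (0, 2 * d + 1)
  else if r = 2 * d + 5 then (1, 2 * d + 2)
  else (2, 2 * d + 3)

theorem residuePair_lt (d r : ℕ) :
    (residuePair d r).1 < 2 * d + 4 ∧ (residuePair d r).2 < 2 * d + 4 := by
  unfold residuePair
  split_ifs <;> constructor <;> simp only <;> omega

theorem exists_residuePair_modEq (d a : ℕ) :
    ∃ r < 2 * d + 7, (residuePair d r).1 + (residuePair d r).2 ≡ a [MOD 2 * d + 7] := by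
  have ht : a % (2 * d + 7) < 2 * d + 7 := Nat.mod_lt _ (by omega)
  suffices ∃ r < 2 * d + 7, (residuePair d r).1 + (residuePair d r).2 = a % (2 * d + 7) ∨
      (residuePair d r).1 + (residuePair d r).2 = a % (2 * d + 7) + (2 * d + 7) by
    obtain ⟨r, hr, h | h⟩ := this
    · exact ⟨r, hr, h ▸ Nat.mod_modEq _ _⟩
    · refine ⟨r, hr, ?_⟩
      rw [h, Nat.ModEq, Nat.add_mod_right, Nat.mod_mod]
  generalize a % (2 * d + 7) = t at ht
  rcases Nat.even_or_odd' t with ⟨i, rfl | rfl⟩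
  · refine ⟨i, by omega, Or.inl ?_⟩
    rw [residuePair, if_pos (by omega)]
    simp only
    omega
  · by_cases hi : i < d
    · refine ⟨i + d + 4, by omega, Or.inr ?_⟩
      rw [residuePair, if_pos (by omega)]
      simp only
      omega
    · refine ⟨i + d + 4, by omega, Or.inl ?_⟩
      rw [residuePair, if_neg (by omega)]
      split_ifs <;> simp only <;> omega

theorem sum_residuePair (d : ℕ) (x : ℕ → ℚ) :
    ∑ r ∈ range (2 * d + 7), (x (residuePair d r).1 + x (residuePair d r).2)
      = 2 * ∑ i ∈ range (2 * d + 4), x i + (x 0 + x 1 + x 2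
        + x (2 * d + 1) + x (2 * d + 2) + x (2 * d + 3)) := by
  rw [sum_range_succ, sum_range_succ, sum_range_succ,
    sum_congr rfl (g := fun i => 2 * x i) fun i hi => by
      rw [residuePair, if_pos (mem_range.1 hi)]
      ring, ← mul_sum]
  simp [residuePair]
  ring

theorem sum_residuePair_le (d : ℕ) (x : ℕ → ℚ) (hx : ∀ i < 2 * d + 4, 0 ≤ x i) :
    (2 * d + 5) * ∑ r ∈ range (2 * d + 7), (x (residuePair d r).1 + x (residuePair d r).2)
      ≤ (6 * d + 20) * ∑ i ∈ range (2 * d + 4), x i := by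
  rw [sum_residuePair]
  rcases Nat.eq_zero_or_pos d with rfl | hd
  · have h0 := hx 0 (by norm_num)
    have h3 := hx 3 (by norm_num)
    simp only [sum_range_succ, range_zero, sum_empty, mul_zero, zero_add, Nat.cast_zero]
    linarith
  · have hsub : ({0, 1, 2, 2 * d + 1, 2 * d + 2, 2 * d + 3} : Finset ℕ) ⊆ range (2 * d + 4) := by
      intro i hi
      simp only [mem_insert, mem_singleton] at hi
      rw [mem_range]
      omega
    have h := sum_le_sum_of_subset_of_nonneg hsub (f := x) fun i hi _ => hx i (mem_range.1 hi)
    rw [sum_insert, sum_insert, sum_insert, sum_insert, sum_insert, sum_singleton] at h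
    · have hT : 0 ≤ ∑ i ∈ range (2 * d + 4), x i := sum_nonneg fun i hi => hx i (mem_range.1 hi)
      have hd' : (0 : ℚ) ≤ 2 * d + 5 := by positivity
      have := mul_le_mul_of_nonneg_left h hd'
      nlinarith
    all_goals simp only [mem_insert, mem_singleton]; omega

/-- Exponents of `z` in the level of a `y`-rich basis: `x_{2d+4}^{p+2} y_d^q` and
representatives of all residues modulo `2d+7`. -/
def levelExp (d i₀ j₀ p q : ℕ) : Option (Fin (2 * d + 7)) → ℕ
  | none => (p + 2) * (2 * d + 4) + q * d
  | some r => (residuePair d r).1 + (residuePair d r).2 + p * i₀ + q * j₀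

/-- Weights of the monomials described by `levelExp`. -/
def levelCost (d : ℕ) (l v : ℕ → ℤ) (i₀ j₀ p q : ℕ) : Option (Fin (2 * d + 7)) → ℤ
  | none => (p + 2) * l (2 * d + 4) + q * v d
  | some r => l (residuePair d r).1 + l (residuePair d r).2 + p * l i₀ + q * v j₀

theorem hasMon_level {d : ℕ} {wt : WIdx (d + 3) → ℤ} {l v : ℕ → ℤ}
    (hx : ∀ i ≤ 2 * d + 4, HasMon (d + 3) wt 1 i 0 (l i))
    (hy : ∀ j ≤ d, HasMon (d + 3) wt 1 j 1 (v j)) {i₀ j₀ : ℕ} (hi₀ : i₀ ≤ 2 * d + 4)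
    (hj₀ : j₀ ≤ d) (p q : ℕ) (o : Option (Fin (2 * d + 7))) :
    HasMon (d + 3) wt (p + 2 + q) (levelExp d i₀ j₀ p q o) q (levelCost d l v i₀ j₀ p q o) := by
  rcases o with _ | r
  · simpa [levelExp, levelCost] using
      ((hx _ le_rfl).nsmul (p + 2)).add ((hy _ le_rfl).nsmul q)
  · have h := residuePair_lt d r
    have := (((hx _ h.1.le).add (hx _ h.2.le)).add ((hx _ hi₀).nsmul p)).add ((hy _ hj₀).nsmul q)
    rw [show p + 2 + q = 1 + 1 + p * 1 + q * 1 by ring]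
    simpa [levelExp, levelCost] using this

theorem mem_of_level {d : ℕ} (U : Submodule ℂ (WRing (d + 3))) {i₀ j₀ p q : ℕ}
    (hi₀ : i₀ ≤ 2 * d + 4) (hj₀ : j₀ ≤ d)
    (hU : ∀ o, zW (d + 3) ^ levelExp d i₀ j₀ p q o * wW (d + 3) ^ q ∈ U)
    (hw : ∀ k ≤ p * (2 * d + 4) + (q + 2) * d, zW (d + 3) ^ k * wW (d + 3) ^ (q + 2) ∈ U) :
    ∀ k ≤ (p + 2) * (2 * d + 4) + q * d, zW (d + 3) ^ k * wW (d + 3) ^ q ∈ U := by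
  set N := (p + 2) * (2 * d + 4) + q * d with hN
  have eN : N = p * (2 * d + 4) + (q + 2) * d + (2 * d + 8) := by rw [hN]; ring
  have step : ∀ k, k + (2 * d + 7) < N → (zW (d + 3) ^ k * wW (d + 3) ^ q ∈ U ↔
      zW (d + 3) ^ (k + (2 * d + 7)) * wW (d + 3) ^ q ∈ U) := by
    intro k hk
    have h := hw k (by omega)
    rw [pow_mul_pow_add_two, show k + (2 * (d + 3) + 1) = k + (2 * d + 7) by ring] at h
    exact ⟨fun h' => (U.add_mem_iff_right h').1 h, fun h' => (U.add_mem_iff_left h').1 h⟩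
  have steps : ∀ s k, k + s * (2 * d + 7) < N → (zW (d + 3) ^ k * wW (d + 3) ^ q ∈ U ↔
      zW (d + 3) ^ (k + s * (2 * d + 7)) * wW (d + 3) ^ q ∈ U) := by
    intro s
    induction s with
    | zero => simp
    | succ s ih =>
      intro k hk
      rw [add_mul, one_mul] at hk ⊢
      rw [ih k (by omega), step _ (by omega), add_assoc]
  have modEq : ∀ k k', k < N → k' < N → k ≡ k' [MOD 2 * d + 7] →
      zW (d + 3) ^ k * wW (d + 3) ^ q ∈ U → zW (d + 3) ^ k' * wW (d + 3) ^ q ∈ U := by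
    intro k k' hk hk' hkk h
    have e := Nat.mod_add_div' k (2 * d + 7)
    have e' := Nat.mod_add_div' k' (2 * d + 7)
    rw [← e, ← steps _ _ (by rw [e]; exact hk), show k % _ = k' % _ from hkk] at h
    rw [← e', ← steps _ _ (by rw [e']; exact hk')]
    exact h
  intro k hk
  rcases hk.eq_or_lt with rfl | hk
  · exact hU none
  · obtain ⟨r, hr, hmod⟩ :=
      exists_residuePair_modEq d (k + (2 * d + 6) * (p * i₀ + q * j₀))
    have hlt := residuePair_lt d r
    refine modEq _ k ?_ hk ?_ (hU (some ⟨r, hr⟩))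
    · have h1 : p * i₀ ≤ p * (2 * d + 4) := Nat.mul_le_mul_left p hi₀
      have h2 : q * j₀ ≤ q * d := Nat.mul_le_mul_left q hj₀
      rw [add_mul] at hN
      simp only [levelExp]
      omega
    · simp only [levelExp, add_assoc]
      have h3 := hmod.add_right (p * i₀ + q * j₀)
      rw [show k + (2 * d + 6) * (p * i₀ + q * j₀) + (p * i₀ + q * j₀)
        = k + (2 * d + 7) * (p * i₀ + q * j₀) by ring, add_assoc] at h3
      exact h3.trans (by simp [Nat.ModEq])

/-- The weight of a level is at most average; the defect is made explicit. -/
theorem sum_levelCost_le {d : ℕ} {l v : ℕ → ℤ} {i₀ j₀ : ℕ}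
    (hi : ∀ i ≤ 2 * d + 4, l i₀ ≤ l i) (hj : ∀ j ≤ d, v j₀ ≤ v j) {a b : ℚ}
    (ha : ∑ i ∈ range (2 * d + 5), (l i : ℚ) = (2 * d + 5) * a)
    (hb : ∑ j ∈ range (d + 1), (v j : ℚ) = (d + 1) * b) {p : ℕ} (hp : 1 ≤ p) (q : ℕ) :
    ∑ o, (levelCost d l v i₀ j₀ p q o : ℚ) + (a - l i₀)
      ≤ (2 * d + 8) * ((p + 2) * a + q * b) := by
  have hp' : (1 : ℚ) ≤ p := by exact_mod_cast hp
  set μ : ℕ → ℚ := fun i => l i - l i₀ with hμ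
  have hμ0 : ∀ i ≤ 2 * d + 4, 0 ≤ μ i := fun i h => by
    rw [hμ, sub_nonneg]
    exact_mod_cast hi i h
  have hres := sum_residuePair_le d μ fun i h => hμ0 i h.le
  set T := ∑ i ∈ range (2 * d + 4), μ i with hT
  have hT0 : 0 ≤ T := sum_nonneg fun i h => hμ0 i (mem_range.1 h).le
  have hM0 := hμ0 _ le_rfl
  have hTa : T + μ (2 * d + 4) = (2 * d + 5) * (a - l i₀) := by
    rw [hT, ← sum_range_succ, hμ, sum_sub_distrib, ha]
    simp
    ring
  set R := ∑ r ∈ range (2 * d + 7), (μ (residuePair d r).1 + μ (residuePair d r).2) with hR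
  have hκ : ((d : ℚ) + 1) * (v d - v j₀) ≤ (2 * d + 8) * ((d + 1) * (b - v j₀)) := by
    have h0 : ∀ j ∈ range (d + 1), (0 : ℚ) ≤ v j - v j₀ := fun j h => by
      rw [sub_nonneg]
      exact_mod_cast hj j (Nat.lt_succ_iff.1 (mem_range.1 h))
    have h1 := single_le_sum h0 (self_mem_range_succ d)
    have h2 := h0 d (self_mem_range_succ d)
    rw [sum_sub_distrib, hb, sum_const, card_range, nsmul_eq_mul] at h1
    push_cast at h1
    nlinarith [mul_nonneg (show (0 : ℚ) ≤ d by positivity) h2]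
  have hκ' : (v d : ℚ) - v j₀ ≤ (2 * d + 8) * (b - v j₀) := by
    have : (0 : ℚ) < d + 1 := by positivity
    nlinarith
  have hcost : ∑ o, (levelCost d l v i₀ j₀ p q o : ℚ)
      = (p + 2) * μ (2 * d + 4) + R + (2 * d + 8) * (p + 2) * l i₀
        + q * (v d - v j₀) + (2 * d + 8) * q * v j₀ := by
    rw [Fintype.sum_option, hR]
    simp only [levelCost, hμ]
    push_cast
    rw [Fin.sum_univ_eq_sum_range
      (fun r => (l (residuePair d r).1 + l (residuePair d r).2 + p * l i₀ + q * v j₀ : ℚ))]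
    simp only [sum_add_distrib, sum_sub_distrib, sum_const, card_range, nsmul_eq_mul]
    push_cast
    ring
  have hx : (p + 2) * μ (2 * d + 4) + R + (a - l i₀) ≤ (2 * d + 8) * (p + 2) * (a - l i₀) := by
    have hd : (0 : ℚ) < 2 * d + 5 := by positivity
    have hpT : 0 ≤ ((p : ℚ) - 1) * T := mul_nonneg (by linarith) hT0
    have hpM : 0 ≤ ((p : ℚ) - 1) * μ (2 * d + 4) := mul_nonneg (by linarith) hM0
    have hdT : 0 ≤ (d : ℚ) * (((p : ℚ) - 1) * T) := mul_nonneg (by positivity) hpT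
    refine le_of_mul_le_mul_left ?_ hd
    have e : (2 * d + 5) * ((2 * d + 8) * (p + 2) * (a - l i₀))
        = (2 * d + 8) * (p + 2) * (T + μ (2 * d + 4)) := by rw [hTa]; ring
    have e' : (2 * d + 5) * ((p + 2) * μ (2 * d + 4) + R + (a - l i₀))
        = (2 * d + 5) * (p + 2) * μ (2 * d + 4) + (2 * d + 5) * R + (T + μ (2 * d + 4)) := by
      rw [hTa]; ring
    rw [e, e']
    nlinarith
  have hy := mul_le_mul_of_nonneg_left hκ' (show (0 : ℚ) ≤ q by positivity)
  rw [hcost]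
  linarith

/-- The `y`-rich family: levels `q = 0, …, t` followed by all monomials of two, respectively one,
`x`-variables. If the average bound on its weight is negative, or zero with the `x`-weights not
constant, then it is a basis of negative weight. -/
theorem exists_isMonBasisW_of_levels {d t : ℕ} {wt : WIdx (d + 3) → ℤ} {l v : ℕ → ℤ}
    (hx : ∀ i ≤ 2 * d + 4, HasMon (d + 3) wt 1 i 0 (l i))
    (hy : ∀ j ≤ d, HasMon (d + 3) wt 1 j 1 (v j)) {i₀ j₀ : ℕ} (hi₀ : i₀ ≤ 2 * d + 4)
    (hj₀ : j₀ ≤ d) (hi : ∀ i ≤ 2 * d + 4, l i₀ ≤ l i) (hj : ∀ j ≤ d, v j₀ ≤ v j) {a b : ℚ}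
    (ha : ∑ i ∈ range (2 * d + 5), (l i : ℚ) = (2 * d + 5) * a)
    (hb : ∑ j ∈ range (d + 1), (v j : ℚ) = (d + 1) * b)
    (hneg : (2 * d + 8) * ((t + 1) * (t + 6) / 2 * a + t * (t + 1) / 2 * b)
      + (2 * (2 * d + 4) + (t + 1) * d + 1) * (2 * a + (t + 1) * b)
      + ((2 * d + 4) + (t + 2) * d + 1) * (a + (t + 2) * b) < (t + 1) * (a - l i₀)) :
    ∃ S : Finset (WDegMon (d + 3) (t + 3)), IsMonBasisW (d + 3) (t + 3) S ∧
      (∑ σ ∈ S, (σ.1.map wt).sum) < 0 := by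
  obtain ⟨c₂, h2, s2⟩ := hasFullRange_of_vars hx hy ha hb 2 (t + 1)
  obtain ⟨c₁, h1, s1⟩ := hasFullRange_of_vars hx hy ha hb 1 (t + 2)
  set N₂ := 2 * (2 * d + 4) + (t + 1) * d with hN₂
  set N₁ := 1 * (2 * d + 4) + (t + 2) * d with hN₁
  refine exists_isMonBasisW_of_family d (t + 3) wt
    (ι := (Fin (t + 1) × Option (Fin (2 * d + 7))) ⊕ (Fin (N₂ + 1) ⊕ Fin (N₁ + 1)))
    (Sum.elim (fun x => levelExp d i₀ j₀ (t - x.1 + 1) x.1 x.2)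
      (Sum.elim (fun k => (k : ℕ)) (fun k => (k : ℕ))))
    (Sum.elim (fun x => (x.1 : ℕ)) (Sum.elim (fun _ => t + 1) (fun _ => t + 2)))
    (Sum.elim (fun x => levelCost d l v i₀ j₀ (t - x.1 + 1) x.1 x.2)
      (Sum.elim (fun k => c₂ k) (fun k => c₁ k))) ?_ ?_ ?_ ?_
  · rintro (⟨⟨q, hq⟩, o⟩ | k | k)
    · have h := hasMon_level hx hy hi₀ hj₀ (t - q + 1) q o
      rwa [show t - q + 1 + 2 + q = t + 3 by omega] at h
    · have h := h2 k (Nat.lt_succ_iff.1 k.2)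
      rwa [show 2 + (t + 1) = t + 3 by ring] at h
    · have h := h1 k (Nat.lt_succ_iff.1 k.2)
      rwa [show 1 + (t + 2) = t + 3 by ring] at h
  · simp only [Fintype.card_sum, Fintype.card_prod, Fintype.card_fin, Fintype.card_option, hN₁, hN₂,
      show t + 3 - 1 = t + 2 by omega]
    ring
  · intro U hU
    have main : ∀ s q, q + s = t + 2 → ∀ k ≤ (s + 1) * (2 * d + 4) + q * d,
        zW (d + 3) ^ k * wW (d + 3) ^ q ∈ U := by
      intro s
      induction s using Nat.twoStepInduction with
      | zero =>
        intro q hq k hk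
        obtain rfl : q = t + 2 := by omega
        exact hU (Sum.inr (Sum.inr ⟨k, by omega⟩))
      | one =>
        intro q hq k hk
        obtain rfl : q = t + 1 := by omega
        exact hU (Sum.inr (Sum.inl ⟨k, by omega⟩))
      | more s ih _ =>
        intro q hq
        have e : t - q + 1 = s + 1 := by omega
        refine mem_of_level U (p := s + 1) hi₀ hj₀ (fun o => ?_) (ih (q + 2) (by omega))
        have h := hU (Sum.inl (⟨q, by omega⟩, o))
        simp only [Sum.elim_inl, e] at h
        exact h
    refine ⟨fun k hk => ?_, fun k hk => ?_⟩
    · simpa using main (t + 2) 0 (by omega) k (by simpa using hk)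
    · simpa using main (t + 1) 1 (by omega) k (by simpa using hk)
  · have hlev : ∀ q ∈ range (t + 1),
        ∑ o, (levelCost d l v i₀ j₀ (t - q + 1) q o : ℚ)
          ≤ (2 * d + 8) * ((t + 3) * a) + (2 * d + 8) * (b - a) * q - (a - l i₀) := by
      intro q hq
      have h := sum_levelCost_le hi hj ha hb (show 1 ≤ t - q + 1 by omega) q
      rw [mem_range] at hq
      push_cast [Nat.cast_sub (show q ≤ t by omega)] at h
      linarith
    have hgauss : ∑ q ∈ range (t + 1), (q : ℚ) = t * (t + 1) / 2 := by
      have h := sum_range_id_mul_two (t + 1)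
      rw [Nat.add_sub_cancel] at h
      have h' : ((∑ q ∈ range (t + 1), q : ℕ) : ℚ) * 2 = ((t + 1) * t : ℕ) := by exact_mod_cast h
      push_cast at h'
      linarith
    have hsum := sum_le_sum hlev
    rw [sum_sub_distrib, sum_add_distrib, sum_const, sum_const, card_range, ← mul_sum,
      hgauss] at hsum
    simp only [nsmul_eq_mul] at hsum
    have hgoal : ((∑ x : (Fin (t + 1) × Option (Fin (2 * d + 7))) ⊕ (Fin (N₂ + 1) ⊕ Fin (N₁ + 1)),
        Sum.elim (fun x : Fin (t + 1) × Option (Fin (2 * d + 7)) =>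
            levelCost d l v i₀ j₀ (t - x.1 + 1) x.1 x.2)
          (Sum.elim (fun k : Fin (N₂ + 1) => c₂ k) (fun k : Fin (N₁ + 1) => c₁ k)) x : ℤ) : ℚ)
        < 0 := by
      rw [Fintype.sum_sum_type, Fintype.sum_sum_type, Fintype.sum_prod_type]
      simp only [Sum.elim_inl, Sum.elim_inr]
      push_cast
      rw [Fin.sum_univ_eq_sum_range (fun q => ∑ o, (levelCost d l v i₀ j₀ (t - q + 1) q o : ℚ)),
        Fin.sum_univ_eq_sum_range (fun k => (c₂ k : ℚ)),
        Fin.sum_univ_eq_sum_range (fun k => (c₁ k : ℚ))]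
      push_cast [hN₁, hN₂] at s1 s2 hsum ⊢
      rw [← hN₁] at s1 ⊢
      rw [← hN₂] at s2 ⊢
      linarith
    exact_mod_cast hgoal

/-- If all `x`-weights vanish and the `y`-weights sum to zero without all vanishing, there is a
basis of negative weight. -/
theorem exists_isMonBasisW_of_x_weights_zero {d m : ℕ} (hm : 2 ≤ m) {wt : WIdx (d + 3) → ℤ}
    {v : ℕ → ℤ} (hx : ∀ i ≤ 2 * d + 4, HasMon (d + 3) wt 1 i 0 0)
    (hy : ∀ j ≤ d, HasMon (d + 3) wt 1 j 1 (v j)) {j₀ : ℕ} (hj₀ : j₀ ≤ d) (hneg : v j₀ < 0)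
    (hv : ∑ j ∈ range (d + 1), v j = 0) :
    ∃ S : Finset (WDegMon (d + 3) m), IsMonBasisW (d + 3) m S ∧
      (∑ σ ∈ S, (σ.1.map wt).sum) < 0 := by
  have hxs : ∀ p, ∀ k ≤ p * (2 * d + 4), HasMon (d + 3) wt p k 0 0 := by
    intro p
    induction p with
    | zero =>
      intro k hk
      obtain rfl : k = 0 := by omega
      exact HasMon.zero _ _
    | succ p ih =>
      intro k hk
      rw [add_mul] at hk
      have h := (ih (k - min k (2 * d + 4)) (by omega)).add (hx (min k (2 * d + 4)) (by omega))
      rwa [show k - min k (2 * d + 4) + min k (2 * d + 4) = k by omega] at h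
  obtain ⟨n, rfl⟩ : ∃ n, m = n + 1 := ⟨m - 1, by omega⟩
  obtain ⟨e, rfl⟩ := Nat.exists_eq_add_of_le hj₀
  set P := n * (2 * (j₀ + e) + 4) with hP
  have hP0 : 0 < P := Nat.mul_pos (by omega) (by omega)
  refine exists_isMonBasisW_of_normal (j₀ + e) (n + 1) wt (fun _ => 0)
    (fun k => v (if k < j₀ then k else if k < j₀ + (P + 1) then j₀ else k - P))
    (fun k hk => hxs _ k hk) (fun k hk => ?_) ?_
  · rw [Nat.add_sub_cancel, ← hP] at hk
    set j := if k < j₀ then k else if k < j₀ + (P + 1) then j₀ else k - P with hj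
    have hjk : j ≤ k ∧ k - j ≤ P ∧ j ≤ j₀ + e := by
      rw [hj]
      split_ifs <;> omega
    have h := (hxs n (k - j) hjk.2.1).add (hy j hjk.2.2)
    rwa [Nat.sub_add_cancel hjk.1, zero_add, zero_add] at h
  · have hsplit : (n + 1 - 1) * (2 * (j₀ + e) + 4) + (j₀ + e) + 1 = j₀ + (P + 1) + e := by
      rw [Nat.add_sub_cancel, ← hP]
      ring
    have h1 : ∀ k ∈ range j₀, v (if k < j₀ then k else if k < j₀ + (P + 1) then j₀ else k - P)
        = v k := fun k hk => by rw [if_pos (mem_range.1 hk)]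
    have h2 : ∀ k ∈ range (P + 1), v (if j₀ + k < j₀ then j₀ + k
        else if j₀ + k < j₀ + (P + 1) then j₀ else j₀ + k - P) = v j₀ := fun k hk => by
      rw [mem_range] at hk
      rw [if_neg (by omega), if_pos (by omega)]
    have h3 : ∀ k ∈ range e, v (if j₀ + (P + 1) + k < j₀ then j₀ + (P + 1) + k
        else if j₀ + (P + 1) + k < j₀ + (P + 1) then j₀ else j₀ + (P + 1) + k - P)
        = v (j₀ + 1 + k) := fun k _ => by
      rw [if_neg (by omega), if_neg (by omega)]
      congr 1
      omega
    rw [sum_const_zero, zero_add, hsplit, sum_range_add, sum_range_add, sum_congr rfl h1,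
      sum_congr rfl h2, sum_congr rfl h3, sum_const, card_range, nsmul_eq_mul]
    rw [show j₀ + e + 1 = j₀ + 1 + e by ring, sum_range_add, sum_range_succ] at hv
    have hP' : (P : ℤ) * v j₀ < 0 := mul_neg_of_pos_of_neg (by exact_mod_cast hP0) hneg
    push_cast
    linarith

/-- Combinatorial content of Theorem 7.3 / Corollary 5.19 (case `m ≥ 3`). -/
theorem wiman_stable (g m : ℕ) (hg : 3 ≤ g) (hm : 3 ≤ m)
    (lam : Fin (2 * g - 1) → ℤ) (nu : Fin (g - 2) → ℤ)
    (hnz : ¬(lam = 0 ∧ nu = 0))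
    (hsum : (∑ i, lam i) + (∑ j, nu j) = 0) :
    ∃ S : Finset (WDegMon g m), IsMonBasisW g m S ∧
      (∑ σ ∈ S, (σ.1.map (Sum.elim lam nu)).sum) < 0 := by
  obtain ⟨d, rfl⟩ : ∃ d, g = d + 3 := ⟨g - 3, by omega⟩
  obtain ⟨t, rfl⟩ : ∃ t, m = t + 3 := ⟨m - 3, by omega⟩
  set l : ℕ → ℤ := fun i => if h : i < 2 * (d + 3) - 1 then lam ⟨i, h⟩ else 0 with hl
  set v : ℕ → ℤ := fun j => if h : j < d + 3 - 2 then nu ⟨j, h⟩ else 0 with hv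
  have hlam : ∀ i : Fin (2 * (d + 3) - 1), l i = lam i := fun i => by simp [hl]
  have hnu : ∀ j : Fin (d + 3 - 2), v j = nu j := fun j => by simp only [hv, j.2, dif_pos]
  have hx : ∀ i ≤ 2 * d + 4, HasMon (d + 3) (Sum.elim lam nu) 1 i 0 (l i) := fun i hi =>
    ⟨{Sum.inl ⟨i, by omega⟩}, by simp, by simp [varW], by simpa using (hlam _).symm⟩
  have hy : ∀ j ≤ d, HasMon (d + 3) (Sum.elim lam nu) 1 j 1 (v j) := fun j hj =>
    ⟨{Sum.inr ⟨j, by omega⟩}, by simp, by simp [varW], by simpa using (hnu _).symm⟩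
  have hsum' : ∑ i ∈ range (2 * d + 5), l i + ∑ j ∈ range (d + 1), v j = 0 := by
    rw [← hsum, ← sum_congr rfl fun i _ => hlam i, ← sum_congr rfl fun j _ => hnu j,
      Fin.sum_univ_eq_sum_range, Fin.sum_univ_eq_sum_range]
    rfl
  obtain ⟨i₀, hi₀, hi⟩ := exists_min_image (range (2 * d + 5)) l ⟨0, by simp⟩
  obtain ⟨j₀, hj₀, hj⟩ := exists_min_image (range (d + 1)) v ⟨0, by simp⟩
  have hi₀' := Nat.lt_succ_iff.1 (mem_range.1 hi₀)
  have hj₀' := Nat.lt_succ_iff.1 (mem_range.1 hj₀)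
  have hi' : ∀ i ≤ 2 * d + 4, l i₀ ≤ l i := fun i h => hi i (mem_range.2 (Nat.lt_succ_iff.2 h))
  have hj' : ∀ j ≤ d, v j₀ ≤ v j := fun j h => hj j (mem_range.2 (Nat.lt_succ_iff.2 h))
  set u : ℚ := (∑ i ∈ range (2 * d + 5), (l i : ℚ)) / ((2 * d + 5) * (d + 1)) with hu
  have ha : ∑ i ∈ range (2 * d + 5), (l i : ℚ) = (2 * d + 5) * ((d + 1) * u) := by
    rw [hu]
    field_simp
  have hb : ∑ j ∈ range (d + 1), (v j : ℚ) = (d + 1) * (-(2 * d + 5) * u) := by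
    have : (∑ i ∈ range (2 * d + 5), (l i : ℚ)) + ∑ j ∈ range (d + 1), (v j : ℚ) = 0 := by
      exact_mod_cast hsum'
    linarith
  have hmin : (l i₀ : ℚ) ≤ (d + 1) * u := by
    have h := card_nsmul_le_sum (range (2 * d + 5)) (fun i => (l i : ℚ)) (l i₀)
      fun i h => by exact_mod_cast hi i h
    rw [ha, card_range, nsmul_eq_mul] at h
    push_cast at h
    exact le_of_mul_le_mul_left h (by positivity)
  have hd0 : (0 : ℚ) ≤ d := by positivity
  have ht0 : (0 : ℚ) ≤ t := by positivity
  rcases lt_trichotomy u 0 with hu0 | hu0 | hu0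
  · obtain ⟨c₀, h0, s0⟩ := hasFullRange_of_vars hx hy ha hb (t + 3) 0
    obtain ⟨c₁, h1, s1⟩ := hasFullRange_of_vars hx hy ha hb (t + 2) 1
    refine exists_isMonBasisW_of_normal d (t + 3) _ c₀ c₁ (by simpa using h0) (by simpa using h1) ?_
    rw [zero_mul, add_zero] at s0
    rw [one_mul] at s1
    rw [show t + 3 - 1 = t + 2 by omega]
    have hgoal : (∑ k ∈ range ((t + 3) * (2 * d + 4) + 1), (c₀ k : ℚ))
        + ∑ k ∈ range ((t + 2) * (2 * d + 4) + d + 1), (c₁ k : ℚ) < 0 := by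
      refine (add_le_add s0 s1).trans_lt ?_
      push_cast
      have hpos : 0 < ((t : ℚ) + 3) * (2 * d + 4) * (t + 3) * (d + 1) + (t + 3) * (d + 1)
          + ((t + 2) * (2 * d + 4) + d + 1) * ((t + 2) * (d + 1) - (2 * d + 5)) := by
        ring_nf
        positivity
      linarith [mul_neg_of_pos_of_neg hpos hu0]
    exact_mod_cast hgoal
  · rw [hu0, mul_zero] at ha hb hmin
    by_cases hconst : ∀ i ≤ 2 * d + 4, l i = 0
    · have hv0 : ∑ j ∈ range (d + 1), v j = 0 := by
        rwa [sum_eq_zero fun i h => hconst i (Nat.lt_succ_iff.1 (mem_range.1 h)), zero_add]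
          at hsum'
      refine exists_isMonBasisW_of_x_weights_zero (by omega)
        (fun i h => by simpa only [hconst i h] using hx i h) hy hj₀' ?_ hv0
      by_contra! hneg
      refine hnz ⟨funext fun i => ?_, funext fun j => ?_⟩
      · rw [← hlam, hconst i (by omega), Pi.zero_apply]
      · rw [← hnu, Pi.zero_apply]
        exact (sum_eq_zero_iff_of_nonneg fun j h => hneg.trans (hj j h)).1 hv0 j
          (mem_range.2 (by omega))
    · refine exists_isMonBasisW_of_levels hx hy hi₀' hj₀' hi' hj' ha hb ?_
      have hl0 : l i₀ < 0 := by
        by_contra! hneg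
        rw [mul_zero] at ha
        exact hconst fun i h => (sum_eq_zero_iff_of_nonneg fun i h => hneg.trans (hi i h)).1
          (by exact_mod_cast ha) i (mem_range.2 (Nat.lt_succ_iff.2 h))
      have hl0' : (l i₀ : ℚ) < 0 := by exact_mod_cast hl0
      have := mul_pos (show (0 : ℚ) < t + 1 by positivity) (neg_pos.2 hl0')
      linarith
  · refine exists_isMonBasisW_of_levels hx hy hi₀' hj₀' hi' hj' ha hb ?_
    refine lt_of_lt_of_le ?_ (mul_nonneg (by positivity) (sub_nonneg.2 hmin))
    have hpos : 0 < ((2 : ℚ) * d + 8) * (t * (t + 1) / 2 * (2 * d + 5)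
          - (t + 1) * (t + 6) / 2 * (d + 1))
        + (2 * (2 * d + 4) + (t + 1) * d + 1) * ((t + 1) * (2 * d + 5) - 2 * (d + 1))
        + ((2 * d + 4) + (t + 2) * d + 1) * ((t + 2) * (2 * d + 5) - (d + 1)) := by
      ring_nf
      positivity
    linarith [mul_pos hpos hu0]

end
end
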